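/- arXiv:1410.5654 — 4 statements merged into one kernel-verified Lean document; each statement's English description precedes it below -/
import Mathlib

section
/- Let K be an algebraically closed field of characteristic 0. Let t : ℕ → ℕ satisfy: t(0)=1, t(1)=2, there exists n ≥ 2 with t(i) = i+1 for all 0 ≤ i ≤ n−1, t(j) ≥ t(j+1) for all j ≥ n−1, and t(j) = 0 for all sufficiently large j. Define the jump indices e(j) = t(j−1) − t(j) for j ≥ n and e(j) = 0 for j < n. Then the following are equivalent: (a) there exist finitely many homogeneous ideals J_1, …, J_m of K[x,y] such that every homogeneous ideal I of K[x,y] with t_I = t satisfies φ(I) = J_i for some linear change of variables φ and some i; (b) Σ_{j ≥ n} (e(j)+1)·e(j+1) ≤ 3. -/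
open MvPolynomial

noncomputable section

/-- The polynomial ring `K[x,y]`. -/
abbrev Pxy (K : Type*) [Field K] := MvPolynomial (Fin 2) K

/-- An ideal of `K[x,y]` is homogeneous if it contains all homogeneous
components of each of its elements. -/
def IsHomog {K : Type*} [Field K] (I : Ideal (Pxy K)) : Prop :=
  ∀ f ∈ I, ∀ k : ℕ, homogeneousComponent k f ∈ I

/-- The Hilbert function of an ideal:
`t_I(k) = dim_K (K[x,y]_k / (I ∩ K[x,y]_k))`. -/
def hilb (K : Type*) [Field K] (I : Ideal (Pxy K)) (k : ℕ) : ℕ :=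
  Module.finrank K
    (homogeneousSubmodule (Fin 2) K k ⧸
      Submodule.comap (homogeneousSubmodule (Fin 2) K k).subtype (I.restrictScalars K))

/-- A linear change of variables: a `K`-algebra automorphism sending the
variables to homogeneous polynomials of degree 1. -/
def IsLinChange {K : Type*} [Field K] (φ : Pxy K ≃ₐ[K] Pxy K) : Prop :=
  ∀ i : Fin 2, (φ (X i)).IsHomogeneous 1

/-- `t` is of homogeneous finite type: there are finitely many homogeneous ideals
`J₁, …, Jₘ` such that every homogeneous ideal `I` with Hilbert function `t` is
mapped onto some `Jᵢ` by a linear change of variables. -/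
def HomogFiniteType (K : Type*) [Field K] (t : ℕ → ℕ) : Prop :=
  ∃ S : Set (Ideal (Pxy K)), S.Finite ∧ (∀ J ∈ S, IsHomog J) ∧
    ∀ I : Ideal (Pxy K), IsHomog I → (∀ k, hilb K I k = t k) →
      ∃ φ : Pxy K ≃ₐ[K] Pxy K, IsLinChange φ ∧ Ideal.map φ I ∈ S

/-- The jump indices of a Hilbert–Samuel sequence `t` (with respect to `n`):
`e j = t (j-1) - t j` for `j ≥ n`, and `e j = 0` for `j < n`. -/
def jump (t : ℕ → ℕ) (n j : ℕ) : ℕ := if n ≤ j then t (j - 1) - t j else 0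

/-- Binary forms of degree `k`. -/
abbrev forms (K : Type*) [Field K] (k : ℕ) : Submodule K (Pxy K) :=
  homogeneousSubmodule (Fin 2) K k

/-- The degree `k` part of an ideal. -/
def layer {K : Type*} [Field K] (I : Ideal (Pxy K)) (k : ℕ) : Submodule K (Pxy K) :=
  forms K k ⊓ I.restrictScalars K

/-- The multiples of `f` by forms of degree `m`. -/
def mulForms {K : Type*} [Field K] (f : Pxy K) (m : ℕ) : Submodule K (Pxy K) :=
  (forms K m).map (LinearMap.mulLeft K f)

section Basic

variable {K : Type*} [Field K]

lemma finrank_map_eq_of_injective {V W : Type*} [AddCommGroup V] [Module K V] [AddCommGroup W]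
    [Module K W] {f : V →ₗ[K] W} (hf : Function.Injective f) (p : Submodule K V) :
    Module.finrank K (p.map f) = Module.finrank K p :=
  (Submodule.equivMapOfInjective f hf p).finrank_eq.symm

/-- Dehomogenization `g(x, y) ↦ g(x, 1)`. -/
def dehom (K : Type*) [Field K] : Pxy K →ₐ[K] Polynomial K :=
  MvPolynomial.aeval ![Polynomial.X, 1]

@[simp] lemma dehom_X_zero : dehom K (X 0) = Polynomial.X := by simp [dehom]

@[simp] lemma dehom_X_one : dehom K (X 1) = 1 := by simp [dehom]

lemma homogenize_dehom {g : Pxy K} {k : ℕ} (hg : g ∈ forms K k) :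
    (dehom K g).homogenize k = g :=
  Polynomial.homogenize_eq_of_isHomogeneous hg rfl

lemma dehom_injOn {k : ℕ} : Set.InjOn (dehom K) (forms K k : Set (Pxy K)) := by
  intro f hf g hg h
  rw [← homogenize_dehom hf, ← homogenize_dehom hg, h]

lemma dehom_homogenize {p : Polynomial K} {k : ℕ} (hp : p.natDegree ≤ k) :
    dehom K (p.homogenize k) = p :=
  Polynomial.aeval_homogenize_X_one p hp

lemma dehom_ne_zero {g : Pxy K} {k : ℕ} (hg : g ∈ forms K k) (h0 : g ≠ 0) : dehom K g ≠ 0 := by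
  intro h
  exact h0 (dehom_injOn hg (Submodule.zero_mem _) (by simpa using h))

lemma natDegree_dehom_le {g : Pxy K} {k : ℕ} (hg : g ∈ forms K k) :
    (dehom K g).natDegree ≤ k := by
  rw [← homogenize_dehom hg]
  simp only [Polynomial.homogenize, map_sum]
  refine Polynomial.natDegree_sum_le_of_forall_le _ _ fun kl hkl => ?_
  replace hkl : kl.1 + kl.2 = k := Finset.HasAntidiagonal.mem_antidiagonal.1 hkl
  simp only [dehom, aeval_monomial, ← Polynomial.C_eq_algebraMap]
  refine (Polynomial.natDegree_C_mul_le _ _).trans ?_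
  rw [Finsupp.prod_fintype _ _ (by simp)]
  simp
  omega

/-- Dehomogenization identifies binary forms of degree `k` with polynomials of degree `≤ k`. -/
def formsEquiv (K : Type*) [Field K] (k : ℕ) : forms K k ≃ₗ[K] Polynomial.degreeLT K (k + 1) :=
  LinearEquiv.ofBijective
    (((dehom K).toLinearMap.domRestrict (forms K k)).codRestrict _ (fun g => by
      rw [Polynomial.degreeLT_succ_eq_degreeLE, Polynomial.mem_degreeLE]
      exact Polynomial.natDegree_le_iff_degree_le.1 (natDegree_dehom_le g.2)))
    ⟨fun f g h => Subtype.ext (dehom_injOn f.2 g.2 (congrArg Subtype.val h)), fun p => by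
      have hp : (p : Polynomial K).natDegree ≤ k := by
        obtain ⟨p, this⟩ := p
        rw [Polynomial.degreeLT_succ_eq_degreeLE, Polynomial.mem_degreeLE] at this
        exact Polynomial.natDegree_le_iff_degree_le.2 this
      exact ⟨⟨_, Polynomial.isHomogeneous_homogenize (n := k) (p : Polynomial K)⟩,
        Subtype.ext (dehom_homogenize hp)⟩⟩

instance (k : ℕ) : FiniteDimensional K (forms K k) :=
  have : FiniteDimensional K (Polynomial.degreeLT K (k + 1)) :=
    (Polynomial.degreeLTEquiv K (k + 1)).symm.finiteDimensional
  (formsEquiv K k).symm.finiteDimensional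

@[simp] lemma finrank_forms (k : ℕ) : Module.finrank K (forms K k) = k + 1 := by
  rw [((formsEquiv K k).trans (Polynomial.degreeLTEquiv K (k + 1))).finrank_eq]
  simp

lemma finiteDimensional_of_le_forms {V : Submodule K (Pxy K)} {k : ℕ} (hV : V ≤ forms K k) :
    FiniteDimensional K V :=
  Submodule.finiteDimensional_of_le hV

lemma forms_mul {f g : Pxy K} {a b : ℕ} (hf : f ∈ forms K a) (hg : g ∈ forms K b) :
    f * g ∈ forms K (a + b) :=
  IsHomogeneous.mul hf hg

lemma forms_pow {f : Pxy K} {a : ℕ} (hf : f ∈ forms K a) (m : ℕ) : f ^ m ∈ forms K (a * m) :=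
  IsHomogeneous.pow hf m

lemma forms_pow_one {f : Pxy K} (hf : f ∈ forms K 1) (m : ℕ) : f ^ m ∈ forms K m := by
  simpa using forms_pow hf m

lemma X_mem_forms (i : Fin 2) : (X i : Pxy K) ∈ forms K 1 := isHomogeneous_X K i

lemma one_mem_forms : (1 : Pxy K) ∈ forms K 0 := isHomogeneous_one (Fin 2) K

lemma mem_forms_zero {f : Pxy K} : f ∈ forms K 0 ↔ ∃ c, f = C c := by
  constructor
  · intro h
    refine ⟨coeff 0 f, ?_⟩
    rw [← homogeneousComponent_zero]
    exact (homogeneousComponent_eq_self h).symm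
  · rintro ⟨c, rfl⟩
    exact isHomogeneous_C _ c

/-- The linear form `a x + b y`. -/
def lin (a b : K) : Pxy K := C a * X 0 + C b * X 1

lemma lin_mem_forms (a b : K) : lin a b ∈ forms K 1 :=
  Submodule.add_mem _ (isHomogeneous_C_mul_X a 0) (isHomogeneous_C_mul_X b 1)

lemma lin_one_zero : lin (1 : K) 0 = X 0 := by simp [lin]

lemma lin_zero_one : lin (0 : K) 1 = X 1 := by simp [lin]

lemma C_mul_lin (c a b : K) : C c * lin a b = lin (c * a) (c * b) := by
  simp [lin]; ring

lemma lin_add_lin (a b c d : K) : lin a b + lin c d = lin (a + c) (b + d) := by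
  simp [lin]; ring

lemma coeff_lin_zero (a b : K) : coeff (Finsupp.single 0 1) (lin a b) = a := by
  simp [lin, coeff_C_mul, coeff_X, Finsupp.single_left_inj]

lemma coeff_lin_one (a b : K) : coeff (Finsupp.single 1 1) (lin a b) = b := by
  simp [lin, coeff_C_mul, coeff_X, Finsupp.single_left_inj]

lemma lin_inj {a b c d : K} : lin a b = lin c d ↔ a = c ∧ b = d := by
  refine ⟨fun h => ⟨?_, ?_⟩, fun h => by rw [h.1, h.2]⟩
  · rw [← coeff_lin_zero a b, h, coeff_lin_zero]
  · rw [← coeff_lin_one a b, h, coeff_lin_one]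

lemma lin_eq_zero {a b : K} : lin a b = 0 ↔ a = 0 ∧ b = 0 := by
  rw [show (0 : Pxy K) = lin 0 0 by simp [lin], lin_inj]

lemma mem_forms_one {f : Pxy K} : f ∈ forms K 1 ↔ ∃ a b, f = lin a b := by
  constructor
  · intro h
    have := h
    rw [forms, homogeneousSubmodule_one_eq_span_X, Submodule.mem_span_range_iff_exists_fun] at this
    obtain ⟨c, rfl⟩ := this
    exact ⟨c 0, c 1, by simp [lin, smul_eq_C_mul]⟩
  · rintro ⟨a, b, rfl⟩
    exact lin_mem_forms a b

lemma X_prime (i : Fin 2) : Prime (X i : Pxy K) := MvPolynomial.X_prime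

lemma X_not_dvd_X {i j : Fin 2} (h : i ≠ j) : ¬ (X i : Pxy K) ∣ X j := by
  rw [MvPolynomial.X_dvd_X]; simpa using h

lemma dvd_of_dvd_mul_X_pow {f g : Pxy K} {a b : ℕ} (h0 : g ∣ f * X 0 ^ a) (h1 : g ∣ f * X 1 ^ b) :
    g ∣ f := by
  obtain ⟨u, hu⟩ := h0
  obtain ⟨v, hv⟩ := h1
  by_cases hg : g = 0
  · subst hg
    simp only [zero_mul, mul_eq_zero, pow_eq_zero_iff', X_ne_zero, false_and, or_false] at hu
    simp [hu]
  have h : u * X 1 ^ b = v * X 0 ^ a := by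
    apply mul_left_cancel₀ hg
    linear_combination (X 0 ^ a) * hv - (X 1 ^ b) * hu
  have h2 : (X 0 : Pxy K) ^ a ∣ u :=
    (X_prime 0).pow_dvd_of_dvd_mul_right a
      (fun h => X_not_dvd_X (i := 0) (j := 1) (by decide) ((X_prime 0).dvd_of_dvd_pow h))
      ⟨v, by rw [h]; ring⟩
  obtain ⟨w, rfl⟩ := h2
  refine ⟨w, ?_⟩
  apply mul_right_cancel₀ (pow_ne_zero a (X_ne_zero (R := K) (0 : Fin 2)))
  rw [hu]; ring

lemma homogeneousComponent_mul_of_mem {f : Pxy K} {d : ℕ} (hf : f ∈ forms K d) (m : ℕ)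
    (h : Pxy K) : homogeneousComponent (d + m) (f * h) = f * homogeneousComponent m h := by
  conv_lhs => rw [← sum_homogeneousComponent h, Finset.mul_sum, map_sum]
  have : ∀ i ∈ Finset.range (h.totalDegree + 1),
      homogeneousComponent (d + m) (f * homogeneousComponent i h) =
        if i = m then f * homogeneousComponent m h else 0 := by
    intro i _
    rw [homogeneousComponent_of_mem (forms_mul hf (homogeneousComponent_mem i h))]
    by_cases him : i = m
    · simp [him]
    · rw [if_neg (by omega), if_neg him]
  rw [Finset.sum_congr rfl this, Finset.sum_ite_eq']
  split_ifs with hm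
  · rfl
  · rw [homogeneousComponent_eq_zero, mul_zero]
    simpa using hm

lemma mem_mulForms {f g : Pxy K} {m : ℕ} : g ∈ mulForms f m ↔ ∃ h ∈ forms K m, f * h = g := by
  simp [mulForms]

lemma mul_mem_mulForms {f h : Pxy K} {m : ℕ} (hh : h ∈ forms K m) : f * h ∈ mulForms f m :=
  mem_mulForms.2 ⟨h, hh, rfl⟩

lemma mulForms_le {f : Pxy K} {d m k : ℕ} (hf : f ∈ forms K d) (hk : d + m = k) :
    mulForms f m ≤ forms K k := by
  intro g hg
  obtain ⟨h, hh, rfl⟩ := mem_mulForms.1 hg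
  exact hk ▸ forms_mul hf hh

lemma finrank_map_mulLeft {f : Pxy K} (hf : f ≠ 0) (V : Submodule K (Pxy K)) :
    Module.finrank K (V.map (LinearMap.mulLeft K f)) = Module.finrank K V :=
  finrank_map_eq_of_injective (fun _ _ h => mul_left_cancel₀ hf h) V

lemma finrank_mulForms {f : Pxy K} (hf : f ≠ 0) (m : ℕ) :
    Module.finrank K (mulForms f m) = m + 1 := by
  rw [mulForms, finrank_map_mulLeft hf, finrank_forms]

lemma mem_mulForms_of_dvd {f g : Pxy K} {d m : ℕ} (hf : f ∈ forms K d)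
    (hg : g ∈ forms K (d + m)) (h : f ∣ g) : g ∈ mulForms f m := by
  obtain ⟨h, rfl⟩ := h
  refine mem_mulForms.2 ⟨homogeneousComponent m h, homogeneousComponent_mem m h, ?_⟩
  rw [← homogeneousComponent_mul_of_mem hf, homogeneousComponent_eq_self hg]

lemma mulForms_one (m : ℕ) : mulForms (1 : Pxy K) m = forms K m := by
  ext g; simp [mem_mulForms]

lemma mulForms_C_mul {c : K} (hc : c ≠ 0) (f : Pxy K) (m : ℕ) :
    mulForms (C c * f) m = mulForms f m := by
  ext g
  simp only [mem_mulForms]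
  constructor
  · rintro ⟨h, hh, rfl⟩
    exact ⟨C c * h, by rw [C_mul']; exact Submodule.smul_mem _ _ hh, by ring⟩
  · rintro ⟨h, hh, rfl⟩
    refine ⟨C c⁻¹ * h, by rw [C_mul']; exact Submodule.smul_mem _ _ hh, ?_⟩
    rw [show C c * f * (C c⁻¹ * h) = (C c * C c⁻¹) * (f * h) by ring, ← C_mul, mul_inv_cancel₀ hc]
    simp

lemma exists_forms_succ {g : Pxy K} {k : ℕ} (hg : g ∈ forms K (k + 1)) :
    ∃ h ∈ forms K k, ∃ c : K, g = X 1 * h + C c * X 0 ^ (k + 1) := by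
  have hle : mulForms (X 1 : Pxy K) k ⊔ K ∙ (X 0 : Pxy K) ^ (k + 1) = forms K (k + 1) := by
    apply Submodule.eq_of_le_of_finrank_le
    · refine sup_le (mulForms_le (X_mem_forms 1) (by omega)) ?_
      rw [Submodule.span_singleton_le_iff_mem]
      exact forms_pow_one (X_mem_forms 0) _
    · have hd : Disjoint (mulForms (X 1 : Pxy K) k) (K ∙ (X 0 : Pxy K) ^ (k + 1)) := by
        rw [Submodule.disjoint_span_singleton' (pow_ne_zero _ (X_ne_zero _))]
        intro h
        obtain ⟨u, -, hu⟩ := mem_mulForms.1 h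
        exact X_not_dvd_X (K := K) (i := 1) (j := 0) (by decide)
          ((X_prime 1).dvd_of_dvd_pow ⟨u, hu.symm⟩)
      have := finiteDimensional_of_le_forms (mulForms_le (X_mem_forms (K := K) 1) (m := k) rfl)
      have := Submodule.finrank_sup_add_finrank_inf_eq (mulForms (X 1 : Pxy K) k)
        (K ∙ (X 0 : Pxy K) ^ (k + 1))
      rw [hd.eq_bot, finrank_bot, finrank_mulForms (X_ne_zero _),
        finrank_span_singleton (pow_ne_zero _ (X_ne_zero _))] at this
      rw [finrank_forms]
      omega
  rw [← hle, Submodule.mem_sup] at hg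
  obtain ⟨u, hu, v, hv, rfl⟩ := hg
  obtain ⟨h, hh, rfl⟩ := mem_mulForms.1 hu
  obtain ⟨c, rfl⟩ := Submodule.mem_span_singleton.1 hv
  exact ⟨h, hh, c, by rw [smul_eq_C_mul]⟩

end Basic

section Layers

variable {K : Type*} [Field K]

lemma mem_layer {I : Ideal (Pxy K)} {k : ℕ} {g : Pxy K} :
    g ∈ layer I k ↔ g ∈ forms K k ∧ g ∈ I := Iff.rfl

lemma layer_le (I : Ideal (Pxy K)) (k : ℕ) : layer I k ≤ forms K k := inf_le_left

instance (I : Ideal (Pxy K)) (k : ℕ) : FiniteDimensional K (layer I k) :=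
  finiteDimensional_of_le_forms (layer_le I k)

lemma finrank_layer_add_hilb (I : Ideal (Pxy K)) (k : ℕ) :
    Module.finrank K (layer I k) + hilb K I k = k + 1 := by
  have h := Submodule.finrank_quotient_add_finrank
    (Submodule.comap (homogeneousSubmodule (Fin 2) K k).subtype (I.restrictScalars K))
  rw [← Submodule.finrank_map_subtype_eq, Submodule.map_comap_subtype] at h
  rw [finrank_forms] at h
  rw [← h, add_comm]
  rfl

lemma mul_mem_layer {I : Ideal (Pxy K)} {k m l : ℕ} {f g : Pxy K} (hf : f ∈ forms K m)
    (hg : g ∈ layer I k) (hl : k + m = l) : f * g ∈ layer I l :=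
  ⟨by rw [← hl, add_comm]; exact forms_mul hf hg.1, I.mul_mem_left f hg.2⟩

lemma IsHomog.ext {I J : Ideal (Pxy K)} (hI : IsHomog I) (hJ : IsHomog J)
    (h : ∀ k, layer I k = layer J k) : I = J := by
  have key : ∀ {I J : Ideal (Pxy K)}, IsHomog I → (∀ k, layer I k = layer J k) → I ≤ J := by
    intro I J hI h f hf
    rw [← sum_homogeneousComponent f]
    refine J.sum_mem fun k _ => ?_
    have : homogeneousComponent k f ∈ layer I k := ⟨homogeneousComponent_mem k f, hI f hf k⟩
    rw [h] at this
    exact this.2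
  exact le_antisymm (key hI h) (key hJ fun k => (h k).symm)

/-- The homogeneous ideal with prescribed graded pieces. -/
def idealOfLayers (A : ℕ → Submodule K (Pxy K))
    (hX : ∀ k i, ∀ f ∈ A k, X i * f ∈ A (k + 1)) : Ideal (Pxy K) where
  carrier := {f | ∀ k, homogeneousComponent k f ∈ A k}
  add_mem' {f g} hf hg k := by rw [map_add]; exact Submodule.add_mem _ (hf k) (hg k)
  zero_mem' k := by rw [map_zero]; exact Submodule.zero_mem _
  smul_mem' c f hf := by
    induction c using MvPolynomial.induction_on generalizing f with
    | C a =>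
      intro k
      rw [smul_eq_mul, homogeneousComponent_C_mul, C_mul']
      exact Submodule.smul_mem _ _ (hf k)
    | add p q hp hq =>
      intro k
      rw [add_smul, map_add]
      exact Submodule.add_mem _ (hp f hf k) (hq f hf k)
    | mul_X p i hp =>
      rw [smul_eq_mul, mul_assoc, ← smul_eq_mul]
      refine hp _ fun k => ?_
      cases k with
      | zero =>
        have : coeff 0 (X i * f) = 0 := by
          rw [← constantCoeff_eq, map_mul, constantCoeff_X, zero_mul]
        rw [homogeneousComponent_zero, this, C_0]
        exact Submodule.zero_mem _
      | succ k =>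
        rw [add_comm, homogeneousComponent_mul_of_mem (X_mem_forms i), add_comm]
        exact hX k i _ (hf k)

lemma isHomog_idealOfLayers (A : ℕ → Submodule K (Pxy K))
    (hX : ∀ k i, ∀ f ∈ A k, X i * f ∈ A (k + 1)) : IsHomog (idealOfLayers A hX) := by
  intro f hf k j
  rw [homogeneousComponent_of_mem (homogeneousComponent_mem k f)]
  split_ifs with h
  · exact h ▸ hf k
  · exact Submodule.zero_mem _

lemma layer_idealOfLayers (A : ℕ → Submodule K (Pxy K)) (hA : ∀ k, A k ≤ forms K k)
    (hX : ∀ k i, ∀ f ∈ A k, X i * f ∈ A (k + 1)) (k : ℕ) :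
    layer (idealOfLayers A hX) k = A k := by
  ext g
  constructor
  · rintro ⟨h1, h2⟩
    have := h2 k
    rwa [homogeneousComponent_eq_self h1] at this
  · intro hg
    refine ⟨hA k hg, fun j => ?_⟩
    rw [homogeneousComponent_of_mem (hA k hg)]
    split_ifs with h
    · exact h ▸ hg
    · exact Submodule.zero_mem _

end Layers

section LinChange

variable {K : Type*} [Field K]

lemma IsLinChange.map_mem_forms {φ : Pxy K ≃ₐ[K] Pxy K} (hφ : IsLinChange φ) {g : Pxy K} {k : ℕ}
    (hg : g ∈ forms K k) : φ g ∈ forms K k := by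
  have h := IsHomogeneous.aeval hg (fun i => φ (X i)) hφ
  rw [one_mul] at h
  have h2 : MvPolynomial.aeval (fun i => φ (X i)) g = φ g := by
    have : MvPolynomial.aeval (fun i => φ (X i)) = (φ : Pxy K →ₐ[K] Pxy K) := by
      ext i; simp
    rw [this]; rfl
  rwa [h2] at h

lemma IsLinChange.map_forms {φ : Pxy K ≃ₐ[K] Pxy K} (hφ : IsLinChange φ) (k : ℕ) :
    (forms K k).map φ.toLinearMap = forms K k := by
  apply Submodule.eq_of_le_of_finrank_eq
  · rintro _ ⟨g, hg, rfl⟩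
    exact hφ.map_mem_forms hg
  · exact finrank_map_eq_of_injective φ.injective _

lemma IsLinChange.symm {φ : Pxy K ≃ₐ[K] Pxy K} (hφ : IsLinChange φ) : IsLinChange φ.symm := by
  intro i
  have h : (X i : Pxy K) ∈ (forms K 1).map φ.toLinearMap := by
    rw [hφ.map_forms]; exact X_mem_forms i
  obtain ⟨g, hg, hgi⟩ := h
  have : φ.symm (X i) = g := by rw [← hgi]; simp
  rw [this]
  exact hg

lemma IsLinChange.trans {φ ψ : Pxy K ≃ₐ[K] Pxy K} (hφ : IsLinChange φ) (hψ : IsLinChange ψ) :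
    IsLinChange (φ.trans ψ) := fun i => hψ.map_mem_forms (hφ i)

lemma mem_map_iff {φ : Pxy K ≃ₐ[K] Pxy K} {I : Ideal (Pxy K)} {g : Pxy K} :
    g ∈ Ideal.map φ I ↔ φ.symm g ∈ I := by
  constructor
  · intro h
    obtain ⟨u, hu, rfl⟩ := (Ideal.mem_map_iff_of_surjective φ φ.surjective).1 h
    simpa using hu
  · intro h
    have := Ideal.mem_map_of_mem φ h
    simpa using this

lemma IsLinChange.homogeneousComponent {φ : Pxy K ≃ₐ[K] Pxy K} (hφ : IsLinChange φ) (g : Pxy K)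
    (k : ℕ) : homogeneousComponent k (φ g) = φ (homogeneousComponent k g) := by
  conv_lhs => rw [← sum_homogeneousComponent g, map_sum, map_sum]
  have : ∀ i ∈ Finset.range (g.totalDegree + 1),
      MvPolynomial.homogeneousComponent k (φ (MvPolynomial.homogeneousComponent i g)) =
        if i = k then φ (MvPolynomial.homogeneousComponent k g) else 0 := by
    intro i _
    rw [homogeneousComponent_of_mem (hφ.map_mem_forms (homogeneousComponent_mem i g))]
    by_cases him : i = k
    · simp [him]
    · rw [if_neg (Ne.symm him), if_neg him]
  rw [Finset.sum_congr rfl this, Finset.sum_ite_eq']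
  split_ifs with hm
  · rfl
  · rw [homogeneousComponent_eq_zero, map_zero]
    simpa using hm

lemma IsLinChange.isHomog_map {φ : Pxy K ≃ₐ[K] Pxy K} (hφ : IsLinChange φ) {I : Ideal (Pxy K)}
    (hI : IsHomog I) : IsHomog (Ideal.map φ I) := by
  intro g hg k
  rw [mem_map_iff] at hg ⊢
  rw [← hφ.symm.homogeneousComponent]
  exact hI _ hg k

lemma IsLinChange.layer_map {φ : Pxy K ≃ₐ[K] Pxy K} (hφ : IsLinChange φ) (I : Ideal (Pxy K))
    (k : ℕ) : layer (Ideal.map φ I) k = (layer I k).map φ.toLinearMap := by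
  ext g
  rw [mem_layer, mem_map_iff, Submodule.mem_map]
  constructor
  · rintro ⟨h1, h2⟩
    exact ⟨φ.symm g, ⟨hφ.symm.map_mem_forms h1, h2⟩, by simp⟩
  · rintro ⟨u, ⟨h1, h2⟩, rfl⟩
    exact ⟨hφ.map_mem_forms h1, by simpa using h2⟩

lemma IsLinChange.map_mulForms {φ : Pxy K ≃ₐ[K] Pxy K} (hφ : IsLinChange φ) (f : Pxy K) (m : ℕ) :
    (mulForms f m).map φ.toLinearMap = mulForms (φ f) m := by
  rw [mulForms, mulForms]
  conv_rhs => rw [← hφ.map_forms m]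
  rw [← Submodule.map_comp, ← Submodule.map_comp]
  congr 1
  refine LinearMap.ext fun g => ?_
  simp

lemma exists_linChange {a b c d : K} (h : a * d - b * c ≠ 0) :
    ∃ φ : Pxy K ≃ₐ[K] Pxy K, IsLinChange φ ∧ φ (lin a b) = X 0 ∧ φ (lin c d) = X 1 := by
  have hc : (C (a * d - b * c) : Pxy K) * C (a * d - b * c)⁻¹ = 1 := by
    rw [← C_mul, mul_inv_cancel₀ h, C_1]
  rw [map_sub, map_mul, map_mul] at hc
  let φ : Pxy K ≃ₐ[K] Pxy K := AlgEquiv.ofAlgHom (MvPolynomial.aeval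
      ![C (a * d - b * c)⁻¹ * lin d (-b), C (a * d - b * c)⁻¹ * lin (-c) a])
    (MvPolynomial.aeval ![lin a b, lin c d])
    (by
      ext i : 1
      fin_cases i
      · simp [lin, algebraMap_eq]
        linear_combination X 0 * hc
      · simp [lin, algebraMap_eq]
        linear_combination X 1 * hc)
    (by
      ext i : 1
      fin_cases i
      · simp [lin, algebraMap_eq]
        linear_combination X 0 * hc
      · simp [lin, algebraMap_eq]
        linear_combination X 1 * hc)
  have hs0 : φ.symm (X 0) = lin a b := by simp [φ]
  have hs1 : φ.symm (X 1) = lin c d := by simp [φ]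
  refine ⟨φ, IsLinChange.symm (φ := φ.symm) ?_, ?_, ?_⟩
  · intro i
    fin_cases i
    · exact hs0 ▸ lin_mem_forms a b
    · exact hs1 ▸ lin_mem_forms c d
  · rw [← hs0]; simp
  · rw [← hs1]; simp

end LinChange

section Combinatorics

/-- No two consecutive strict descents of `t` from degree `m` on. -/
def NoAdj (t : ℕ → ℕ) (m : ℕ) : Prop := ∀ j, m ≤ j → t j = t (j - 1) ∨ t (j + 1) = t j

/-- The Hilbert functions with finitely many orbits. -/
def SmallType (t : ℕ → ℕ) (n : ℕ) : Prop :=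
  (t n ≤ 3 ∧ NoAdj t n) ∨
  (1 ≤ t n ∧ n ≤ 3 ∧ t (n + 1) + 1 = t n ∧ NoAdj t (n + 1)) ∨
  (t n = 2 ∧ ∃ k, n ≤ k ∧ t k = 2 ∧ t (k + 1) = 1 ∧ t (k + 2) = 0 ∧ (n < k ∨ n = 2))

/-- The Hilbert functions with infinitely many orbits. -/
def BigType (t : ℕ → ℕ) (n : ℕ) : Prop :=
  4 ≤ t n ∨
  (t n = 3 ∧ ∃ j, n < j ∧ t j < t (j - 1) ∧ t (j + 1) < t j) ∨
  (1 ≤ t n ∧ t n ≤ 3 ∧ 4 ≤ n ∧ t (n + 1) < t n) ∨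
  (n = 3 ∧ t 3 = 2 ∧ t 4 ≤ 1 ∧ t 5 = 0)

variable {t : ℕ → ℕ} {n : ℕ}

lemma anti_of_step (hmono : ∀ j, n - 1 ≤ j → t (j + 1) ≤ t j) {i j : ℕ} (hi : n - 1 ≤ i)
    (hij : i ≤ j) : t j ≤ t i := by
  induction j, hij using Nat.le_induction with
  | base => exact le_rfl
  | succ j hj ih => exact (hmono j (by omega)).trans ih

lemma smallType_of_not_bigType (hn : 2 ≤ n) (hlow : ∀ i ≤ n - 1, t i = i + 1)
    (hmono : ∀ j, n - 1 ≤ j → t (j + 1) ≤ t j) (h : ¬ BigType t n) : SmallType t n := by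
  have hanti : ∀ i j, n - 1 ≤ i → i ≤ j → t j ≤ t i := fun i j => anti_of_step hmono
  have hn1 : t (n - 1) = n := by rw [hlow _ le_rfl]; omega
  have hnn := hanti (n - 1) n le_rfl (by omega)
  have hn2 := hmono n (by omega)
  have hn3 := hmono (n + 1) (by omega)
  have hstep : ∀ j, n ≤ j → t j ≤ t (j - 1) := fun j hj => hanti _ _ (by omega) (by omega)
  have hstep' : ∀ j, n ≤ j → t (j + 1) ≤ t j := fun j hj => hanti _ _ (by omega) (by omega)
  unfold BigType at h
  push Not at h
  obtain ⟨h1, h2, h3, h4⟩ := h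
  have hc : t n = 0 ∨ t n = 1 ∨ t n = 2 ∨ t n = 3 := by omega
  rcases hc with hc | hc | hc | hc
  · left
    refine ⟨by omega, fun j hj => Or.inr ?_⟩
    have := hanti n j (by omega) hj
    have := hstep' j hj
    omega
  · by_cases hs : t (n + 1) = 1
    · left
      refine ⟨by omega, fun j hj => ?_⟩
      rcases hj.eq_or_lt with rfl | hj
      · right; omega
      · have := hanti n (j - 1) (by omega) (by omega)
        have := hstep' j hj.le
        have := hstep j hj.le
        omega
    · right; left
      refine ⟨by omega, by by_contra; have := h3 (by omega) (by omega) (by omega); omega,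
        by omega, fun j hj => ?_⟩
      have := hanti (n + 1) j (by omega) (by omega)
      have := hstep' j (by omega)
      omega
  · have hlast : ∀ j, n < j → t (j - 1) = 1 → t j = t (j - 1) ∨ t (j + 1) = t j := by
      intro j hj hj1
      have := hstep' j hj.le
      have := hstep j hj.le
      omega
    by_cases hs : t (n + 1) = 2
    · by_cases hna : NoAdj t n
      · left; exact ⟨by omega, hna⟩
      · right; right
        unfold NoAdj at hna
        push Not at hna
        obtain ⟨j, hj, hj1, hj2⟩ := hna
        have a1 := hstep j hj
        have a2 := hstep' j hj
        have hjn : j ≠ n := by rintro rfl; omega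
        have a3 := hanti n (j - 1) (by omega) (by omega)
        have hjn' : j ≠ n + 1 := by rintro rfl; simp at hj1; omega
        obtain ⟨k, rfl⟩ : ∃ k, j = k + 1 := ⟨j - 1, by omega⟩
        simp only [Nat.add_sub_cancel] at *
        exact ⟨hc, k, by omega, by omega, by omega, by rw [show k + 2 = k + 1 + 1 by omega]; omega,
          by omega⟩
    · have hn4 : n ≤ 3 := by by_contra; have := h3 (by omega) (by omega) (by omega); omega
      obtain rfl | rfl : n = 2 ∨ n = 3 := by omega
      · by_cases hz : t 4 = 0 ∧ t 3 = 1
        · right; right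
          exact ⟨hc, 2, le_rfl, hc, hz.2, hz.1, Or.inr rfl⟩
        · left
          simp only [Nat.reduceAdd, Nat.reduceSub] at *
          refine ⟨by omega, fun j hj => ?_⟩
          by_cases hj2 : j = 2
          · subst hj2; left; simp; omega
          by_cases hj3 : j = 3
          · subst hj3; right; simp; omega
          · have := hanti 3 (j - 1) (by omega) (by omega)
            have := hstep' j (by omega)
            have := hstep j (by omega)
            omega
      · simp only [Nat.reduceAdd, Nat.reduceSub, forall_const] at *
        have := h4 hc (by omega)
        right; left
        refine ⟨by omega, le_rfl, by simp; omega, fun j hj => ?_⟩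
        by_cases hj4 : j = 4
        · subst hj4; right; simp; omega
        · have := hanti 4 (j - 1) (by omega) (by omega)
          have := hstep' j (by omega)
          have := hstep j (by omega)
          omega
  · left
    refine ⟨by omega, fun j hj => ?_⟩
    have a1 := hstep j hj
    have a2 := hstep' j hj
    rcases hj.eq_or_lt with rfl | hj
    · by_contra hcon
      have := h3 (by omega) (by omega) (by omega)
      omega
    · have := h2 hc j hj
      omega

lemma jump_of_le {j : ℕ} (hj : n ≤ j) : jump t n j = t (j - 1) - t j := if_pos hj

lemma finsum_jump_eq {N : ℕ} (hN : ∀ j ≥ N, t j = 0) :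
    (∑ᶠ j ∈ {j : ℕ | n ≤ j}, (jump t n j + 1) * jump t n (j + 1)) =
      ∑ j ∈ Finset.Ico n (n + N), (jump t n j + 1) * jump t n (j + 1) := by
  apply finsum_mem_eq_sum_of_inter_support_eq
  ext j
  simp only [Set.mem_inter_iff, Set.mem_ofPred_eq, Function.mem_support, Finset.coe_Ico,
    Set.mem_Ico]
  refine ⟨fun h => ⟨⟨h.1, ?_⟩, h.2⟩, fun h => ⟨h.1.1, h.2⟩⟩
  by_contra hj
  apply h.2
  rw [jump_of_le (by omega : n ≤ j + 1), Nat.add_sub_cancel, hN j (by omega)]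
  simp

lemma sum_jump_succ (hmono : ∀ j, n - 1 ≤ j → t (j + 1) ≤ t j) (N : ℕ) :
    ∑ j ∈ Finset.Ico n (n + N), jump t n (j + 1) = t n - t (n + N) := by
  induction N with
  | zero => simp
  | succ N ih =>
    rw [← add_assoc, Finset.sum_Ico_succ_top (by omega), ih, jump_of_le (by omega),
      Nat.add_sub_cancel]
    have := hmono (n + N) (by omega)
    have := anti_of_step hmono (i := n) (j := n + N) (by omega) (by omega)
    omega

lemma finsum_jump_eq_add (hmono : ∀ j, n - 1 ≤ j → t (j + 1) ≤ t j) {N : ℕ}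
    (hN : ∀ j ≥ N, t j = 0) :
    (∑ᶠ j ∈ {j : ℕ | n ≤ j}, (jump t n j + 1) * jump t n (j + 1)) =
      t n + ∑ j ∈ Finset.Ico n (n + N), jump t n j * jump t n (j + 1) := by
  rw [finsum_jump_eq hN]
  simp only [add_mul, one_mul]
  rw [Finset.sum_add_distrib, sum_jump_succ hmono, hN (n + N) (by omega)]
  omega

lemma finsum_jump_le_of_smallType (hn : 2 ≤ n) (hlow : ∀ i ≤ n - 1, t i = i + 1)
    (hmono : ∀ j, n - 1 ≤ j → t (j + 1) ≤ t j) (hfin : ∃ N, ∀ j ≥ N, t j = 0)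
    (h : SmallType t n) :
    (∑ᶠ j ∈ {j : ℕ | n ≤ j}, (jump t n j + 1) * jump t n (j + 1)) ≤ 3 := by
  obtain ⟨N, hN⟩ := hfin
  have hanti : ∀ i j, n - 1 ≤ i → i ≤ j → t j ≤ t i := fun i j => anti_of_step hmono
  have hn1 : t (n - 1) = n := by rw [hlow _ le_rfl]; omega
  rw [finsum_jump_eq_add hmono hN]
  have hz : ∀ j, n ≤ j → (t j = t (j - 1) ∨ t (j + 1) = t j) →
      jump t n j * jump t n (j + 1) = 0 := by
    intro j hj h
    rw [jump_of_le hj, jump_of_le (by omega : n ≤ j + 1), Nat.add_sub_cancel]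
    rcases h with h | h <;> simp [h]
  have hsingle : ∀ j0, n ≤ j0 → (∀ j, n ≤ j → j ≠ j0 → t j = t (j - 1) ∨ t (j + 1) = t j) →
      ∑ j ∈ Finset.Ico n (n + N), jump t n j * jump t n (j + 1) ≤
        (t (j0 - 1) - t j0) * (t j0 - t (j0 + 1)) := by
    intro j0 hj0 h
    have hle : ∑ j ∈ Finset.Ico n (n + N), jump t n j * jump t n (j + 1) ≤
        ∑ j ∈ Finset.Ico n (n + N), if j = j0 then (t (j0 - 1) - t j0) * (t j0 - t (j0 + 1))
          else 0 := by
      refine Finset.sum_le_sum fun j hj => ?_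
      have hj := (Finset.mem_Ico.1 hj).1
      split_ifs with hjj
      · subst hjj
        rw [jump_of_le hj, jump_of_le (by omega : n ≤ j + 1), Nat.add_sub_cancel]
      · exact (hz j hj (h j hj hjj)).le
    refine hle.trans ?_
    rw [Finset.sum_ite_eq']
    split_ifs <;> simp
  rcases h with ⟨h1, h2⟩ | ⟨h1, h2, h3, h4⟩ | ⟨h1, k, hk, h2, h3, h4, h5⟩
  · rw [Finset.sum_eq_zero fun j hj => hz j (Finset.mem_Ico.1 hj).1 (h2 j (Finset.mem_Ico.1 hj).1)]
    omega
  · have := hsingle n le_rfl fun j hj hjn => h4 j (by omega)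
    rw [hn1, ← h3, Nat.add_sub_cancel_left] at this
    have := hanti (n - 1) n (by omega) (by omega)
    omega
  · have := hsingle (k + 1) (by omega) fun j hj hjk => by
      rcases lt_or_gt_of_ne hjk with h | h
      · have a1 := hanti j k (by omega) (by omega)
        have a2 := hanti n j (by omega) (by omega)
        by_cases hjk : j = k
        · left
          subst hjk
          by_cases hjn : j = n
          · subst hjn; omega
          · have := hanti n (j - 1) (by omega) (by omega)
            have := hanti (j - 1) j (by omega) (by omega)
            omega
        · right
          have := hanti (j + 1) k (by omega) (by omega)
          have := hanti n (j + 1) (by omega) (by omega)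
          omega
      · right
        have a1 := hanti (k + 2) j (by omega) (by omega)
        have a2 := hanti (k + 2) (j + 1) (by omega) (by omega)
        omega
    simp only [Nat.add_sub_cancel] at this
    rw [show k + 1 + 1 = k + 2 by omega, h2, h3, h4] at this
    omega

lemma finsum_jump_gt_of_bigType (hn : 2 ≤ n) (hlow : ∀ i ≤ n - 1, t i = i + 1)
    (hmono : ∀ j, n - 1 ≤ j → t (j + 1) ≤ t j) (hfin : ∃ N, ∀ j ≥ N, t j = 0)
    (h : BigType t n) :
    3 < (∑ᶠ j ∈ {j : ℕ | n ≤ j}, (jump t n j + 1) * jump t n (j + 1)) := by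
  obtain ⟨N, hN⟩ := hfin
  have hn1 : t (n - 1) = n := by rw [hlow _ le_rfl]; omega
  rw [finsum_jump_eq_add hmono hN]
  have hge : ∀ j, n ≤ j → (t (j - 1) - t j) * (t j - t (j + 1)) ≤
      ∑ j ∈ Finset.Ico n (n + N), jump t n j * jump t n (j + 1) := by
    intro j hj
    by_cases hjN : j < n + N
    · have := Finset.single_le_sum (f := fun j => jump t n j * jump t n (j + 1))
        (s := Finset.Ico n (n + N)) (fun _ _ => Nat.zero_le _) (Finset.mem_Ico.2 ⟨hj, hjN⟩)
      simpa only [jump_of_le hj, jump_of_le (by omega : n ≤ j + 1), Nat.add_sub_cancel] using this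
    · rw [hN j (by omega)]; simp
  rcases h with h | ⟨h, j, hj, h1, h2⟩ | ⟨h1, h2, h3, h4⟩ | ⟨rfl, h1, h2, h3⟩
  · omega
  · have := hge j hj.le
    have := Nat.mul_pos (Nat.sub_pos_of_lt h1) (Nat.sub_pos_of_lt h2)
    omega
  · have := hge n le_rfl
    rw [hn1] at this
    have := Nat.mul_le_mul_left (n - t n) (Nat.sub_pos_of_lt h4)
    omega
  · have a := hge 3 le_rfl
    simp only [Nat.reduceAdd, Nat.reduceSub] at a hn1
    rw [hn1, h1] at a
    by_cases ht4 : t 4 = 0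
    · rw [ht4] at a; omega
    · have ht4 : t 4 = 1 := by omega
      have hN5 : 4 < N := by
        by_contra hcon
        have := hN 4 (by omega)
        omega
      have hsub : ({3, 4} : Finset ℕ) ⊆ Finset.Ico 3 (3 + N) := by
        intro j hj
        simp only [Finset.mem_insert, Finset.mem_singleton] at hj
        rw [Finset.mem_Ico]; omega
      have := Finset.sum_le_sum_of_subset (f := fun j => jump t 3 j * jump t 3 (j + 1)) hsub
      rw [Finset.sum_pair (by decide)] at this
      rw [jump_of_le (by omega : 3 ≤ 3), jump_of_le (by omega : 3 ≤ 3 + 1),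
        jump_of_le (by omega : 3 ≤ 4 + 1)] at this
      simp only [Nat.reduceAdd, Nat.reduceSub, hn1, h1, ht4, h3] at this
      omega

end Combinatorics

section Structure

variable {K : Type*} [Field K]

lemma homogFiniteType_of_layers {t : ℕ → ℕ} {T : Set (ℕ → Submodule K (Pxy K))} (hT : T.Finite)
    (h : ∀ I : Ideal (Pxy K), IsHomog I → (∀ k, hilb K I k = t k) →
      ∃ φ : Pxy K ≃ₐ[K] Pxy K, IsLinChange φ ∧ (fun k => (layer I k).map φ.toLinearMap) ∈ T) :
    HomogFiniteType K t := by
  refine ⟨{J | IsHomog J ∧ layer J ∈ T}, ?_, fun J hJ => hJ.1, fun I hI ht => ?_⟩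
  · refine Set.Finite.of_finite_image (f := layer) (hT.subset ?_) ?_
    · rintro _ ⟨J, hJ, rfl⟩
      exact hJ.2
    · intro I hI J hJ hIJ
      exact hI.1.ext hJ.1 fun k => congrFun hIJ k
  · obtain ⟨φ, hφ, hφT⟩ := h I hI ht
    refine ⟨φ, hφ, hφ.isHomog_map hI, ?_⟩
    have : layer (Ideal.map φ I) = fun k => (layer I k).map φ.toLinearMap :=
      funext fun k => hφ.layer_map I k
    rwa [this]

lemma mem_forms_of_X_mul {g : Pxy K} {k : ℕ} {i : Fin 2} (h : X i * g ∈ forms K (k + 1)) :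
    g ∈ forms K k := by
  obtain ⟨h', hh, he⟩ := mem_mulForms.1
    (mem_mulForms_of_dvd (X_mem_forms i) (m := k) (by rwa [add_comm]) ⟨g, rfl⟩)
  rwa [← mul_left_cancel₀ (X_ne_zero i) he]

lemma mulForms_le_of_X_mul {f : Pxy K} {m : ℕ} {V : Submodule K (Pxy K)}
    (h : ∀ i, ∀ g ∈ mulForms f m, X i * g ∈ V) : mulForms f (m + 1) ≤ V := by
  intro g hg
  obtain ⟨u, hu, rfl⟩ := mem_mulForms.1 hg
  obtain ⟨v, hv, c, rfl⟩ := exists_forms_succ hu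
  have h1 := h 1 _ (mul_mem_mulForms (f := f) hv)
  have h2 := h 0 _ (mul_mem_mulForms (f := f)
    (Submodule.smul_mem _ c (forms_pow_one (X_mem_forms 0) m)))
  convert Submodule.add_mem _ h1 h2 using 1
  rw [smul_eq_C_mul]
  ring

/-- A space of binary forms grows by at least one dimension when multiplied by the linear forms,
and by exactly one only if it consists of all multiples of a form. -/
lemma growth (k : ℕ) (V W : Submodule K (Pxy K)) [FiniteDimensional K W] (hV : V ≤ forms K k)
    (hV0 : V ≠ ⊥) (hVW : ∀ i, ∀ g ∈ V, X i * g ∈ W) :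
    Module.finrank K V + 1 ≤ Module.finrank K W ∧
    (Module.finrank K W ≤ Module.finrank K V + 1 →
      ∃ f ∈ forms K (k + 1 - Module.finrank K V), f ≠ 0 ∧
        V = mulForms f (Module.finrank K V - 1)) := by
  induction k generalizing V W with
  | zero =>
    have hVf : V = forms K 0 := by
      have := finiteDimensional_of_le_forms hV
      apply Submodule.eq_of_le_of_finrank_le hV
      rw [finrank_forms]
      exact Submodule.one_le_finrank_iff.2 hV0
    subst hVf
    have hW := mulForms_le_of_X_mul (f := (1 : Pxy K)) (m := 0) (V := W) (by rwa [mulForms_one])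
    rw [mulForms_one] at hW
    refine ⟨by simpa using Submodule.finrank_mono hW, fun _ => ⟨1, ?_, one_ne_zero, ?_⟩⟩
    · simpa using one_mem_forms (K := K)
    · simp [mulForms_one]
  | succ k ih =>
    have fV := finiteDimensional_of_le_forms hV
    set V₁ : Submodule K (Pxy K) :=
      V.comap (LinearMap.mulLeft K (X 0)) ⊓ V.comap (LinearMap.mulLeft K (X 1)) with hV₁
    have hmem : ∀ {g}, g ∈ V₁ ↔ X 0 * g ∈ V ∧ X 1 * g ∈ V := by simp [hV₁]
    have hV₁k : V₁ ≤ forms K k := fun g hg => mem_forms_of_X_mul (hV (hmem.1 hg).1)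
    have fV₁ := finiteDimensional_of_le_forms hV₁k
    have hsup : V.map (LinearMap.mulLeft K (X 0)) ⊔ V.map (LinearMap.mulLeft K (X 1)) ≤ W := by
      refine sup_le ?_ ?_ <;> rintro _ ⟨g, hg, rfl⟩
      · exact hVW 0 g hg
      · exact hVW 1 g hg
    have hinf : V.map (LinearMap.mulLeft K (X 0)) ⊓ V.map (LinearMap.mulLeft K (X 1)) ≤
        V₁.map (LinearMap.mulLeft K (X 0 * X 1)) := by
      rintro _ ⟨⟨u, hu, rfl⟩, ⟨v, hv, huv⟩⟩
      simp only [LinearMap.mulLeft_apply] at huv ⊢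
      have : (X 1 : Pxy K) ∣ u :=
        ((X_prime 1).dvd_or_dvd (Dvd.intro _ huv)).resolve_left (X_not_dvd_X (by decide))
      obtain ⟨w, rfl⟩ := this
      refine ⟨w, hmem.2 ⟨?_, hu⟩, by simp [mul_comm, mul_left_comm]⟩
      have : v = X 0 * w := by
        apply mul_left_cancel₀ (X_ne_zero (R := K) (1 : Fin 2))
        rw [huv]; ring
      rwa [← this]
    have hdim := Submodule.finrank_sup_add_finrank_inf_eq
      (V.map (LinearMap.mulLeft K (X 0))) (V.map (LinearMap.mulLeft K (X 1)))
    rw [finrank_map_mulLeft (X_ne_zero _), finrank_map_mulLeft (X_ne_zero _)] at hdim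
    have h1 : Module.finrank K ↥(V.map (LinearMap.mulLeft K (X 0)) ⊔
      V.map (LinearMap.mulLeft K (X 1))) ≤ Module.finrank K W := Submodule.finrank_mono hsup
    have h2 := Submodule.finrank_mono hinf
    rw [finrank_map_mulLeft (mul_ne_zero (X_ne_zero _) (X_ne_zero _))] at h2
    have hVpos := Submodule.one_le_finrank_iff.2 hV0
    by_cases h0 : V₁ = ⊥
    · rw [h0, finrank_bot] at h2
      refine ⟨by omega, fun hle => ?_⟩
      have hone : Module.finrank K V = 1 := by omega
      obtain ⟨f, hf, hf0⟩ := Submodule.exists_mem_ne_zero_of_ne_bot hV0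
      rw [hone]
      refine ⟨f, hV hf, hf0, ?_⟩
      symm
      apply Submodule.eq_of_le_of_finrank_eq
      · intro g hg
        obtain ⟨c, hc, rfl⟩ := mem_mulForms.1 hg
        obtain ⟨c, rfl⟩ := mem_forms_zero.1 hc
        rw [mul_comm, C_mul']
        exact Submodule.smul_mem _ _ hf
      · rw [finrank_mulForms hf0, hone]
    · obtain ⟨i1, i2⟩ := ih V₁ V hV₁k h0 (fun i g hg => by
        fin_cases i
        · exact (hmem.1 hg).1
        · exact (hmem.1 hg).2)
      refine ⟨by omega, fun hle => ?_⟩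
      obtain ⟨f, hf, hf0, hfV⟩ := i2 (by omega)
      have hpos := Submodule.one_le_finrank_iff.2 h0
      have heq : Module.finrank K V = Module.finrank K V₁ + 1 := by omega
      refine ⟨f, ?_, hf0, ?_⟩
      · rwa [heq, show k + 1 + 1 - (Module.finrank K V₁ + 1) = k + 1 - Module.finrank K V₁ by omega]
      · symm
        apply Submodule.eq_of_le_of_finrank_eq
        · rw [show Module.finrank K V - 1 = Module.finrank K V₁ - 1 + 1 by omega]
          apply mulForms_le_of_X_mul
          intro i g hg
          rw [← hfV] at hg
          fin_cases i
          · exact (hmem.1 hg).1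
          · exact (hmem.1 hg).2
        · rw [finrank_mulForms hf0]; omega

lemma exists_lin_dvd [IsAlgClosed K] {f : Pxy K} {d : ℕ} (hf : f ∈ forms K (d + 1)) :
    ∃ l ∈ forms K 1, l ≠ 0 ∧ ∃ g ∈ forms K d, f = l * g := by
  by_cases hd : (dehom K f).natDegree ≤ d
  · refine ⟨X 1, X_mem_forms 1, X_ne_zero _, _,
      Polynomial.isHomogeneous_homogenize (n := d) (dehom K f), ?_⟩
    apply dehom_injOn hf
    · rw [SetLike.mem_coe, add_comm]
      exact forms_mul (X_mem_forms 1) (Polynomial.isHomogeneous_homogenize _)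
    · rw [map_mul, dehom_X_one, one_mul, dehom_homogenize hd]
  · have hdeg : (dehom K f).degree ≠ 0 := by
      intro h
      exact hd ((Polynomial.natDegree_eq_of_degree_eq_some h).le.trans (Nat.zero_le d))
    obtain ⟨α, hα⟩ := IsAlgClosed.exists_root _ hdeg
    obtain ⟨q, hq⟩ := Polynomial.dvd_iff_isRoot.2 hα
    have hqd : q.natDegree ≤ d := by
      by_cases hq0 : q = 0
      · simp [hq0]
      have := natDegree_dehom_le hf
      rw [hq, Polynomial.natDegree_mul (Polynomial.X_sub_C_ne_zero _) hq0,
        Polynomial.natDegree_X_sub_C] at this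
      omega
    refine ⟨lin 1 (-α), lin_mem_forms _ _, fun h => one_ne_zero (lin_eq_zero.1 h).1, _,
      Polynomial.isHomogeneous_homogenize (n := d) q, ?_⟩
    apply dehom_injOn hf
    · rw [SetLike.mem_coe, add_comm]
      exact forms_mul (lin_mem_forms _ _) (Polynomial.isHomogeneous_homogenize _)
    · rw [map_mul, dehom_homogenize hqd, hq]
      congr 1
      simp only [lin, map_add, map_mul, dehom_X_zero, dehom_X_one]
      simp [dehom, sub_eq_add_neg]

lemma exists_prod_lin [IsAlgClosed K] {f : Pxy K} {d : ℕ} (hf : f ∈ forms K d) (hf0 : f ≠ 0) :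
    ∃ l : ℕ → Pxy K, (∀ i, l i ∈ forms K 1 ∧ l i ≠ 0) ∧
      ∃ c : K, c ≠ 0 ∧ f = C c * ∏ i ∈ Finset.range d, l i := by
  induction d generalizing f with
  | zero =>
    obtain ⟨c, rfl⟩ := mem_forms_zero.1 hf
    exact ⟨fun _ => X 0, fun _ => ⟨X_mem_forms 0, X_ne_zero _⟩, c, by rintro rfl; simp at hf0,
      by simp⟩
  | succ d ih =>
    obtain ⟨m, hm, hm0, g, hg, rfl⟩ := exists_lin_dvd hf
    obtain ⟨l, hl, c, hc, rfl⟩ := ih hg (right_ne_zero_of_mul hf0)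
    refine ⟨fun i => if i = d then m else l i, fun i => ?_, c, hc, ?_⟩
    · beta_reduce
      split_ifs
      · exact ⟨hm, hm0⟩
      · exact hl i
    · have : ∀ i ∈ Finset.range d, (if i = d then m else l i) = l i := fun i hi => by
        rw [if_neg (Finset.mem_range.1 hi).ne]
      rw [Finset.prod_range_succ, if_pos rfl, Finset.prod_congr rfl this]
      ring

lemma prod_lin_mem_forms {l : ℕ → Pxy K} (hl : ∀ i, l i ∈ forms K 1 ∧ l i ≠ 0) (m : ℕ) :
    ∏ i ∈ Finset.range m, l i ∈ forms K m := by
  simpa using IsHomogeneous.prod (Finset.range m) l (fun _ => 1) (fun i _ => (hl i).1)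

lemma prod_lin_ne_zero {l : ℕ → Pxy K} (hl : ∀ i, l i ∈ forms K 1 ∧ l i ≠ 0) (m : ℕ) :
    ∏ i ∈ Finset.range m, l i ≠ 0 :=
  Finset.prod_ne_zero_iff.2 fun i _ => (hl i).2

/-- The graded pieces of a homogeneous ideal with Hilbert function `t`. -/
structure IsGradedPiece (D : ℕ → Submodule K (Pxy K)) (t : ℕ → ℕ) : Prop where
  le : ∀ k, D k ≤ forms K k
  mul : ∀ k i, ∀ g ∈ D k, X i * g ∈ D (k + 1)
  dim : ∀ k, Module.finrank K (D k) + t k = k + 1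

lemma isGradedPiece_layer {I : Ideal (Pxy K)} {t : ℕ → ℕ} (h : ∀ k, hilb K I k = t k) :
    IsGradedPiece (layer I) t where
  le := layer_le I
  mul k i g hg := mul_mem_layer (X_mem_forms i) hg rfl
  dim k := by rw [← h, finrank_layer_add_hilb]

namespace IsGradedPiece

variable {D : ℕ → Submodule K (Pxy K)} {t : ℕ → ℕ}

lemma eq_bot (hD : IsGradedPiece D t) {k : ℕ} (h : t k = k + 1) : D k = ⊥ := by
  have := hD.dim k
  have := finiteDimensional_of_le_forms (hD.le k)
  rw [← Submodule.finrank_eq_zero (R := K)]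
  omega

lemma eq_forms (hD : IsGradedPiece D t) {k : ℕ} (h : t k = 0) : D k = forms K k := by
  apply Submodule.eq_of_le_of_finrank_eq (hD.le k)
  rw [finrank_forms, ← hD.dim k, h, add_zero]

lemma eq_mulForms_of_le (hD : IsGradedPiece D t) {k : ℕ} {f : Pxy K} (hf0 : f ≠ 0) (hk : t k ≤ k)
    (h : D k ≤ mulForms f (k - t k)) : D k = mulForms f (k - t k) := by
  have : FiniteDimensional K (mulForms f (k - t k)) := by unfold mulForms; infer_instance
  apply Submodule.eq_of_le_of_finrank_eq h
  have := hD.dim k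
  rw [finrank_mulForms hf0]
  omega

lemma eq_mulForms_of_ge (hD : IsGradedPiece D t) {k : ℕ} {f : Pxy K} (hf0 : f ≠ 0) (hk : t k ≤ k)
    (h : mulForms f (k - t k) ≤ D k) : D k = mulForms f (k - t k) := by
  have := finiteDimensional_of_le_forms (hD.le k)
  symm
  apply Submodule.eq_of_le_of_finrank_eq h
  have := hD.dim k
  rw [finrank_mulForms hf0]
  omega

lemma dvd_of_mul (hD : IsGradedPiece D t) {k : ℕ} {f g : Pxy K} {m : ℕ}
    (hf : D (k + 1) ≤ mulForms f m) (hg : g ∈ D k) :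
    f ∣ g := by
  have h : ∀ i, f ∣ g * X i ^ 1 := fun i => by
    obtain ⟨u, -, hu⟩ := mem_mulForms.1 (hf (hD.mul k i g hg))
    exact ⟨u, by rw [hu]; ring⟩
  exact dvd_of_dvd_mul_X_pow (h 0) (h 1)

lemma eq_mulForms_of_succ (hD : IsGradedPiece D t) {k : ℕ} {f : Pxy K}
    (hf : f ∈ forms K (t k)) (hf0 : f ≠ 0) (hk : t k ≤ k) {m : ℕ}
    (h : D (k + 1) ≤ mulForms f m) : D k = mulForms f (k - t k) := by
  apply hD.eq_mulForms_of_le hf0 hk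
  intro g hg
  apply mem_mulForms_of_dvd hf _ (hD.dvd_of_mul h hg)
  rw [Nat.add_sub_cancel' hk]
  exact hD.le k hg

lemma exists_eq_mulForms (hD : IsGradedPiece D t) {k : ℕ} (h : t (k + 1) = t k) :
    ∃ f ∈ forms K (t (k + 1)), f ≠ 0 ∧ D (k + 1) = mulForms f (k + 1 - t (k + 1)) := by
  have d1 := hD.dim k
  have d2 := hD.dim (k + 1)
  have fd := finiteDimensional_of_le_forms (hD.le (k + 1))
  by_cases h0 : D k = ⊥
  · rw [h0, finrank_bot] at d1
    have hne : D (k + 1) ≠ ⊥ := by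
      intro hb
      rw [hb, finrank_bot] at d2
      omega
    obtain ⟨f, hf, hf0⟩ := Submodule.exists_mem_ne_zero_of_ne_bot hne
    have hfk := hD.le _ hf
    refine ⟨f, by rwa [show t (k + 1) = k + 1 by omega], hf0, hD.eq_mulForms_of_ge hf0 (by omega) ?_⟩
    intro g hg
    rw [show k + 1 - t (k + 1) = 0 by omega] at hg
    obtain ⟨c, hc, rfl⟩ := mem_mulForms.1 hg
    obtain ⟨c, rfl⟩ := mem_forms_zero.1 hc
    rw [mul_comm, C_mul']
    exact Submodule.smul_mem _ _ hf
  · have fk := finiteDimensional_of_le_forms (hD.le k)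
    obtain ⟨f, hf, hf0, hfD⟩ := (growth k (D k) (D (k + 1)) (hD.le k) h0 (hD.mul k)).2 (by omega)
    have hpos := Submodule.one_le_finrank_iff.2 h0
    refine ⟨f, by rwa [show t (k + 1) = k + 1 - Module.finrank K (D k) by omega], hf0,
      hD.eq_mulForms_of_ge hf0 (by omega) ?_⟩
    rw [show k + 1 - t (k + 1) = Module.finrank K (D k) - 1 + 1 by omega]
    apply mulForms_le_of_X_mul
    rw [← hfD]
    exact hD.mul k

/-- If no two consecutive descents occur from degree `m` on, the graded pieces are given by
products of an increasing chain of linear forms. -/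
lemma exists_chain (hD : IsGradedPiece D t) [IsAlgClosed K] {m : ℕ} (hm : 1 ≤ m)
    (hmono : ∀ j, m - 1 ≤ j → t (j + 1) ≤ t j) (hfin : ∃ N, ∀ j ≥ N, t j = 0)
    (hadj : NoAdj t m) (htm : t m ≤ m) :
    ∃ l : ℕ → Pxy K, (∀ i, l i ∈ forms K 1 ∧ l i ≠ 0) ∧
      ∀ k ≥ m, D k = mulForms (∏ i ∈ Finset.range (t k), l i) (k - t k) := by
  obtain ⟨N, hN⟩ := hfin
  have htk : ∀ k ≥ m, t k ≤ k := fun k hk =>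
    (anti_of_step hmono (by omega) hk).trans (htm.trans hk)
  have key : ∀ d k, m ≤ k → N ≤ k + d → ∃ l : ℕ → Pxy K, (∀ i, l i ∈ forms K 1 ∧ l i ≠ 0) ∧
      ∀ k' ≥ k, D k' = mulForms (∏ i ∈ Finset.range (t k'), l i) (k' - t k') := by
    intro d
    induction d with
    | zero =>
      intro k hk hNk
      refine ⟨fun _ => X 0, fun _ => ⟨X_mem_forms 0, X_ne_zero _⟩, fun k' hk' => ?_⟩
      have h0 := hN k' (by omega)
      rw [hD.eq_forms h0, h0]
      simp [mulForms_one]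
    | succ d ih =>
      intro k hk hNk
      obtain ⟨l, hl, hlD⟩ := ih (k + 1) (by omega) (by omega)
      have hD1 := hlD (k + 1) le_rfl
      rcases (hmono k (by omega)).eq_or_lt with heq | hlt
      · refine ⟨l, hl, fun k' hk' => ?_⟩
        rcases hk'.eq_or_lt with rfl | hk'
        · rw [heq] at hD1
          exact hD.eq_mulForms_of_succ (prod_lin_mem_forms hl _) (prod_lin_ne_zero hl _)
            (htk k hk) hD1.le
        · exact hlD k' hk'
      · have heq : t k = t (k - 1) := (hadj k hk).resolve_right hlt.ne
        obtain ⟨j, rfl⟩ : ∃ j, k = j + 1 := ⟨k - 1, by omega⟩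
        have dj := hD.dim j
        obtain ⟨f, hf, hf0, hfD⟩ := hD.exists_eq_mulForms (k := j) heq
        have hdvd : ∏ i ∈ Finset.range (t (j + 1 + 1)), l i ∣ f := by
          have : ∀ i, ∏ i ∈ Finset.range (t (j + 1 + 1)), l i ∣ f * X i ^ (j + 1 - t (j + 1)) := by
            intro i
            refine hD.dvd_of_mul hD1.le ?_
            rw [hfD]
            exact mul_mem_mulForms (forms_pow_one (X_mem_forms i) _)
          exact dvd_of_dvd_mul_X_pow (this 0) (this 1)
        obtain ⟨q, hq, rfl⟩ := mem_mulForms.1 (mem_mulForms_of_dvd (prod_lin_mem_forms hl _)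
          (m := t (j + 1) - t (j + 1 + 1)) (by rwa [Nat.add_sub_cancel' hlt.le]) hdvd)
        obtain ⟨l', hl', c, hc, rfl⟩ := exists_prod_lin hq (right_ne_zero_of_mul hf0)
        refine ⟨fun i => if i < t (j + 1 + 1) then l i else l' (i - t (j + 1 + 1)), fun i => ?_,
          fun k' hk' => ?_⟩
        · beta_reduce
          split_ifs
          · exact hl i
          · exact hl' _
        · rcases hk'.eq_or_lt with rfl | hk'
          · rw [hfD]
            obtain ⟨b, hb⟩ : ∃ b, t (j + 1) = t (j + 1 + 1) + b :=
              ⟨t (j + 1) - t (j + 1 + 1), by omega⟩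
            rw [hb, Finset.prod_range_add, mul_left_comm, mulForms_C_mul hc, Nat.add_sub_cancel_left]
            congr 2
            · refine Finset.prod_congr rfl fun i hi => ?_
              rw [if_pos (Finset.mem_range.1 hi)]
            · refine Finset.prod_congr rfl fun i hi => ?_
              rw [if_neg (by omega), Nat.add_sub_cancel_left]
          · rw [hlD k' hk']
            congr 1
            refine Finset.prod_congr rfl fun i hi => ?_
            have := anti_of_step hmono (i := j + 1 + 1) (by omega) hk'
            exact (if_pos ((Finset.mem_range.1 hi).trans_le this)).symm
  exact key N m le_rfl (by omega)

end IsGradedPiece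

end Structure

section Polar

variable {K : Type*} [Field K]

/-- The derivation of `K[x,y]` killing the linear form `m`. -/
def polar (m : Pxy K) : Derivation K (Pxy K) (Pxy K) :=
  coeff (Finsupp.single 1 1) m • pderiv 0 - coeff (Finsupp.single 0 1) m • pderiv 1

lemma polar_lin (a b : K) (g : Pxy K) :
    polar (lin a b) g = C b * pderiv 0 g - C a * pderiv 1 g := by
  rw [polar, coeff_lin_one, coeff_lin_zero]
  simp [smul_eq_C_mul]

lemma polar_C_mul (c : K) (m g : Pxy K) : polar (C c * m) g = C c * polar m g := by
  simp only [polar, coeff_C_mul, Derivation.sub_apply, Derivation.smul_apply, smul_eq_C_mul, C_mul]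
  ring

lemma polar_self {m : Pxy K} (hm : m ∈ forms K 1) : polar m m = 0 := by
  obtain ⟨a, b, rfl⟩ := mem_forms_one.1 hm
  rw [polar_lin]
  simp [lin]
  ring

lemma polar_mem_forms (m : Pxy K) {g : Pxy K} {k : ℕ} (hg : g ∈ forms K (k + 1)) :
    polar m g ∈ forms K k := by
  have h : ∀ i : Fin 2, pderiv i g ∈ forms K k := fun i => IsHomogeneous.pderiv hg
  simp only [polar, Derivation.sub_apply, Derivation.smul_apply]
  exact Submodule.sub_mem _ (Submodule.smul_mem _ _ (h 0)) (Submodule.smul_mem _ _ (h 1))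

lemma eq_C_mul_pow_of_polar_eq_zero [CharZero K] {m : Pxy K} (hm : m ∈ forms K 1) (hm0 : m ≠ 0)
    {k : ℕ} {g : Pxy K} (hg : g ∈ forms K k) (h : polar m g = 0) : ∃ c, g = C c * m ^ k := by
  induction k generalizing g with
  | zero => simpa using mem_forms_zero.1 hg
  | succ k ih =>
    have hdvd : m ∣ g := by
      obtain ⟨a, b, rfl⟩ := mem_forms_one.1 hm
      have he := IsHomogeneous.sum_X_mul_pderiv hg
      rw [Fin.sum_univ_two, nsmul_eq_mul] at he
      rw [polar_lin] at h
      have hk : (C ((k + 1 : ℕ) : K) : Pxy K) * C ((k + 1 : ℕ) : K)⁻¹ = 1 := by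
        rw [← C_mul, mul_inv_cancel₀ (Nat.cast_ne_zero.2 k.succ_ne_zero), C_1]
      have hC : (C ((k + 1 : ℕ) : K) : Pxy K) = ((k + 1 : ℕ) : Pxy K) := map_natCast C _
      rw [hC] at hk
      by_cases ha : a = 0
      · subst ha
        have hb : b ≠ 0 := by
          rintro rfl
          exact hm0 (lin_eq_zero.2 ⟨rfl, rfl⟩)
        have hb' : (C b : Pxy K) * C b⁻¹ = 1 := by rw [← C_mul, mul_inv_cancel₀ hb, C_1]
        refine ⟨C b⁻¹ * C ((k + 1 : ℕ) : K)⁻¹ * pderiv 1 g, ?_⟩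
        have h' : pderiv 0 g = 0 := by
          have := congrArg (C b⁻¹ * ·) h
          simp only [C_0, zero_mul, sub_zero, mul_zero, ← mul_assoc] at this
          rwa [mul_comm (C b⁻¹), hb', one_mul] at this
        rw [h'] at he
        simp only [lin, C_0, zero_mul, zero_add]
        linear_combination (-g) * hk - C ((k + 1 : ℕ) : K)⁻¹ * he
          - X 1 * C ((k + 1 : ℕ) : K)⁻¹ * pderiv 1 g * hb'
      · have ha' : (C a : Pxy K) * C a⁻¹ = 1 := by rw [← C_mul, mul_inv_cancel₀ ha, C_1]
        refine ⟨C a⁻¹ * C ((k + 1 : ℕ) : K)⁻¹ * pderiv 0 g, ?_⟩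
        simp only [lin]
        linear_combination (-g) * hk - C ((k + 1 : ℕ) : K)⁻¹ * he
          - C ((k + 1 : ℕ) : K)⁻¹ * (X 0 * pderiv 0 g + X 1 * pderiv 1 g) * ha'
          - C ((k + 1 : ℕ) : K)⁻¹ * X 1 * C a⁻¹ * h
    obtain ⟨u, hu, rfl⟩ := mem_mulForms.1 (mem_mulForms_of_dvd hm (m := k) (by rwa [add_comm]) hdvd)
    rw [Derivation.leibniz, polar_self hm, smul_zero, add_zero, smul_eq_mul] at h
    obtain ⟨c, rfl⟩ := ih hu ((mul_eq_zero.1 h).resolve_left hm0)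
    exact ⟨c, by ring⟩

lemma IsLinChange.exists_lin {φ : Pxy K ≃ₐ[K] Pxy K} (hφ : IsLinChange φ) :
    ∃ a b c d : K, φ (X 0) = lin a b ∧ φ (X 1) = lin c d ∧ a * d - b * c ≠ 0 := by
  obtain ⟨a, b, h0⟩ := mem_forms_one.1 (hφ 0)
  obtain ⟨c, d, h1⟩ := mem_forms_one.1 (hφ 1)
  have key : ∀ p q : K, φ (lin p q) = lin (p * a + q * c) (p * b + q * d) := by
    intro p q
    rw [← lin_add_lin, ← C_mul_lin, ← C_mul_lin, ← h0, ← h1, lin, map_add, map_mul, map_mul,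
      ← algebraMap_eq, AlgEquiv.commutes, AlgEquiv.commutes]
  refine ⟨a, b, c, d, h0, h1, fun h => ?_⟩
  have e1 : φ (lin d (-b)) = 0 := by
    rw [key, lin_eq_zero]
    exact ⟨by linear_combination h, by ring⟩
  have e2 : φ (lin (-c) a) = 0 := by
    rw [key, lin_eq_zero]
    exact ⟨by ring, by linear_combination h⟩
  rw [map_eq_zero_iff _ φ.injective, lin_eq_zero] at e1 e2
  have := φ.injective.ne (X_ne_zero (R := K) (0 : Fin 2))
  rw [h0, map_zero, Ne, lin_eq_zero] at this
  exact this ⟨e2.2, neg_eq_zero.1 e1.2⟩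

lemma IsLinChange.exists_polar {φ : Pxy K ≃ₐ[K] Pxy K} (hφ : IsLinChange φ) :
    ∃ δ : K, δ ≠ 0 ∧ ∀ m ∈ forms K 1, ∀ g, polar (φ m) (φ g) = C δ * φ (polar m g) := by
  obtain ⟨a, b, c, d, h0, h1, hδ⟩ := hφ.exists_lin
  refine ⟨a * d - b * c, hδ, fun m hm g => ?_⟩
  obtain ⟨p, q, rfl⟩ := mem_forms_one.1 hm
  have hC : ∀ r : K, φ (C r) = C r := fun r => by
    rw [← algebraMap_eq, AlgEquiv.commutes]
  have hm' : φ (lin p q) = lin (p * a + q * c) (p * b + q * d) := by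
    rw [← lin_add_lin, ← C_mul_lin, ← C_mul_lin, ← h0, ← h1, lin, map_add, map_mul, map_mul,
      hC, hC]
  have hX : ∀ i : Fin 2, polar (φ (lin p q)) (φ (X i)) =
      C (a * d - b * c) * φ (polar (lin p q) (X i)) := by
    intro i
    rw [hm', polar_lin, polar_lin]
    fin_cases i
    · simp [h0, lin, hC]
      ring
    · simp [h1, lin, hC]
      ring
  induction g using MvPolynomial.induction_on with
  | C r =>
    rw [hC, ← algebraMap_eq, Derivation.map_algebraMap, Derivation.map_algebraMap, map_zero,
      mul_zero]
  | add u v hu hv => rw [map_add, map_add, hu, hv, map_add, map_add, mul_add]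
  | mul_X u i hu =>
    rw [map_mul, Derivation.leibniz, hu, hX, Derivation.leibniz, map_add]
    simp only [smul_eq_mul, map_mul]
    ring

/-- The binary forms of degree `N` killed by the composite of the derivations attached to the
linear forms `l 0, …, l (N - 1)`. -/
def apolar (l : ℕ → Pxy K) : ℕ → Submodule K (Pxy K)
  | 0 => ⊥
  | N + 1 => forms K (N + 1) ⊓ (apolar l N).comap (polar (l N)).toLinearMap

lemma mem_apolar_succ {l : ℕ → Pxy K} {N : ℕ} {g : Pxy K} :
    g ∈ apolar l (N + 1) ↔ g ∈ forms K (N + 1) ∧ polar (l N) g ∈ apolar l N := Iff.rfl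

lemma C_mul_mem_iff {c : K} (hc : c ≠ 0) {V : Submodule K (Pxy K)} {g : Pxy K} :
    C c * g ∈ V ↔ g ∈ V := by
  rw [C_mul']
  exact Submodule.smul_mem_iff V hc

lemma apolar_congr {l l' : ℕ → Pxy K} {N : ℕ}
    (h : ∀ i < N, ∃ c : K, c ≠ 0 ∧ l i = C c * l' i) : apolar l N = apolar l' N := by
  induction N with
  | zero => rfl
  | succ N ih =>
    ext g
    obtain ⟨c, hc, hl⟩ := h N N.lt_succ_self
    rw [mem_apolar_succ, mem_apolar_succ, ih fun i hi => h i (by omega), hl, polar_C_mul,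
      C_mul_mem_iff hc]

lemma IsLinChange.mem_apolar {φ : Pxy K ≃ₐ[K] Pxy K} (hφ : IsLinChange φ) {l : ℕ → Pxy K}
    (hl : ∀ i, l i ∈ forms K 1) {N : ℕ} {g : Pxy K} :
    φ g ∈ apolar (fun i => φ (l i)) N ↔ g ∈ apolar l N := by
  obtain ⟨δ, hδ, h⟩ := hφ.exists_polar
  induction N generalizing g with
  | zero => simp [apolar]
  | succ N ih =>
    rw [mem_apolar_succ, mem_apolar_succ, h _ (hl N), C_mul_mem_iff hδ, ih]
    refine and_congr_left fun _ => ⟨fun hg => ?_, hφ.map_mem_forms⟩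
    simpa using hφ.symm.map_mem_forms hg

lemma IsLinChange.map_apolar {φ : Pxy K ≃ₐ[K] Pxy K} (hφ : IsLinChange φ) {l : ℕ → Pxy K}
    (hl : ∀ i, l i ∈ forms K 1) (N : ℕ) :
    (apolar l N).map φ.toLinearMap = apolar (fun i => φ (l i)) N := by
  ext g
  rw [Submodule.mem_map]
  constructor
  · rintro ⟨u, hu, rfl⟩
    exact (hφ.mem_apolar hl).2 hu
  · intro hg
    refine ⟨φ.symm g, ?_, by simp⟩
    rw [← hφ.mem_apolar hl]
    simpa using hg

lemma exists_dual_of_hyperplane {N : ℕ} {V : Submodule K (Pxy K)} (hV : V ≤ forms K N)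
    (hdim : Module.finrank K V = N) :
    ∃ ψ : Pxy K →ₗ[K] K, V = forms K N ⊓ LinearMap.ker ψ := by
  have hne : ¬ forms K N ≤ V := by
    intro h
    have := finrank_forms (K := K) N
    rw [le_antisymm h hV, hdim] at this
    omega
  obtain ⟨w, hw, hwV⟩ := SetLike.not_le_iff_exists.1 hne
  obtain ⟨ψ, hψ, hψV⟩ := Submodule.exists_le_ker_of_notMem hwV
  refine ⟨ψ, ?_⟩
  have fd := finiteDimensional_of_le_forms (K := K) (V := forms K N ⊓ LinearMap.ker ψ) inf_le_left
  apply Submodule.eq_of_le_of_finrank_le (le_inf hV hψV)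
  have : forms K N ⊓ LinearMap.ker ψ < forms K N :=
    lt_of_le_of_ne inf_le_left fun h => hψ (LinearMap.mem_ker.1 (inf_eq_left.1 h hw))
  have := Submodule.finrank_lt_finrank_of_lt this
  rw [finrank_forms] at this
  omega

/-- A hyperplane of binary forms contains a pure power. -/
lemma exists_pow_mem [IsAlgClosed K] {N : ℕ} (hN : 1 ≤ N) {V : Submodule K (Pxy K)}
    (hV : V ≤ forms K N) (hdim : Module.finrank K V = N) :
    ∃ m ∈ forms K 1, m ≠ 0 ∧ m ^ N ∈ V := by
  obtain ⟨ψ, rfl⟩ := exists_dual_of_hyperplane hV hdim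
  by_cases h1 : ψ (X 1 ^ N) = 0
  · exact ⟨X 1, X_mem_forms 1, X_ne_zero _, forms_pow_one (X_mem_forms 1) N, h1⟩
  let p : Polynomial K := ∑ j ∈ Finset.range (N + 1),
    Polynomial.monomial j (ψ (X 1 ^ j * X 0 ^ (N - j)) * N.choose j)
  have hp : p.coeff N ≠ 0 := by
    simp only [p, Polynomial.finsetSum_coeff, Polynomial.coeff_monomial]
    simpa using h1
  have hdeg : p.degree ≠ 0 := by
    intro h
    have := Polynomial.le_natDegree_of_ne_zero hp
    have : p.natDegree = 0 := Polynomial.natDegree_eq_of_degree_eq_some h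
    omega
  obtain ⟨s, hs⟩ := IsAlgClosed.exists_root p hdeg
  refine ⟨lin 1 s, lin_mem_forms _ _, fun h => one_ne_zero (lin_eq_zero.1 h).1,
    forms_pow_one (lin_mem_forms _ _) N, ?_⟩
  change ψ _ = 0
  rw [← hs, lin, C_1, one_mul, add_comm, add_pow, map_sum]
  simp only [p, Polynomial.eval_finsetSum, Polynomial.eval_monomial]
  refine Finset.sum_congr rfl fun j _ => ?_
  have : (C s * X 1 : Pxy K) ^ j * X 0 ^ (N - j) * (N.choose j : Pxy K) =
      (s ^ j * (N.choose j : K)) • (X 1 ^ j * X 0 ^ (N - j)) := by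
    rw [smul_eq_C_mul, C_mul, map_natCast, C_pow]
    ring
  rw [this, map_smul, smul_eq_mul]
  ring

lemma exists_apolar [IsAlgClosed K] [CharZero K] {N : ℕ} {V : Submodule K (Pxy K)}
    (hV : V ≤ forms K N) (hdim : Module.finrank K V = N) :
    ∃ l : ℕ → Pxy K, (∀ i, l i ∈ forms K 1 ∧ l i ≠ 0) ∧ V = apolar l N := by
  induction N generalizing V with
  | zero =>
    have := finiteDimensional_of_le_forms hV
    exact ⟨fun _ => X 0, fun _ => ⟨X_mem_forms 0, X_ne_zero _⟩, Submodule.finrank_eq_zero.1 hdim⟩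
  | succ N ih =>
    have fV := finiteDimensional_of_le_forms hV
    obtain ⟨m, hm, hm0, hmV⟩ := exists_pow_mem (by omega) hV hdim
    have hpow : polar m (m ^ (N + 1)) = 0 := by
      rw [Derivation.leibniz_pow, polar_self hm, smul_zero, smul_zero]
    have hle : V.map (polar m).toLinearMap ≤ forms K N := by
      rintro _ ⟨g, hg, rfl⟩
      exact polar_mem_forms m (hV hg)
    have hd : Module.finrank K (V.map (polar m).toLinearMap) = N := by
      have h1 := LinearMap.finrank_range_add_finrank_ker ((polar m).toLinearMap.domRestrict V)
      rw [LinearMap.range_domRestrict, hdim] at h1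
      have h2 : Module.finrank K (LinearMap.ker ((polar m).toLinearMap.domRestrict V)) = 1 := by
        let v : LinearMap.ker ((polar m).toLinearMap.domRestrict V) := ⟨⟨m ^ (N + 1), hmV⟩, hpow⟩
        refine (finrank_eq_one_iff_of_nonzero' v ?_).2 ?_
        · intro h
          exact pow_ne_zero _ hm0 (congrArg (fun z => ((z : V) : Pxy K)) (congrArg Subtype.val h))
        · rintro ⟨⟨g, hg⟩, hgk⟩
          obtain ⟨c, hc⟩ := eq_C_mul_pow_of_polar_eq_zero hm hm0 (hV hg) hgk
          refine ⟨c, Subtype.ext (Subtype.ext ?_)⟩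
          change c • m ^ (N + 1) = g
          rw [hc, smul_eq_C_mul]
      omega
    obtain ⟨l, hl, hlV⟩ := ih hle hd
    refine ⟨fun i => if i = N then m else l i, fun i => ?_, ?_⟩
    · beta_reduce
      split_ifs
      · exact ⟨hm, hm0⟩
      · exact hl i
    · have hcong : apolar (fun i => if i = N then m else l i) N = apolar l N :=
        apolar_congr fun i hi => ⟨1, one_ne_zero, by simp [hi.ne]⟩
      ext g
      rw [mem_apolar_succ, hcong, if_pos rfl, ← hlV]
      constructor
      · exact fun hg => ⟨hV hg, Submodule.mem_map_of_mem hg⟩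
      · rintro ⟨hg, v, hv, hvg⟩
        obtain ⟨c, hc⟩ := eq_C_mul_pow_of_polar_eq_zero hm hm0 (Submodule.sub_mem _ hg (hV hv))
          (by rw [map_sub, sub_eq_zero]; exact hvg.symm)
        rw [sub_eq_iff_eq_add.1 hc, ← smul_eq_C_mul]
        exact Submodule.add_mem _ (Submodule.smul_mem _ _ hmV) hv

end Polar

section NormalForms

variable {K : Type*} [Field K]

lemma exists_eq_C_mul_of_det_eq_zero {a b c d : K} (h0 : lin a b ≠ 0) (h1 : lin c d ≠ 0)
    (h : a * d - b * c = 0) : ∃ e : K, e ≠ 0 ∧ lin c d = C e * lin a b := by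
  simp only [ne_eq, lin_eq_zero, not_and_or] at h0 h1
  by_cases ha : a = 0
  · subst ha
    have hb : b ≠ 0 := by simpa using h0
    have hc : c = 0 := by
      have : b * c = 0 := by linear_combination -h
      exact (mul_eq_zero.1 this).resolve_left hb
    subst hc
    have hd : d ≠ 0 := by simpa using h1
    refine ⟨d / b, div_ne_zero hd hb, ?_⟩
    rw [C_mul_lin, mul_zero, div_mul_cancel₀ _ hb]
  · have hc : c ≠ 0 := by
      rintro rfl
      have : a * d = 0 := by linear_combination h
      have := (mul_eq_zero.1 this).resolve_left ha
      simp [this] at h1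
    refine ⟨c / a, div_ne_zero hc ha, ?_⟩
    rw [C_mul_lin, div_mul_cancel₀ _ ha]
    congr 1
    field_simp
    linear_combination h

lemma exists_linChange_X_zero {m : Pxy K} (hm : m ∈ forms K 1) (hm0 : m ≠ 0) :
    ∃ φ : Pxy K ≃ₐ[K] Pxy K, IsLinChange φ ∧ φ m = X 0 := by
  obtain ⟨a, b, rfl⟩ := mem_forms_one.1 hm
  by_cases ha : a = 0
  · have hb : b ≠ 0 := by
      rintro rfl
      exact hm0 (lin_eq_zero.2 ⟨ha, rfl⟩)
    obtain ⟨φ, hφ, h, -⟩ := exists_linChange (a := a) (b := b) (c := 1) (d := 0) (by simpa)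
    exact ⟨φ, hφ, h⟩
  · obtain ⟨φ, hφ, h, -⟩ := exists_linChange (a := a) (b := b) (c := 0) (d := 1) (by simpa)
    exact ⟨φ, hφ, h⟩

lemma algEquiv_C (φ : Pxy K ≃ₐ[K] Pxy K) (c : K) : φ (C c) = C c := by
  rw [← algebraMap_eq, AlgEquiv.commutes]

lemma eq_C_mul_of_C_mul_eq {c : K} (hc : c ≠ 0) {f g : Pxy K} (h : C c * f = g) :
    f = C c⁻¹ * g := by
  rw [← h, ← mul_assoc, ← C_mul, inv_mul_cancel₀ hc, C_1, one_mul]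

variable (K) in
/-- Three pairwise independent linear forms. -/
def refLin : Fin 3 → Pxy K := ![X 0, X 1, X 0 + X 1]

variable (K) in
/-- The sequence of reference linear forms attached to a selection `p`. -/
def refSeq (p : Fin 3 → Fin 3) (i : ℕ) : Pxy K := refLin K (p (Fin.ofNat 3 i))

/-- Three linear forms can be moved to multiples of `x`, `y`, `x + y`. -/
lemma exists_refSeq {l : ℕ → Pxy K} (hl : ∀ i, l i ∈ forms K 1 ∧ l i ≠ 0) :
    ∃ φ : Pxy K ≃ₐ[K] Pxy K, IsLinChange φ ∧ ∃ p : Fin 3 → Fin 3,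
      ∀ i < 3, ∃ c : K, c ≠ 0 ∧ φ (l i) = C c * refSeq K p i := by
  suffices h : ∃ φ : Pxy K ≃ₐ[K] Pxy K, IsLinChange φ ∧ ∃ p : Fin 3 → Fin 3,
      (∃ c : K, c ≠ 0 ∧ φ (l 0) = C c * refLin K (p 0)) ∧
      (∃ c : K, c ≠ 0 ∧ φ (l 1) = C c * refLin K (p 1)) ∧
      (∃ c : K, c ≠ 0 ∧ φ (l 2) = C c * refLin K (p 2)) by
    obtain ⟨φ, hφ, p, h0, h1, h2⟩ := h
    refine ⟨φ, hφ, p, fun i hi => ?_⟩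
    interval_cases i
    · exact h0
    · exact h1
    · exact h2
  obtain ⟨a, b, e0⟩ := mem_forms_one.1 (hl 0).1
  obtain ⟨c, d, e1⟩ := mem_forms_one.1 (hl 1).1
  obtain ⟨r, s, e2⟩ := mem_forms_one.1 (hl 2).1
  have n0 := (hl 0).2
  have n1 := (hl 1).2
  have n2 := (hl 2).2
  by_cases h01 : a * d - b * c = 0
  · obtain ⟨u, hu, hu1⟩ := exists_eq_C_mul_of_det_eq_zero (e0 ▸ n0) (e1 ▸ n1) h01
    rw [← e0, ← e1] at hu1
    by_cases h02 : a * s - b * r = 0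
    · obtain ⟨v, hv, hv1⟩ := exists_eq_C_mul_of_det_eq_zero (e0 ▸ n0) (e2 ▸ n2) h02
      rw [← e0, ← e2] at hv1
      obtain ⟨φ, hφ, h⟩ := exists_linChange_X_zero (hl 0).1 n0
      refine ⟨φ, hφ, ![0, 0, 0], ⟨1, one_ne_zero, ?_⟩, ⟨u, hu, ?_⟩, ⟨v, hv, ?_⟩⟩
      · simp [refLin, h]
      · rw [hu1, map_mul, algEquiv_C, h]; rfl
      · rw [hv1, map_mul, algEquiv_C, h]; rfl
    · obtain ⟨φ, hφ, h, h'⟩ := exists_linChange h02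
      rw [← e0] at h
      rw [← e2] at h'
      refine ⟨φ, hφ, ![0, 0, 1], ⟨1, one_ne_zero, ?_⟩, ⟨u, hu, ?_⟩, ⟨1, one_ne_zero, ?_⟩⟩
      · simp [refLin, h]
      · rw [hu1, map_mul, algEquiv_C, h]; rfl
      · simp [refLin, h']
  · set u := (r * d - s * c) / (a * d - b * c) with hu
    set v := (a * s - b * r) / (a * d - b * c) with hv
    have hlin : l 2 = C u * l 0 + C v * l 1 := by
      rw [e0, e1, e2, C_mul_lin, C_mul_lin, lin_add_lin, lin_inj, hu, hv]
      constructor <;>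
      · rw [div_mul_eq_mul_div, div_mul_eq_mul_div, ← add_div, eq_div_iff h01]
        ring
    by_cases hu0 : u = 0
    · have hv0 : v ≠ 0 := by
        intro hv0
        rw [hu0, hv0] at hlin
        simp [hlin] at n2
      obtain ⟨φ, hφ, h, h'⟩ := exists_linChange h01
      rw [← e0] at h
      rw [← e1] at h'
      refine ⟨φ, hφ, ![0, 1, 1], ⟨1, one_ne_zero, ?_⟩, ⟨1, one_ne_zero, ?_⟩, ⟨v, hv0, ?_⟩⟩
      · simp [refLin, h]
      · simp [refLin, h']
      · rw [hlin, hu0, map_add, map_mul, map_mul, algEquiv_C, algEquiv_C, h']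
        simp [refLin]
    · by_cases hv0 : v = 0
      · obtain ⟨φ, hφ, h, h'⟩ := exists_linChange h01
        rw [← e0] at h
        rw [← e1] at h'
        refine ⟨φ, hφ, ![0, 1, 0], ⟨1, one_ne_zero, ?_⟩, ⟨1, one_ne_zero, ?_⟩, ⟨u, hu0, ?_⟩⟩
        · simp [refLin, h]
        · simp [refLin, h']
        · rw [hlin, hv0, map_add, map_mul, map_mul, algEquiv_C, algEquiv_C, h]
          simp [refLin]
      · obtain ⟨φ, hφ, h, h'⟩ := exists_linChange (a := u * a) (b := u * b) (c := v * c)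
          (d := v * d) (by
            rw [show u * a * (v * d) - u * b * (v * c) = u * v * (a * d - b * c) by ring]
            exact mul_ne_zero (mul_ne_zero hu0 hv0) h01)
        rw [← C_mul_lin, ← e0, map_mul, algEquiv_C] at h
        rw [← C_mul_lin, ← e1, map_mul, algEquiv_C] at h'
        refine ⟨φ, hφ, ![0, 1, 2], ⟨u⁻¹, inv_ne_zero hu0, ?_⟩, ⟨v⁻¹, inv_ne_zero hv0, ?_⟩,
          ⟨1, one_ne_zero, ?_⟩⟩
        · rw [eq_C_mul_of_C_mul_eq hu0 h]; rfl
        · rw [eq_C_mul_of_C_mul_eq hv0 h']; rfl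
        · rw [hlin, map_add, map_mul, map_mul, algEquiv_C, algEquiv_C, h, h']
          simp [refLin]

lemma exists_prod_eq_C_mul {f g : ℕ → Pxy K} {m : ℕ}
    (h : ∀ i < m, ∃ c : K, c ≠ 0 ∧ f i = C c * g i) :
    ∃ c : K, c ≠ 0 ∧ ∏ i ∈ Finset.range m, f i = C c * ∏ i ∈ Finset.range m, g i := by
  induction m with
  | zero => exact ⟨1, one_ne_zero, by simp⟩
  | succ m ih =>
    obtain ⟨c, hc, h1⟩ := ih fun i hi => h i (by omega)
    obtain ⟨d, hd, h2⟩ := h m (by omega)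
    refine ⟨c * d, mul_ne_zero hc hd, ?_⟩
    rw [Finset.prod_range_succ, Finset.prod_range_succ, h1, h2, C_mul]
    ring

lemma map_mulLeft_C_mul {c : K} (hc : c ≠ 0) (f : Pxy K) (V : Submodule K (Pxy K)) :
    V.map (LinearMap.mulLeft K (C c * f)) = V.map (LinearMap.mulLeft K f) := by
  have : LinearMap.mulLeft K (C c * f) = c • LinearMap.mulLeft K f := by
    refine LinearMap.ext fun g => ?_
    rw [LinearMap.smul_apply, LinearMap.mulLeft_apply, LinearMap.mulLeft_apply, smul_eq_C_mul,
      mul_assoc]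
  rw [this, Submodule.map_smul _ _ _ hc]

lemma map_map_mulLeft (φ : Pxy K ≃ₐ[K] Pxy K) (f : Pxy K) (V : Submodule K (Pxy K)) :
    (V.map (LinearMap.mulLeft K f)).map φ.toLinearMap =
      (V.map φ.toLinearMap).map (LinearMap.mulLeft K (φ f)) := by
  rw [← Submodule.map_comp, ← Submodule.map_comp]
  congr 1
  exact LinearMap.ext fun g => by simp

lemma map_map_mulLeft_prod (φ : Pxy K ≃ₐ[K] Pxy K) {l r : ℕ → Pxy K} {m : ℕ}
    (h : ∀ i < m, ∃ c : K, c ≠ 0 ∧ φ (l i) = C c * r i) (V : Submodule K (Pxy K)) :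
    (V.map (LinearMap.mulLeft K (∏ i ∈ Finset.range m, l i))).map φ.toLinearMap =
      (V.map φ.toLinearMap).map (LinearMap.mulLeft K (∏ i ∈ Finset.range m, r i)) := by
  obtain ⟨c, hc, hp⟩ := exists_prod_eq_C_mul h
  rw [map_map_mulLeft, map_prod, hp, map_mulLeft_C_mul hc]

lemma IsLinChange.map_mulForms_prod {φ : Pxy K ≃ₐ[K] Pxy K} (hφ : IsLinChange φ)
    {l r : ℕ → Pxy K} {m : ℕ} (h : ∀ i < m, ∃ c : K, c ≠ 0 ∧ φ (l i) = C c * r i) (k : ℕ) :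
    (mulForms (∏ i ∈ Finset.range m, l i) k).map φ.toLinearMap =
      mulForms (∏ i ∈ Finset.range m, r i) k := by
  rw [mulForms, map_map_mulLeft_prod φ h, hφ.map_forms, mulForms]

variable {t : ℕ → ℕ} {n : ℕ}

lemma homogFiniteType_of_noAdj [IsAlgClosed K] (hn : 2 ≤ n) (hlow : ∀ i ≤ n - 1, t i = i + 1)
    (hmono : ∀ j, n - 1 ≤ j → t (j + 1) ≤ t j) (hfin : ∃ N, ∀ j ≥ N, t j = 0)
    (h3 : t n ≤ 3) (hadj : NoAdj t n) : HomogFiniteType K t := by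
  let F : (ℕ → Pxy K) → ℕ → Submodule K (Pxy K) := fun l k =>
    if k < n then ⊥ else mulForms (∏ i ∈ Finset.range (t k), l i) (k - t k)
  refine homogFiniteType_of_layers (T := Set.range fun p => F (refSeq K p)) (Set.finite_range _)
    fun I _ ht => ?_
  have hD := isGradedPiece_layer ht
  have hn1 : t (n - 1) = n := by rw [hlow _ le_rfl]; omega
  have htn : t n ≤ n := (anti_of_step hmono le_rfl (by omega)).trans hn1.le
  obtain ⟨l, hl, hlD⟩ := hD.exists_chain (by omega) hmono hfin hadj htn
  obtain ⟨φ, hφ, p, hp⟩ := exists_refSeq hl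
  refine ⟨φ, hφ, p, funext fun k => ?_⟩
  simp only [F]
  split_ifs with hk
  · rw [hD.eq_bot (hlow k (by omega)), Submodule.map_bot]
  · have : t k ≤ t n := anti_of_step hmono (by omega) (by omega)
    rw [hlD k (by omega), hφ.map_mulForms_prod fun i hi => hp i (by omega)]

lemma homogFiniteType_of_apolar [IsAlgClosed K] [CharZero K] (hn : 2 ≤ n)
    (hlow : ∀ i ≤ n - 1, t i = i + 1)
    (hmono : ∀ j, n - 1 ≤ j → t (j + 1) ≤ t j) (hfin : ∃ N, ∀ j ≥ N, t j = 0)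
    (h3 : n ≤ 3) (ht1 : t (n + 1) + 1 = t n) (hadj : NoAdj t (n + 1)) :
    HomogFiniteType K t := by
  set c := t (n + 1) with hc
  let F : (ℕ → Pxy K) → ℕ → Submodule K (Pxy K) := fun l k =>
    if k < n then ⊥ else if k = n then
      (apolar (fun i => l (c + i)) (n - c)).map
        (LinearMap.mulLeft K (∏ i ∈ Finset.range c, l i))
    else mulForms (∏ i ∈ Finset.range (t k), l i) (k - t k)
  refine homogFiniteType_of_layers (T := Set.range fun p => F (refSeq K p)) (Set.finite_range _)
    fun I _ ht => ?_
  have hD := isGradedPiece_layer ht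
  have hn1 : t (n - 1) = n := by rw [hlow _ le_rfl]; omega
  have htn : t n ≤ n := (anti_of_step hmono le_rfl (by omega)).trans hn1.le
  obtain ⟨l, hl, hlD⟩ := hD.exists_chain (m := n + 1) (by omega) (fun j hj => hmono j (by omega))
    hfin hadj (by omega)
  set f := ∏ i ∈ Finset.range c, l i with hf
  have hf0 : f ≠ 0 := prod_lin_ne_zero hl _
  set V : Submodule K (Pxy K) := forms K (n - c) ⊓ (layer I n).comap (LinearMap.mulLeft K f)
    with hV
  have hVD : layer I n = V.map (LinearMap.mulLeft K f) := by
    apply le_antisymm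
    · intro g hg
      have hdvd : f ∣ g := hD.dvd_of_mul (hlD (n + 1) le_rfl).le hg
      have hgn : g ∈ forms K (c + (n - c)) := by
        rw [Nat.add_sub_cancel' (by omega)]; exact hD.le n hg
      obtain ⟨u, hu, rfl⟩ := mem_mulForms.1 (mem_mulForms_of_dvd (prod_lin_mem_forms hl _) hgn hdvd)
      exact ⟨u, ⟨hu, hg⟩, rfl⟩
    · rintro _ ⟨u, ⟨-, hu⟩, rfl⟩
      exact hu
  have hVdim : Module.finrank K V = n - c := by
    have := hD.dim n
    rw [hVD, finrank_map_mulLeft hf0] at this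
    omega
  obtain ⟨l', hl', hVl⟩ := exists_apolar (hV ▸ inf_le_left) hVdim
  let l'' : ℕ → Pxy K := fun i => if i < c then l i else l' (i - c)
  have hl'' : ∀ i, l'' i ∈ forms K 1 ∧ l'' i ≠ 0 := by
    intro i
    simp only [l'']
    split_ifs
    · exact hl i
    · exact hl' _
  have hprod : ∀ m ≤ c, ∏ i ∈ Finset.range m, l i = ∏ i ∈ Finset.range m, l'' i := by
    intro m hm
    refine Finset.prod_congr rfl fun i hi => ?_
    exact (if_pos ((Finset.mem_range.1 hi).trans_le hm)).symm
  have hshift : l' = fun i => l'' (c + i) := by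
    funext i
    simp [l'']
  obtain ⟨φ, hφ, p, hp⟩ := exists_refSeq hl''
  refine ⟨φ, hφ, p, funext fun k => ?_⟩
  simp only [F]
  split_ifs with hk hkn
  · rw [hD.eq_bot (hlow k (by omega)), Submodule.map_bot]
  · rw [hkn, hVD, hVl, hf, hprod c le_rfl, map_map_mulLeft_prod φ fun i hi => hp i (by omega),
      hshift, hφ.map_apolar fun i => (hl'' _).1]
    congr 1
    exact (apolar_congr fun i hi => hp (c + i) (by omega)).symm
  · have : t k ≤ c := anti_of_step hmono (by omega) (by omega)
    rw [hlD k (by omega), hprod _ this, hφ.map_mulForms_prod fun i hi => hp i (by omega)]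

lemma exists_forms_succ' {g : Pxy K} {k : ℕ} (hg : g ∈ forms K (k + 1)) :
    ∃ h ∈ forms K k, ∃ c : K, g = X 0 * h + C c * X 1 ^ (k + 1) := by
  obtain ⟨φ, hφ, h0, h1⟩ := exists_linChange (K := K) (a := 0) (b := 1) (c := 1) (d := 0) (by simp)
  rw [lin_zero_one] at h0
  rw [lin_one_zero] at h1
  obtain ⟨h, hh, c, hc⟩ := exists_forms_succ (hφ.symm.map_mem_forms hg)
  refine ⟨φ h, hφ.map_mem_forms hh, c, ?_⟩
  have := congrArg φ hc
  rwa [AlgEquiv.apply_symm_apply, map_add, map_mul, map_mul, map_pow, algEquiv_C, h0, h1] at this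

variable (K) in
/-- Normal forms of pairs consisting of a quadratic form and a form of degree `k + 1` which is
not a multiple of it. -/
def normalPairs (k : ℕ) : Set (Pxy K × Pxy K) :=
  {(X 0 * X 1, X 0 ^ (k + 1)), (X 0 * X 1, X 1 ^ (k + 1)),
    (X 0 * X 1, X 0 ^ (k + 1) + X 1 ^ (k + 1)), (X 0 ^ 2, X 0 * X 1 ^ k), (X 0 ^ 2, X 1 ^ (k + 1))}

lemma exists_normalPair [IsAlgClosed K] [CharZero K] {f w : Pxy K} {k : ℕ} (hk : 1 ≤ k)
    (hf : f ∈ forms K 2) (hf0 : f ≠ 0) (hw : w ∈ forms K (k + 1)) (hfw : ¬ f ∣ w) :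
    ∃ φ : Pxy K ≃ₐ[K] Pxy K, IsLinChange φ ∧ ∃ p ∈ normalPairs K k,
      (∃ c : K, c ≠ 0 ∧ φ f = C c * p.1) ∧ ∃ d : K, d ≠ 0 ∧ p.1 ∣ φ w - C d * p.2 := by
  obtain ⟨j, rfl⟩ : ∃ j, k = j + 1 := ⟨k - 1, by omega⟩
  obtain ⟨l, hl, q, hq, rfl⟩ := exists_prod_lin hf hf0
  simp only [Finset.prod_range_succ, Finset.range_zero, Finset.prod_empty, one_mul] at *
  obtain ⟨a, b, e0⟩ := mem_forms_one.1 (hl 0).1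
  obtain ⟨c, d, e1⟩ := mem_forms_one.1 (hl 1).1
  have hndvd : ∀ (φ : Pxy K ≃ₐ[K] Pxy K) (u : Pxy K) (r : K), φ (C q * (l 0 * l 1)) = C r * u →
      r ≠ 0 → ¬ u ∣ φ w := by
    intro φ u r hu hr hdvd
    apply hfw
    rw [← map_dvd_iff φ, hu]
    have hunit : IsUnit (C r : Pxy K) := (isUnit_iff_ne_zero.2 hr).map C
    rwa [hunit.mul_left_dvd]
  by_cases h01 : a * d - b * c = 0
  · obtain ⟨u, hu, hu1⟩ := exists_eq_C_mul_of_det_eq_zero (e0 ▸ (hl 0).2) (e1 ▸ (hl 1).2) h01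
    rw [← e0, ← e1] at hu1
    obtain ⟨φ, hφ, h⟩ := exists_linChange_X_zero (hl 0).1 (hl 0).2
    have hφf : φ (C q * (l 0 * l 1)) = C (q * u) * X 0 ^ 2 := by
      rw [hu1, map_mul, map_mul, map_mul, algEquiv_C, algEquiv_C, h, C_mul]
      ring
    obtain ⟨h1, hh1, β, hβ⟩ := exists_forms_succ' (hφ.map_mem_forms hw)
    obtain ⟨h2, hh2, α, rfl⟩ := exists_forms_succ' hh1
    by_cases hβ0 : β = 0
    · refine ⟨φ, hφ, (X 0 ^ 2, X 0 * X 1 ^ (j + 1)), by simp [normalPairs],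
        ⟨q * u, mul_ne_zero hq hu, hφf⟩, α, ?_, h2, ?_⟩
      · rintro rfl
        apply hndvd φ _ _ hφf (mul_ne_zero hq hu)
        rw [hβ, hβ0]
        exact ⟨h2, by simp; ring⟩
      · rw [hβ, hβ0, C_0]
        ring
    · have hj : ((j + 2 : ℕ) : K) ≠ 0 := Nat.cast_ne_zero.2 (by omega)
      obtain ⟨γ, hγ⟩ : ∃ γ : K, α = γ * (j + 2 : ℕ) * β := ⟨α / ((j + 2 : ℕ) * β), by field_simp⟩
      obtain ⟨ψ, hψ, g0, g1⟩ := exists_linChange (K := K) (a := 1) (b := 0) (c := γ) (d := 1)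
        (by simp)
      rw [lin_one_zero] at g0
      have g1 : ψ (X 1) = X 1 + (- C γ * X 0) := by
        rw [lin, map_add, map_mul, map_mul, algEquiv_C, algEquiv_C, g0, C_1, one_mul] at g1
        linear_combination g1
      refine ⟨φ.trans ψ, hφ.trans hψ, (X 0 ^ 2, X 1 ^ (j + 1 + 1)), by simp [normalPairs],
        ⟨q * u, mul_ne_zero hq hu, ?_⟩, β, hβ0, ?_⟩
      · rw [AlgEquiv.trans_apply, hφf, map_mul, map_pow, algEquiv_C, g0]
      · rw [AlgEquiv.trans_apply, hβ]
        simp only [map_add, map_mul, map_pow, algEquiv_C, g0, g1]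
        obtain ⟨v, hv⟩ := Polynomial.powAddExpansion (X 1 : Pxy K) (- C γ * X 0) (j + 1 + 1)
        obtain ⟨v', hv'⟩ := sub_dvd_pow_sub_pow (X 1 + (- C γ * X 0) : Pxy K) (X 1) (j + 1)
        rw [hv, sub_eq_iff_eq_add.1 hv', hγ, Nat.add_sub_cancel]
        refine ⟨ψ h2 - C (γ * (j + 2 : ℕ) * β) * C γ * v' + C β * v * C γ ^ 2, ?_⟩
        rw [C_mul, C_mul, map_natCast]
        simp only [Nat.add_assoc, Nat.reduceAdd]
        ring
  · obtain ⟨φ, hφ, h, h'⟩ := exists_linChange h01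
    rw [← e0] at h
    rw [← e1] at h'
    have hφf : φ (C q * (l 0 * l 1)) = C q * (X 0 * X 1) := by
      rw [map_mul, map_mul, algEquiv_C, h, h']
    have hnd := hndvd φ _ _ hφf hq
    obtain ⟨h1, hh1, β, hβ⟩ := exists_forms_succ' (hφ.map_mem_forms hw)
    obtain ⟨h2, hh2, α, rfl⟩ := exists_forms_succ hh1
    by_cases hβ0 : β = 0
    · refine ⟨φ, hφ, (X 0 * X 1, X 0 ^ (j + 1 + 1)), by simp [normalPairs], ⟨q, hq, hφf⟩, α, ?_,
        h2, ?_⟩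
      · rintro rfl
        apply hnd
        rw [hβ, hβ0]
        exact ⟨h2, by simp; ring⟩
      · rw [hβ, hβ0, C_0]
        ring
    · by_cases hα0 : α = 0
      · refine ⟨φ, hφ, (X 0 * X 1, X 1 ^ (j + 1 + 1)), by simp [normalPairs], ⟨q, hq, hφf⟩, β, hβ0,
          h2, ?_⟩
        rw [hβ, hα0, C_0]
        ring
      · obtain ⟨r, hr⟩ := IsAlgClosed.exists_pow_nat_eq α (n := j + 1 + 1) (by omega)
        obtain ⟨s, hs⟩ := IsAlgClosed.exists_pow_nat_eq β (n := j + 1 + 1) (by omega)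
        have hr0 : r ≠ 0 := by rintro rfl; simp at hr; exact hα0 hr.symm
        have hs0 : s ≠ 0 := by rintro rfl; simp at hs; exact hβ0 hs.symm
        obtain ⟨ψ, hψ, g0, g1⟩ := exists_linChange (K := K) (a := r) (b := 0) (c := 0) (d := s)
          (by simp [hr0, hs0])
        simp only [lin, C_0, zero_mul, add_zero, zero_add] at g0 g1
        have k0 := g0
        have k1 := g1
        rw [map_mul, algEquiv_C] at k0 k1
        have k0 := eq_C_mul_of_C_mul_eq hr0 k0
        have k1 := eq_C_mul_of_C_mul_eq hs0 k1
        refine ⟨φ.trans ψ, hφ.trans hψ, (X 0 * X 1, X 0 ^ (j + 1 + 1) + X 1 ^ (j + 1 + 1)),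
          by simp [normalPairs], ⟨q * (r⁻¹ * s⁻¹), by simp [hq, hr0, hs0], ?_⟩, 1, one_ne_zero,
          C (r⁻¹ * s⁻¹) * ψ h2, ?_⟩
        · rw [AlgEquiv.trans_apply, hφf, map_mul, map_mul, algEquiv_C, k0, k1, C_mul, C_mul]
          ring
        · rw [AlgEquiv.trans_apply, hβ]
          have hsplit : X 0 * (X 1 * h2 + C α * X 0 ^ (j + 1)) + C β * X 1 ^ (j + 1 + 1) =
              X 0 * X 1 * h2 + (C r * X 0) ^ (j + 1 + 1) + (C s * X 1) ^ (j + 1 + 1) := by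
            rw [mul_pow, mul_pow, ← C_pow, ← C_pow, hr, hs]
            ring
          rw [hsplit, map_add, map_add, map_pow, map_pow, g0, g1, map_mul, map_mul, k0, k1, C_1,
            C_mul]
          ring

lemma normalPairs_mem_forms {k : ℕ} {p : Pxy K × Pxy K} (hp : p ∈ normalPairs K k) :
    p.1 ∈ forms K 2 ∧ p.2 ∈ forms K (k + 1) := by
  have h0 := X_mem_forms (K := K) 0
  have h1 := X_mem_forms (K := K) 1
  have h2 : (X 0 * X 1 : Pxy K) ∈ forms K 2 := forms_mul h0 h1
  have h3 : (X 0 ^ 2 : Pxy K) ∈ forms K 2 := forms_pow_one h0 2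
  have h4 : (X 0 * X 1 ^ k : Pxy K) ∈ forms K (k + 1) := by
    rw [add_comm]; exact forms_mul h0 (forms_pow_one h1 k)
  have h5 := forms_pow_one h0 (k + 1)
  have h6 := forms_pow_one h1 (k + 1)
  rcases hp with rfl | rfl | rfl | rfl | rfl
  · exact ⟨h2, h5⟩
  · exact ⟨h2, h6⟩
  · exact ⟨h2, Submodule.add_mem _ h5 h6⟩
  · exact ⟨h3, h4⟩
  · exact ⟨h3, h6⟩

lemma homogFiniteType_of_pencil [IsAlgClosed K] [CharZero K] (hn : 2 ≤ n)
    (hlow : ∀ i ≤ n - 1, t i = i + 1) (hmono : ∀ j, n - 1 ≤ j → t (j + 1) ≤ t j)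
    (h2 : t n = 2) {k : ℕ} (hnk : n ≤ k) (htk : t k = 2) (htk1 : t (k + 1) = 1)
    (htk2 : t (k + 2) = 0) (hor : n < k ∨ n = 2) : HomogFiniteType K t := by
  let F : Pxy K × Pxy K → ℕ → Submodule K (Pxy K) := fun p j =>
    if j < n then ⊥ else if j ≤ k then mulForms p.1 (j - 2) else if j = k + 1 then
      mulForms p.1 (k - 1) ⊔ K ∙ p.2 else forms K j
  have hfin : (normalPairs K k).Finite := by simp [normalPairs]
  refine homogFiniteType_of_layers (T := F '' normalPairs K k) (hfin.image F) fun I _ ht => ?_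
  have hD := isGradedPiece_layer ht
  have hn1 : t (n - 1) = n := by rw [hlow _ le_rfl]; omega
  have ht2 : ∀ j, n ≤ j → j ≤ k → t j = 2 := fun j hj hjk => by
    have a1 := anti_of_step hmono (i := n) (by omega) hj
    have a2 := anti_of_step hmono (i := j) (by omega) hjk
    omega
  have hprev : t (k - 1) = 2 := by
    rcases hor with h | rfl
    · exact ht2 _ (by omega) (by omega)
    · rcases hnk.eq_or_lt with rfl | h
      · exact hn1
      · exact ht2 _ (by omega) (by omega)
  obtain ⟨f, hf, hf0, hfD⟩ : ∃ f ∈ forms K 2, f ≠ 0 ∧ layer I k = mulForms f (k - 2) := by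
    obtain ⟨j, rfl⟩ : ∃ j, k = j + 1 := ⟨k - 1, by omega⟩
    rw [Nat.add_sub_cancel] at hprev
    have := hD.exists_eq_mulForms (k := j) (by omega)
    rwa [htk] at this
  have hlow' : ∀ d j, n ≤ j → j + d = k → layer I j = mulForms f (j - 2) := by
    intro d
    induction d with
    | zero => rintro j - rfl; exact hfD
    | succ d ih =>
      intro j hj hjd
      have hj2 := ht2 j hj (by omega)
      have := hD.eq_mulForms_of_succ (k := j) (by rwa [hj2]) hf0 (by omega)
        (ih (j + 1) (by omega) (by omega)).le
      rwa [hj2] at this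
  have hle : mulForms f (k - 1) ≤ layer I (k + 1) := by
    rw [show k - 1 = k - 2 + 1 by omega]
    apply mulForms_le_of_X_mul
    rw [← hfD]
    exact hD.mul k
  have hd1 := hD.dim (k + 1)
  have hne : ¬ layer I (k + 1) ≤ mulForms f (k - 1) := by
    intro h
    rw [le_antisymm h hle, finrank_mulForms hf0] at hd1
    omega
  obtain ⟨w, hw, hwf⟩ := SetLike.not_le_iff_exists.1 hne
  have hfw : ¬ f ∣ w := fun h => hwf (mem_mulForms_of_dvd hf (by
    rw [show 2 + (k - 1) = k + 1 by omega]; exact hD.le _ hw) h)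
  have htop : layer I (k + 1) = mulForms f (k - 1) ⊔ K ∙ w := by
    symm
    apply Submodule.eq_of_le_of_finrank_le
    · exact sup_le hle ((Submodule.span_singleton_le_iff_mem _ _).2 hw)
    · have hlt : mulForms f (k - 1) < mulForms f (k - 1) ⊔ K ∙ w :=
        lt_of_le_of_ne le_sup_left fun h => hwf (by
          rw [h]; exact Submodule.mem_sup_right (Submodule.mem_span_singleton_self w))
      have fd : FiniteDimensional K ↥(mulForms f (k - 1) ⊔ K ∙ w) :=
        finiteDimensional_of_le_forms ((sup_le hle
          ((Submodule.span_singleton_le_iff_mem _ _).2 hw)).trans (hD.le _))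
      have := Submodule.finrank_lt_finrank_of_lt hlt
      rw [finrank_mulForms hf0] at this
      omega
  obtain ⟨φ, hφ, p, hp, ⟨c, hc, hpc⟩, d, hd, hpd⟩ :=
    exists_normalPair (by omega) hf hf0 (hD.le _ hw) hfw
  refine ⟨φ, hφ, p, hp, funext fun j => ?_⟩
  have hmapf : ∀ m, (mulForms f m).map φ.toLinearMap = mulForms p.1 m := fun m => by
    rw [hφ.map_mulForms, hpc, mulForms_C_mul hc]
  simp only [F]
  split_ifs with hj hjk hjk1
  · rw [hD.eq_bot (hlow j (by omega)), Submodule.map_bot]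
  · rw [hlow' (k - j) j (by omega) (by omega), hmapf]
  · rw [hjk1, htop, Submodule.map_sup, hmapf, LinearMap.map_span, Set.image_singleton]
    have hdiff : φ w - C d * p.2 ∈ mulForms p.1 (k - 1) := by
      apply mem_mulForms_of_dvd (normalPairs_mem_forms hp).1 _ hpd
      rw [show 2 + (k - 1) = k + 1 by omega]
      refine Submodule.sub_mem _ (hφ.map_mem_forms (hD.le _ hw)) ?_
      rw [C_mul']
      exact Submodule.smul_mem _ _ (normalPairs_mem_forms hp).2
    apply le_antisymm
    · refine sup_le le_sup_left ((Submodule.span_singleton_le_iff_mem _ _).2 ?_)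
      rw [← C_mul_mem_iff hd, Submodule.mem_sup]
      refine ⟨-(φ w - C d * p.2), Submodule.neg_mem _ hdiff, φ w,
        Submodule.mem_span_singleton_self _, by ring⟩
    · refine sup_le le_sup_left ((Submodule.span_singleton_le_iff_mem _ _).2 ?_)
      change φ w ∈ _
      rw [Submodule.mem_sup]
      refine ⟨φ w - C d * p.2, hdiff, C d * p.2, ?_, by ring⟩
      rw [C_mul']
      exact Submodule.smul_mem _ _ (Submodule.mem_span_singleton_self _)
  · have : t j = 0 := by
      have := anti_of_step hmono (i := k + 2) (j := j) (by omega) (by omega)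
      omega
    rw [hD.eq_forms this, hφ.map_forms]

lemma homogFiniteType_of_smallType [IsAlgClosed K] [CharZero K] (hn : 2 ≤ n)
    (hlow : ∀ i ≤ n - 1, t i = i + 1)
    (hmono : ∀ j, n - 1 ≤ j → t (j + 1) ≤ t j) (hfin : ∃ N, ∀ j ≥ N, t j = 0)
    (h : SmallType t n) : HomogFiniteType K t := by
  rcases h with ⟨h1, h2⟩ | ⟨-, h2, h3, h4⟩ | ⟨h1, k, hk, h2, h3, h4, h5⟩
  · exact homogFiniteType_of_noAdj hn hlow hmono hfin h1 h2
  · exact homogFiniteType_of_apolar hn hlow hmono hfin h2 h3 h4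
  · exact homogFiniteType_of_pencil hn hlow hmono h1 hk h2 h3 h4 h5

end NormalForms

section Flexes

lemma exists_C_mul_of_wronskian_eq_zero {K : Type*} [Field K] [CharZero K] {f h : Polynomial K}
    (hf : f ≠ 0) (hw : Polynomial.wronskian f h = 0) : ∃ c : K, h = Polynomial.C c * f := by
  classical
  let _ : GCDMonoid (Polynomial K) := EuclideanDomain.gcdMonoid _
  have hd : GCDMonoid.gcd f h ≠ 0 := fun h0 => hf ((gcd_eq_zero_iff _ _).1 h0).1
  have hc := isCoprime_div_gcd_div_gcd_of_gcd_ne_zero hd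
  have e1 := EuclideanDomain.mul_div_cancel' hd (gcd_dvd_left f h)
  have e2 := EuclideanDomain.mul_div_cancel' hd (gcd_dvd_right f h)
  set d := GCDMonoid.gcd f h
  set a := f / d
  set b := h / d
  have hw' : Polynomial.wronskian a b = 0 := by
    have : d ^ 2 * Polynomial.wronskian a b = 0 := by
      rw [← hw, ← e1, ← e2]
      simp only [Polynomial.wronskian, Polynomial.derivative_mul]
      ring
    exact (mul_eq_zero.1 this).resolve_left (pow_ne_zero 2 hd)
  obtain ⟨ha, hb⟩ := hc.wronskian_eq_zero_iff.1 hw'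
  have ha := Polynomial.eq_C_of_derivative_eq_zero ha
  have hb := Polynomial.eq_C_of_derivative_eq_zero hb
  have ha0 : a.coeff 0 ≠ 0 := by
    intro h0
    rw [h0, Polynomial.C_0] at ha
    exact hf (by rw [← e1, ha, mul_zero])
  refine ⟨b.coeff 0 / a.coeff 0, ?_⟩
  rw [← e1, ← e2, ha, hb, mul_left_comm, ← Polynomial.C_mul]
  simp [div_mul_cancel₀ _ ha0]

/-- A linear system of polynomials of dimension `r` has finitely many flexes. -/
lemma finite_setOf_pow_dvd {K : Type*} [Field K] [CharZero K] (r : ℕ)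
    (V : Submodule K (Polynomial K)) [FiniteDimensional K V] (hr : Module.finrank K V ≤ r) :
    {α : K | ∃ h ∈ V, h ≠ 0 ∧ (Polynomial.X - Polynomial.C α) ^ r ∣ h}.Finite := by
  induction r generalizing V with
  | zero =>
    have : V = ⊥ := by rw [← Submodule.finrank_eq_zero (R := K)]; omega
    subst this
    convert Set.finite_empty (α := K)
    ext α
    simp only [Set.mem_ofPred_eq, Set.mem_empty_iff_false, iff_false]
    rintro ⟨h, h1, h2, -⟩
    exact h2 ((Submodule.mem_bot K).1 h1)
  | succ r ih =>
    by_cases hV : V = ⊥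
    · subst hV
      convert Set.finite_empty (α := K)
      ext α
      simp only [Set.mem_ofPred_eq, Set.mem_empty_iff_false, iff_false]
      rintro ⟨h, h1, h2, -⟩
      exact h2 ((Submodule.mem_bot K).1 h1)
    classical
    obtain ⟨f, hf, hf0⟩ := Submodule.exists_mem_ne_zero_of_ne_bot hV
    let D : Polynomial K →ₗ[K] Polynomial K := Polynomial.wronskianBilin K f
    have hker : 0 < Module.finrank K (LinearMap.ker (D.domRestrict V)) := by
      have hfker : (⟨f, hf⟩ : V) ∈ LinearMap.ker (D.domRestrict V) := by
        rw [LinearMap.mem_ker, LinearMap.domRestrict_apply]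
        simp [D, Polynomial.wronskian_self_eq_zero]
      refine Nat.pos_of_ne_zero fun h => hf0 ?_
      rw [Submodule.finrank_eq_zero.1 h, Submodule.mem_bot] at hfker
      simpa using hfker
    have hrank := (D.domRestrict V).finrank_range_add_finrank_ker
    rw [LinearMap.range_domRestrict] at hrank
    refine ((ih (V.map D) (by omega)).union f.roots.toFinset.finite_toSet).subset ?_
    rintro α ⟨h, hh, h0, hdvd⟩
    by_cases hw : Polynomial.wronskian f h = 0
    · right
      obtain ⟨c, rfl⟩ := exists_C_mul_of_wronskian_eq_zero hf0 hw
      have hc : c ≠ 0 := by rintro rfl; simp at h0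
      have := (dvd_pow_self _ (Nat.succ_ne_zero r)).trans hdvd
      rw [Polynomial.dvd_iff_isRoot, Polynomial.IsRoot.def, Polynomial.eval_mul,
        Polynomial.eval_C] at this
      simp only [Finset.mem_coe, Multiset.mem_toFinset, Polynomial.mem_roots hf0]
      exact (mul_eq_zero.1 this).resolve_left hc
    · left
      refine ⟨D h, ⟨h, hh, rfl⟩, hw, ?_⟩
      obtain ⟨u, rfl⟩ := hdvd
      refine ⟨f * ((r + 1 : Polynomial K) * u + (Polynomial.X - Polynomial.C α) *
        Polynomial.derivative u) - Polynomial.derivative f * (Polynomial.X - Polynomial.C α) * u, ?_⟩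
      simp only [D, Polynomial.wronskianBilin_apply, Polynomial.wronskian,
        Polynomial.derivative_mul, Polynomial.derivative_X_sub_C_pow]
      simp
      ring

variable {K : Type*} [Field K]

/-- `m` divides some nonzero member of `V` to the order `dim V`. -/
def IsFlex (V : Submodule K (Pxy K)) (m : Pxy K) : Prop :=
  ∃ h ∈ V, h ≠ 0 ∧ m ^ Module.finrank K V ∣ h

lemma exists_finite_isFlex [CharZero K] {V : Submodule K (Pxy K)} {k : ℕ} (hV : V ≤ forms K k) :
    ∃ Z : Set (Pxy K), Z.Finite ∧ ∀ m ∈ forms K 1, m ≠ 0 → IsFlex V m →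
      ∃ z ∈ Z, ∃ c : K, c ≠ 0 ∧ m = C c * z := by
  have := finiteDimensional_of_le_forms hV
  have hrank : Module.finrank K (V.map (dehom K).toLinearMap) ≤ Module.finrank K V :=
    Submodule.finrank_map_le _ _
  have hfin := finite_setOf_pow_dvd _ _ hrank
  refine ⟨_, (hfin.image fun α => lin 1 (-α)).insert (X 1), fun m hm hm0 hflex => ?_⟩
  obtain ⟨h, hh, hh0, hdvd⟩ := hflex
  obtain ⟨a, b, rfl⟩ := mem_forms_one.1 hm
  by_cases ha : a = 0
  · subst ha
    refine ⟨X 1, Set.mem_insert _ _, b, ?_, by simp [lin]⟩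
    rintro rfl
    simp [lin] at hm0
  · refine ⟨lin 1 (- (-(b / a))), Set.mem_insert_of_mem _ ⟨-(b / a), ?_, rfl⟩, a, ha, ?_⟩
    · refine ⟨dehom K h, ⟨h, hh, rfl⟩, dehom_ne_zero (hV hh) hh0, ?_⟩
      refine dvd_trans (pow_dvd_pow_of_dvd ?_ _) (by simpa using map_dvd (dehom K) hdvd)
      refine ⟨Polynomial.C a, ?_⟩
      simp only [lin, map_add, map_mul, dehom_X_zero, dehom_X_one, ← algebraMap_eq,
        AlgHom.commutes]
      simp only [← Polynomial.C_eq_algebraMap, map_neg, sub_neg_eq_add, mul_one, add_mul,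
        ← Polynomial.C_mul, div_mul_cancel₀ _ ha]
      ring
    · rw [C_mul_lin, neg_neg, mul_one, mul_div_cancel₀ _ ha]

lemma IsFlex.map {V : Submodule K (Pxy K)} {m : Pxy K} (h : IsFlex V m) (φ : Pxy K ≃ₐ[K] Pxy K) :
    IsFlex (V.map φ.toLinearMap) (φ m) := by
  obtain ⟨h, hh, h0, hdvd⟩ := h
  refine ⟨φ h, ⟨h, hh, rfl⟩, by simpa using h0, ?_⟩
  rw [finrank_map_eq_of_injective φ.injective]
  simpa using map_dvd φ hdvd

lemma apply_eq_C_mul_of_scalar {σ : Pxy K ≃ₐ[K] Pxy K} {e : K} (h : ∀ i, σ (X i) = C e * X i)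
    {k : ℕ} {g : Pxy K} (hg : g ∈ forms K k) : σ g = C (e ^ k) * g := by
  induction k generalizing g with
  | zero =>
    obtain ⟨c, rfl⟩ := mem_forms_zero.1 hg
    rw [algEquiv_C, pow_zero, C_1, one_mul]
  | succ k ih =>
    obtain ⟨u, hu, c, rfl⟩ := exists_forms_succ hg
    rw [map_add, map_mul, map_mul, map_pow, ih hu, h, h, algEquiv_C, C_pow, C_pow]
    ring

/-- Changes of variables agreeing up to scalars on `x`, `y`, `x + y` are proportional. -/
lemma eq_of_map_eq_of_refLin {φ ψ : Pxy K ≃ₐ[K] Pxy K} {I J : Ideal (Pxy K)} (hI : IsHomog I)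
    (hJ : IsHomog J) (hIJ : Ideal.map φ I = Ideal.map ψ J) {z : Fin 3 → Pxy K}
    (hφ : ∀ i, ∃ c : K, c ≠ 0 ∧ φ (refLin K i) = C c * z i)
    (hψ : ∀ i, ∃ c : K, c ≠ 0 ∧ ψ (refLin K i) = C c * z i) : I = J := by
  have hσ : ∀ i, ∃ c : K, c ≠ 0 ∧ (ψ.trans φ.symm) (refLin K i) = C c * refLin K i := by
    intro i
    obtain ⟨c, hc, h⟩ := hφ i
    obtain ⟨d, hd, h'⟩ := hψ i
    refine ⟨d * c⁻¹, mul_ne_zero hd (inv_ne_zero hc), ?_⟩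
    rw [AlgEquiv.trans_apply, h', AlgEquiv.symm_apply_eq, map_mul, h, algEquiv_C, ← mul_assoc,
      ← C_mul, mul_assoc, inv_mul_cancel₀ hc, mul_one]
  set σ := ψ.trans φ.symm with hσ_def
  obtain ⟨a, ha, h0⟩ := hσ 0
  obtain ⟨b, hb, h1⟩ := hσ 1
  obtain ⟨c, hc, h2⟩ := hσ 2
  simp only [refLin, Matrix.cons_val] at h0 h1 h2
  have hlin : lin a b = lin c c := by
    rw [lin, lin, ← h0, ← h1, ← map_add, h2]
    ring
  obtain ⟨hac, hbc⟩ := lin_inj.1 hlin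
  rw [hbc, ← hac] at h1
  have hscal : ∀ i, σ (X i) = C a * X i := by
    intro i
    fin_cases i
    · exact h0
    · exact h1
  refine hI.ext hJ fun k => ?_
  ext g
  simp only [mem_layer]
  refine and_congr_right fun hg => ?_
  have e1 : g ∈ I ↔ φ g ∈ Ideal.map φ I := by rw [mem_map_iff, AlgEquiv.symm_apply_apply]
  have e2 : g ∈ J ↔ ψ g ∈ Ideal.map ψ J := by rw [mem_map_iff, AlgEquiv.symm_apply_apply]
  have e3 : ψ g = C (a ^ k) * φ g := by
    have := apply_eq_C_mul_of_scalar hscal hg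
    rw [hσ_def, AlgEquiv.trans_apply, AlgEquiv.symm_apply_eq, map_mul, algEquiv_C] at this
    exact this
  have hu : IsUnit (C (a ^ k) : Pxy K) := (isUnit_iff_ne_zero.2 (pow_ne_zero k ha)).map C
  rw [e1, e2, e3, hIJ, Ideal.unit_mul_mem_iff_mem _ hu]

lemma refLin_mem_forms (i : Fin 3) : refLin K i ∈ forms K 1 ∧ refLin K i ≠ 0 := by
  have h2 : refLin K 2 = lin 1 1 := by simp [refLin, lin]
  fin_cases i
  · exact ⟨X_mem_forms 0, X_ne_zero 0⟩
  · exact ⟨X_mem_forms 1, X_ne_zero 1⟩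
  · change refLin K 2 ∈ _ ∧ refLin K 2 ≠ 0
    rw [h2, ne_eq, lin_eq_zero]
    exact ⟨lin_mem_forms 1 1, by simp⟩

/-- An infinite family of homogeneous ideals sharing three flexes in some degree meets infinitely
many orbits. -/
lemma not_homogFiniteType_of_infinite [CharZero K] {t : ℕ → ℕ} {F : Set (Ideal (Pxy K))}
    (hF : F.Infinite) (n : ℕ) (h : ∀ I ∈ F, IsHomog I ∧ (∀ k, hilb K I k = t k) ∧
      ∀ i, IsFlex (layer I n) (refLin K i)) : ¬ HomogFiniteType K t := by
  rintro ⟨S, hS, -, hFT⟩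
  choose Z hZ hflex using fun J : Ideal (Pxy K) => exists_finite_isFlex (layer_le J n)
  have key : ∀ I ∈ F, ∃ (φ : Pxy K ≃ₐ[K] Pxy K) (z : Fin 3 → Pxy K), Ideal.map φ I ∈ S ∧
      (∀ i, z i ∈ Z (Ideal.map φ I)) ∧ ∀ i, ∃ c : K, c ≠ 0 ∧ φ (refLin K i) = C c * z i := by
    intro I hI
    obtain ⟨h1, h2, h3⟩ := h I hI
    obtain ⟨φ, hφ, hφS⟩ := hFT I h1 h2
    have : ∀ i, ∃ z ∈ Z (Ideal.map φ I), ∃ c : K, c ≠ 0 ∧ φ (refLin K i) = C c * z := by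
      intro i
      have hr := refLin_mem_forms (K := K) i
      refine hflex _ _ (hφ.map_mem_forms hr.1) (by simpa using hr.2) ?_
      rw [hφ.layer_map]
      exact (h3 i).map φ
    choose z hz hz' using this
    exact ⟨φ, z, hφS, hz, hz'⟩
  choose! φ z hφS hz hc using key
  let T : Set (Ideal (Pxy K) × (Fin 3 → Pxy K)) :=
    ⋃ J ∈ S, {J} ×ˢ Set.pi Set.univ fun _ => Z J
  have hT : T.Finite := hS.biUnion fun J _ =>
    (Set.finite_singleton J).prod (Set.Finite.pi fun _ => hZ J)
  obtain ⟨I, hI, J, hJ, hne, heq⟩ := hF.exists_ne_map_eq_of_mapsTo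
    (f := fun I => (Ideal.map (φ I) I, z I)) (t := T) (fun I hI => by
      simp only [T, Set.mem_iUnion]
      exact ⟨_, hφS I hI, rfl, fun i _ => hz I hI i⟩) hT
  rw [Prod.mk.injEq] at heq
  refine hne (eq_of_map_eq_of_refLin (h I hI).1 (h J hJ).1 heq.1 (hc I hI) ?_)
  rw [heq.2]
  exact hc J hJ

end Flexes

section Families

lemma finrank_sup_span_singleton_of_notMem {K E : Type*} [Field K] [AddCommGroup E] [Module K E]
    {U : Submodule K E} [FiniteDimensional K U] {e : E} (he : e ∉ U) :
    Module.finrank K ↥(U ⊔ K ∙ e) = Module.finrank K U + 1 := by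
  have h := Submodule.finrank_sup_add_finrank_inf_eq U (K ∙ e)
  have he0 : e ≠ 0 := fun h0 => he (h0 ▸ U.zero_mem)
  rw [disjoint_iff.1 ((Submodule.disjoint_span_singleton' he0).2 he), finrank_bot, add_zero,
    finrank_span_singleton he0] at h
  exact h

lemma exists_submodule_finrank_eq {K E : Type*} [Field K] [AddCommGroup E] [Module K E]
    {U V : Submodule K E} [FiniteDimensional K V] (hUV : U ≤ V) {m : ℕ}
    (hU : Module.finrank K U ≤ m) (hV : m ≤ Module.finrank K V) :
    ∃ W, U ≤ W ∧ W ≤ V ∧ Module.finrank K W = m := by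
  induction m, hU using Nat.le_induction with
  | base => exact ⟨U, le_rfl, hUV, rfl⟩
  | succ m hm ih =>
    obtain ⟨W, h1, h2, h3⟩ := ih (by omega)
    obtain ⟨e, he, heW⟩ : ∃ e ∈ V, e ∉ W := by
      by_contra! h
      have := Submodule.finrank_mono (show W ≤ V from h2)
      rw [le_antisymm h2 h] at h3
      omega
    have : FiniteDimensional K W := Submodule.finiteDimensional_of_le h2
    exact ⟨W ⊔ K ∙ e, h1.trans le_sup_left,
      sup_le h2 ((Submodule.span_singleton_le_iff_mem _ _).2 he), by
        rw [finrank_sup_span_singleton_of_notMem heW, h3]⟩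

/-- Over an infinite field, a subspace of codimension at least two lies in infinitely many
hyperplanes. -/
lemma infinite_setOf_hyperplane {K E : Type*} [Field K] [Infinite K] [AddCommGroup E] [Module K E]
    {U V : Submodule K E} [FiniteDimensional K V] (hUV : U ≤ V)
    (h : Module.finrank K U + 2 ≤ Module.finrank K V) :
    {W : Submodule K E | U ≤ W ∧ W ≤ V ∧ Module.finrank K W + 1 = Module.finrank K V}.Infinite := by
  obtain ⟨A, hUA, hAV, hA⟩ := exists_submodule_finrank_eq hUV
    (m := Module.finrank K V - 2) (by omega) (by omega)
  obtain ⟨B, hAB, hBV, hB⟩ := exists_submodule_finrank_eq hAV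
    (m := Module.finrank K V - 1) (by omega) (by omega)
  have : FiniteDimensional K B := Submodule.finiteDimensional_of_le hBV
  have : FiniteDimensional K A := Submodule.finiteDimensional_of_le hAV
  obtain ⟨e, he, heA⟩ : ∃ e ∈ B, e ∉ A := by
    by_contra! h'
    rw [le_antisymm hAB h'] at hA
    omega
  obtain ⟨f, hf, hfB⟩ : ∃ f ∈ V, f ∉ B := by
    by_contra! h'
    rw [le_antisymm hBV h'] at hB
    omega
  have hef : ∀ c : K, e + c • f ∉ A := by
    intro c hc
    by_cases h0 : c = 0
    · simp [h0] at hc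
      exact heA hc
    · have := B.sub_mem (hAB hc) he
      rw [add_sub_cancel_left, B.smul_mem_iff h0] at this
      exact hfB this
  refine Set.infinite_of_injective_forall_mem (f := fun c : K => A ⊔ K ∙ (e + c • f)) ?_ fun c =>
    ⟨hUA.trans le_sup_left, sup_le hAV ((Submodule.span_singleton_le_iff_mem _ _).2
      (V.add_mem (hBV he) (V.smul_mem c hf))), ?_⟩
  · intro c d hcd
    by_contra hne
    dsimp only at hcd
    set W := A ⊔ K ∙ (e + c • f) with hW
    have h1 : e + c • f ∈ W := Submodule.mem_sup_right (Submodule.mem_span_singleton_self _)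
    have h2 : e + d • f ∈ W := by
      rw [hcd]; exact Submodule.mem_sup_right (Submodule.mem_span_singleton_self _)
    have h3 : f ∈ W := by
      have := W.sub_mem h1 h2
      rwa [add_sub_add_left_eq_sub, ← sub_smul, W.smul_mem_iff (sub_ne_zero.2 hne)] at this
    have h4 : e ∈ W := by
      have := W.sub_mem h1 (W.smul_mem c h3)
      rwa [add_sub_cancel_right] at this
    have hBW : B ≤ W := by
      have hB' : A ⊔ K ∙ e = B := by
        have : FiniteDimensional K B := inferInstance
        refine Submodule.eq_of_le_of_finrank_eq
          (sup_le hAB ((Submodule.span_singleton_le_iff_mem _ _).2 he)) ?_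
        rw [finrank_sup_span_singleton_of_notMem heA]
        omega
      rw [← hB']
      exact sup_le le_sup_left ((Submodule.span_singleton_le_iff_mem _ _).2 h4)
    have hWdim : Module.finrank K W = Module.finrank K B := by
      rw [hW, finrank_sup_span_singleton_of_notMem (hef c)]
      omega
    have : FiniteDimensional K W := by rw [hW]; infer_instance
    rw [Submodule.eq_of_le_of_finrank_eq hBW hWdim.symm] at hfB
    exact hfB h3
  · rw [finrank_sup_span_singleton_of_notMem (hef c)]
    omega

variable {K : Type*} [Field K] {t : ℕ → ℕ} {n : ℕ}

lemma IsGradedPiece.exists_ideal {D : ℕ → Submodule K (Pxy K)} (hD : IsGradedPiece D t) :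
    ∃ I, IsHomog I ∧ (∀ k, hilb K I k = t k) ∧ ∀ k, layer I k = D k := by
  have hl := layer_idealOfLayers D hD.le hD.mul
  refine ⟨_, isHomog_idealOfLayers D hD.mul, fun k => ?_, hl⟩
  have h1 := finrank_layer_add_hilb (idealOfLayers D hD.mul) k
  have h2 := hD.dim k
  rw [hl] at h1
  omega

lemma not_homogFiniteType_of_family [CharZero K] {ι : Type*} {P : Set ι} (hP : P.Infinite)
    {D : ι → ℕ → Submodule K (Pxy K)} (hD : ∀ p ∈ P, IsGradedPiece (D p) t) (hinj : Set.InjOn D P)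
    (n : ℕ) (hflex : ∀ p ∈ P, ∀ i, IsFlex (D p n) (refLin K i)) : ¬ HomogFiniteType K t := by
  choose! I hI ht hl using fun p hp => (hD p hp).exists_ideal
  refine not_homogFiniteType_of_infinite (F := I '' P) (hP.image fun p hp q hq hpq => ?_) n ?_
  · refine hinj hp hq (funext fun k => ?_)
    rw [← hl p hp, ← hl q hq, hpq]
  · rintro _ ⟨p, hp, rfl⟩
    refine ⟨hI p hp, ht p hp, fun i => ?_⟩
    rw [hl p hp]
    exact hflex p hp i

/-- Graded pieces consisting of the multiples of the products of initial segments of `l`, except in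
degree `j`. -/
def chainPieces (l : ℕ → Pxy K) (t : ℕ → ℕ) (n j : ℕ) (W : Submodule K (Pxy K)) (k : ℕ) :
    Submodule K (Pxy K) :=
  if k < n then ⊥ else if k = j then W else mulForms (∏ i ∈ Finset.range (t k), l i) (k - t k)

lemma map_mulLeft_le_mulForms {l : ℕ → Pxy K} (hl : ∀ i, l i ∈ forms K 1 ∧ l i ≠ 0) {a b k : ℕ}
    (hab : a ≤ b) (hbk : b ≤ k) {V : Submodule K (Pxy K)} (hV : V ≤ forms K (k - b)) :
    V.map (LinearMap.mulLeft K (∏ i ∈ Finset.range b, l i)) ≤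
      mulForms (∏ i ∈ Finset.range a, l i) (k - a) := by
  rintro _ ⟨u, hu, rfl⟩
  refine mem_mulForms_of_dvd (prod_lin_mem_forms hl a) ?_ ?_
  · rw [show a + (k - a) = b + (k - b) by omega]
    exact forms_mul (prod_lin_mem_forms hl b) (hV hu)
  · exact (Finset.prod_dvd_prod_of_subset _ _ _ (by simpa using hab)).mul_right _

lemma X_mul_mem_mulForms {f g : Pxy K} {m : ℕ} (i : Fin 2) (hg : g ∈ mulForms f m) :
    X i * g ∈ mulForms f (m + 1) := by
  obtain ⟨u, hu, rfl⟩ := mem_mulForms.1 hg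
  rw [mul_left_comm, add_comm]
  exact mul_mem_mulForms (forms_mul (X_mem_forms i) hu)

lemma isGradedPiece_chainPieces {l : ℕ → Pxy K} (hl : ∀ i, l i ∈ forms K 1 ∧ l i ≠ 0)
    (hn : 2 ≤ n) (hlow : ∀ i ≤ n - 1, t i = i + 1) (hmono : ∀ j, n - 1 ≤ j → t (j + 1) ≤ t j)
    {j : ℕ} (hj : n ≤ j) {W : Submodule K (Pxy K)} (hW : W ≤ forms K j)
    (hdim : Module.finrank K W + t j = j + 1)
    (hlower : n < j → mulForms (∏ i ∈ Finset.range (t (j - 1)), l i) (j - t (j - 1)) ≤ W)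
    (hupper : W ≤ mulForms (∏ i ∈ Finset.range (t (j + 1)), l i) (j - t (j + 1))) :
    IsGradedPiece (chainPieces l t n j W) t := by
  have hn1 : t (n - 1) = n := by rw [hlow _ le_rfl]; omega
  have htk : ∀ k, n ≤ k → t k ≤ k := fun k hk =>
    ((anti_of_step hmono le_rfl (by omega)).trans hn1.le).trans hk
  refine ⟨fun k => ?_, fun k i g hg => ?_, fun k => ?_⟩
  · unfold chainPieces
    split_ifs with h1 h2
    · exact bot_le
    · exact h2 ▸ hW
    · exact mulForms_le (prod_lin_mem_forms hl _) (Nat.add_sub_cancel' (htk k (by omega)))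
  · unfold chainPieces at hg ⊢
    by_cases h1 : k < n
    · rw [if_pos h1, Submodule.mem_bot] at hg
      rw [hg, mul_zero]
      exact Submodule.zero_mem _
    have hstep := hmono k (by omega)
    have hk := htk k (by omega)
    rw [if_neg h1] at hg
    rw [if_neg (by omega : ¬ k + 1 < n)]
    by_cases h2 : k = j
    · subst h2
      rw [if_pos rfl] at hg
      rw [if_neg (by omega), show k + 1 - t (k + 1) = k - t (k + 1) + 1 by omega]
      exact X_mul_mem_mulForms i (hupper hg)
    rw [if_neg h2] at hg
    have hX := X_mul_mem_mulForms i hg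
    by_cases h3 : k + 1 = j
    · subst h3
      rw [if_pos rfl]
      apply hlower (by omega)
      rwa [Nat.add_sub_cancel, show k + 1 - t k = k - t k + 1 by omega]
    · rw [if_neg h3]
      refine map_mulLeft_le_mulForms hl hstep (k := k + 1) (by omega) le_rfl ?_
      rwa [show k + 1 - t k = k - t k + 1 by omega]
  · by_cases h1 : k < n
    · have : chainPieces l t n j W k = ⊥ := if_pos h1
      rw [this, finrank_bot, hlow k (by omega), zero_add]
    by_cases h2 : k = j
    · have : chainPieces l t n j W k = W := by rw [chainPieces, if_neg h1, if_pos h2]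
      rw [this, h2, hdim]
    · have : chainPieces l t n j W k = mulForms (∏ i ∈ Finset.range (t k), l i) (k - t k) := by
        rw [chainPieces, if_neg h1, if_neg h2]
      have := htk k (by omega)
      rw [‹chainPieces l t n j W k = _›, finrank_mulForms (prod_lin_ne_zero hl _)]
      omega

lemma isFlex_mulForms {f m : Pxy K} (hf : f ≠ 0) (hm : m ∈ forms K 1) (hm0 : m ≠ 0) (h : m ∣ f)
    (d : ℕ) : IsFlex (mulForms f d) m := by
  refine ⟨f * m ^ d, mul_mem_mulForms (forms_pow_one hm d), mul_ne_zero hf (pow_ne_zero d hm0), ?_⟩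
  rw [finrank_mulForms hf, pow_succ']
  exact mul_dvd_mul_right h _

end Families

section InfiniteType

variable {K : Type*} [Field K]

lemma dvd_of_mulForms_le {f g : Pxy K} {m d : ℕ} (h : mulForms g m ≤ mulForms f d) : f ∣ g := by
  have key : ∀ i, f ∣ g * X i ^ m := fun i => by
    obtain ⟨u, -, hu⟩ := mem_mulForms.1
      (h (mul_mem_mulForms (forms_pow_one (X_mem_forms i) m)))
    exact ⟨u, hu.symm⟩
  exact dvd_of_dvd_mul_X_pow (key 0) (key 1)

lemma refSeq_id (i : Fin 3) : refSeq K id i = refLin K i := by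
  simp [refSeq]

lemma refSeq_mem_forms (i : ℕ) : refSeq K id i ∈ forms K 1 ∧ refSeq K id i ≠ 0 :=
  refLin_mem_forms _

variable [CharZero K] {t : ℕ → ℕ} {n : ℕ}

lemma not_homogFiniteType_of_four_le (hn : 2 ≤ n) (hlow : ∀ i ≤ n - 1, t i = i + 1)
    (hmono : ∀ j, n - 1 ≤ j → t (j + 1) ≤ t j) (h : 4 ≤ t n) : ¬ HomogFiniteType K t := by
  have hn1 : t (n - 1) = n := by rw [hlow _ le_rfl]; omega
  have htn : t n ≤ n := (anti_of_step hmono le_rfl (by omega)).trans hn1.le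
  let l : K → ℕ → Pxy K := fun c i => if i < 3 then refSeq K id i else lin 1 c
  have hl : ∀ c i, l c i ∈ forms K 1 ∧ l c i ≠ 0 := by
    intro c i
    simp only [l]
    split_ifs
    · exact refSeq_mem_forms i
    · exact ⟨lin_mem_forms 1 c, by simp [lin_eq_zero]⟩
  let f : K → Pxy K := fun c => ∏ i ∈ Finset.range (t n), l c i
  have hf : ∀ c, f c ≠ 0 := fun c => prod_lin_ne_zero (hl c) _
  let D : K → ℕ → Submodule K (Pxy K) := fun c =>
    chainPieces (l c) t n n (mulForms (f c) (n - t n))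
  have hDn : ∀ c, D c n = mulForms (f c) (n - t n) := fun c => by simp [D, chainPieces]
  refine not_homogFiniteType_of_family (P := ({0, 1} : Set K)ᶜ) (D := D)
    (Set.toFinite _).infinite_compl (fun c _ => ?_) ?_ n fun c _ i => ?_
  · refine isGradedPiece_chainPieces (hl c) hn hlow hmono le_rfl
      (mulForms_le (prod_lin_mem_forms (hl c) _) (by omega)) ?_ (fun h => absurd h (lt_irrefl n))
      (map_mulLeft_le_mulForms (hl c) (hmono n (by omega)) htn le_rfl)
    rw [finrank_mulForms (hf c)]
    omega
  · intro c hc d hd hcd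
    have hdvd : f c ∣ f d := by
      apply dvd_of_mulForms_le (m := n - t n) (d := n - t n)
      rw [← hDn, ← hDn, hcd]
    have hlin : lin 1 c ∣ f d :=
      (Finset.dvd_prod_of_mem (l c) (Finset.mem_range.2 (by omega : 3 < t n))).trans hdvd
    have h0 : MvPolynomial.eval ![-c, 1] (f d) = 0 := by
      obtain ⟨u, hu⟩ := hlin
      rw [hu, map_mul]
      simp [lin]
    simp only [f, map_prod, Finset.prod_eq_zero_iff, Finset.mem_range] at h0
    obtain ⟨i, -, hi⟩ := h0
    simp only [Set.mem_compl_iff, Set.mem_insert_iff, Set.mem_singleton_iff, not_or] at hc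
    simp only [l] at hi
    split_ifs at hi with h3
    · exfalso
      interval_cases i
      · exact hc.1 (by simpa [refSeq, refLin] using hi)
      · have : MvPolynomial.eval ![-c, 1] (X 1 : Pxy K) = 0 := hi
        simp at this
      · have : MvPolynomial.eval ![-c, 1] (X 0 + X 1) = 0 := hi
        simp only [map_add, eval_X, Matrix.cons_val_zero, Matrix.cons_val_one] at this
        exact hc.2 (by linear_combination -this)
    · simp [lin] at hi
      linear_combination -hi
  · rw [hDn]
    refine isFlex_mulForms (hf c) (refLin_mem_forms i).1 (refLin_mem_forms i).2 ?_ _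
    have : l c i = refLin K i := by simp only [l, if_pos i.2, refSeq_id]
    rw [← this]
    exact Finset.dvd_prod_of_mem _ (Finset.mem_range.2 (by omega))

/-- Ideals whose graded piece in degree `j` is a varying hyperplane in the multiples of a fixed
product of linear forms. -/
lemma not_homogFiniteType_of_hyperplane (hn : 2 ≤ n) (hlow : ∀ i ≤ n - 1, t i = i + 1)
    (hmono : ∀ j, n - 1 ≤ j → t (j + 1) ≤ t j) {j b : ℕ} (hj : n ≤ j) (hb : t j = b + 1)
    (htj : t (j + 1) ≤ b) {U : Submodule K (Pxy K)} (hU : U ≤ forms K (j - b))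
    (hUdim : Module.finrank K U + 2 ≤ j - b + 1)
    (hlower : n < j → mulForms (∏ i ∈ Finset.range (t (j - 1)), refSeq K id i) (j - t (j - 1)) ≤
      U.map (LinearMap.mulLeft K (∏ i ∈ Finset.range b, refSeq K id i)))
    (hflex : ∀ V : Submodule K (Pxy K), U ≤ V → V ≤ forms K (j - b) →
      Module.finrank K V = j - b → ∀ i, IsFlex (chainPieces (refSeq K id) t n j
        (V.map (LinearMap.mulLeft K (∏ i ∈ Finset.range b, refSeq K id i))) n) (refLin K i)) :
    ¬ HomogFiniteType K t := by
  have hn1 : t (n - 1) = n := by rw [hlow _ le_rfl]; omega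
  have htj' : t j ≤ n := (anti_of_step hmono le_rfl (by omega)).trans hn1.le
  set f := ∏ i ∈ Finset.range b, refSeq K id i with hf_def
  have hf : f ≠ 0 := prod_lin_ne_zero refSeq_mem_forms _
  have hinf := infinite_setOf_hyperplane hU (by rwa [finrank_forms])
  refine not_homogFiniteType_of_family hinf
    (D := fun V => chainPieces (refSeq K id) t n j (V.map (LinearMap.mulLeft K f)))
    (fun V hV => ?_) (fun V _ W _ hVW => ?_) n fun V hV => hflex V hV.1 hV.2.1 ?_
  · obtain ⟨h1, h2, h3⟩ := hV
    rw [finrank_forms] at h3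
    refine isGradedPiece_chainPieces refSeq_mem_forms hn hlow hmono hj ?_ ?_
      (fun h => (hlower h).trans (Submodule.map_mono h1))
      (map_mulLeft_le_mulForms refSeq_mem_forms htj (by omega) h2)
    · rw [← mulForms_one j]
      simpa using map_mulLeft_le_mulForms refSeq_mem_forms (Nat.zero_le b) (k := j) (by omega) h2
    · rw [finrank_map_mulLeft hf]
      omega
  · have := congrFun hVW j
    simp only [chainPieces, if_neg (not_lt.2 hj), if_true] at this
    exact Submodule.map_injective_of_injective (mul_right_injective₀ hf) this
  · have := hV.2.2
    rw [finrank_forms] at this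
    omega

lemma not_homogFiniteType_of_adjacent (hn : 2 ≤ n) (hlow : ∀ i ≤ n - 1, t i = i + 1)
    (hmono : ∀ j, n - 1 ≤ j → t (j + 1) ≤ t j) (h : t n = 3) {j : ℕ} (hj : n < j)
    (h1 : t j < t (j - 1)) (h2 : t (j + 1) < t j) : ¬ HomogFiniteType K t := by
  have hn1 : t (n - 1) = n := by rw [hlow _ le_rfl]; omega
  have htn : t n ≤ n := (anti_of_step hmono le_rfl (by omega)).trans hn1.le
  have htj : t (j - 1) ≤ t n := anti_of_step hmono (by omega) (by omega)
  obtain ⟨b, hb⟩ : ∃ b, t j = b + 1 := ⟨t j - 1, by omega⟩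
  have hl := refSeq_mem_forms (K := K)
  have hg : refSeq K id b * refSeq K id (b + 1) ∈ forms K 2 := forms_mul (hl b).1 (hl (b + 1)).1
  have hg0 : refSeq K id b * refSeq K id (b + 1) ≠ 0 := mul_ne_zero (hl b).2 (hl (b + 1)).2
  have hprod : ∏ i ∈ Finset.range (b + 2), refSeq K id i =
      (∏ i ∈ Finset.range b, refSeq K id i) * (refSeq K id b * refSeq K id (b + 1)) := by
    rw [Finset.prod_range_succ, Finset.prod_range_succ, mul_assoc]
  refine not_homogFiniteType_of_hyperplane hn hlow hmono hj.le hb (by omega)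
    (U := mulForms (refSeq K id b * refSeq K id (b + 1)) (j - b - 2)) (mulForms_le hg (by omega))
    (by rw [finrank_mulForms hg0]; omega) (fun _ => ?_) fun V _ _ _ i => ?_
  · refine (map_mulLeft_le_mulForms hl (by omega : b + 2 ≤ t (j - 1)) (k := j) (by omega)
      le_rfl).trans ?_
    rintro _ ⟨u, hu, rfl⟩
    refine ⟨_, mul_mem_mulForms (by rwa [show j - (b + 2) = j - b - 2 by omega] at hu), ?_⟩
    rw [hprod]
    simp only [LinearMap.mulLeft_apply, mul_assoc]
  · simp only [chainPieces, if_neg (lt_irrefl n), if_neg hj.ne]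
    refine isFlex_mulForms (prod_lin_ne_zero hl _) (refLin_mem_forms i).1 (refLin_mem_forms i).2 ?_ _
    rw [← refSeq_id i]
    exact Finset.dvd_prod_of_mem _ (Finset.mem_range.2 (by omega))

lemma not_homogFiniteType_of_first (hn : 4 ≤ n) (hlow : ∀ i ≤ n - 1, t i = i + 1)
    (hmono : ∀ j, n - 1 ≤ j → t (j + 1) ≤ t j) (h1 : 1 ≤ t n) (h3 : t n ≤ 3)
    (h2 : t (n + 1) < t n) : ¬ HomogFiniteType K t := by
  classical
  obtain ⟨b, hb⟩ : ∃ b, t n = b + 1 := ⟨t n - 1, by omega⟩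
  have hl := refSeq_mem_forms (K := K)
  set f := ∏ i ∈ Finset.range b, refSeq K id i with hf_def
  have hf : f ≠ 0 := prod_lin_ne_zero hl _
  let S : Finset (Pxy K) := (Finset.Ico b 3).image fun i => refSeq K id i ^ (n - b)
  have hS : S.card ≤ 3 - b := Finset.card_image_le.trans (Nat.card_Ico b 3).le
  refine not_homogFiniteType_of_hyperplane (by omega) hlow hmono le_rfl hb (by omega)
    (U := Submodule.span K (S : Set (Pxy K))) ?_ ?_ (fun h => absurd h (lt_irrefl n))
    fun V hUV hV hVdim i => ?_
  · rw [Submodule.span_le]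
    intro g hg
    obtain ⟨i, -, rfl⟩ := Finset.mem_image.1 (Finset.mem_coe.1 hg)
    exact forms_pow_one (hl i).1 _
  · have := finrank_span_finset_le_card (R := K) S
    have : Module.finrank K (Submodule.span K (S : Set (Pxy K))) ≤ S.card := this
    omega
  · have : chainPieces (refSeq K id) t n n (V.map (LinearMap.mulLeft K f)) n =
        V.map (LinearMap.mulLeft K f) := by simp [chainPieces]
    rw [this]
    have hm := refLin_mem_forms (K := K) i
    suffices h : ∃ u ∈ V, u ≠ 0 ∧ refLin K i ^ (n - b) ∣ f * u by
      obtain ⟨u, hu, hu0, hdvd⟩ := h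
      refine ⟨f * u, ⟨u, hu, rfl⟩, mul_ne_zero hf hu0, ?_⟩
      rwa [finrank_map_mulLeft hf, hVdim]
    by_cases hi : (i : ℕ) < b
    · obtain ⟨u, ⟨hu, huV⟩, hu0⟩ : ∃ u ∈ mulForms (refLin K i ^ (n - b - 1)) 1 ⊓ V, u ≠ 0 := by
        apply Submodule.exists_mem_ne_zero_of_ne_bot
        intro hbot
        have hle : mulForms (refLin K i ^ (n - b - 1)) 1 ≤ forms K (n - b) :=
          mulForms_le (forms_pow_one hm.1 _) (by omega)
        have := finiteDimensional_of_le_forms hle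
        have := finiteDimensional_of_le_forms hV
        have hsum := Submodule.finrank_sup_add_finrank_inf_eq
          (mulForms (refLin K i ^ (n - b - 1)) 1) V
        have hsup := Submodule.finrank_mono (sup_le hle hV)
        rw [hbot, finrank_bot, finrank_mulForms (pow_ne_zero _ hm.2), hVdim] at hsum
        rw [finrank_forms] at hsup
        omega
      refine ⟨u, huV, hu0, ?_⟩
      obtain ⟨v, -, rfl⟩ := mem_mulForms.1 hu
      have h1 : refLin K i ∣ f := by
        rw [← refSeq_id i]
        exact Finset.dvd_prod_of_mem _ (Finset.mem_range.2 hi)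
      rw [show n - b = n - b - 1 + 1 by omega, pow_succ', ← mul_assoc]
      exact (mul_dvd_mul_right h1 _).mul_right v
    · refine ⟨refLin K i ^ (n - b), hUV (Submodule.subset_span ?_), pow_ne_zero _ hm.2,
        dvd_mul_left _ _⟩
      rw [← refSeq_id i]
      exact Finset.mem_coe.2 (Finset.mem_image.2 ⟨(i : ℕ), Finset.mem_Ico.2 ⟨by omega, i.2⟩, rfl⟩)

end InfiniteType

section Cubics

variable {K : Type*} [Field K]

/-- A pencil of binary cubics with flexes `x`, `y` and `x + y` for nonzero `s`. -/
def cubicPencil (s : K) : Submodule K (Pxy K) :=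
  Submodule.span K {X 0 ^ 3 - C (s - 2) * (X 0 ^ 2 * X 1), X 1 ^ 3 - C (s⁻¹ - 2) * (X 0 * X 1 ^ 2)}

lemma cubicPencil_le (s : K) : cubicPencil s ≤ forms K 3 := by
  have h0 := X_mem_forms (K := K) 0
  have h1 := X_mem_forms (K := K) 1
  rw [cubicPencil, Submodule.span_le]
  rintro g (rfl | rfl)
  · refine Submodule.sub_mem _ (forms_pow_one h0 3) ?_
    rw [C_mul']
    exact Submodule.smul_mem _ _ (forms_mul (forms_pow_one h0 2) h1)
  · refine Submodule.sub_mem _ (forms_pow_one h1 3) ?_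
    rw [C_mul']
    exact Submodule.smul_mem _ _ (forms_mul h0 (forms_pow_one h1 2))

lemma dehom_cubic (a b c d : K) :
    dehom K (c • (X 0 ^ 3 - C a * (X 0 ^ 2 * X 1)) + d • (X 1 ^ 3 - C b * (X 0 * X 1 ^ 2))) =
      Polynomial.C c * Polynomial.X ^ 3 + Polynomial.C (-(c * a)) * Polynomial.X ^ 2 +
        Polynomial.C (-(d * b)) * Polynomial.X + Polynomial.C d := by
  have hC : ∀ e : K, dehom K (C e) = Polynomial.C e := fun e => by
    rw [← algebraMap_eq, AlgHom.commutes, Polynomial.C_eq_algebraMap]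
  simp only [smul_eq_C_mul, map_add, map_sub, map_mul, map_pow, hC, dehom_X_zero, dehom_X_one,
    map_neg]
  ring

lemma coeff_cubic (a b c d : K) (i : ℕ) :
    (Polynomial.C a * Polynomial.X ^ 3 + Polynomial.C b * Polynomial.X ^ 2 +
      Polynomial.C c * Polynomial.X + Polynomial.C d).coeff i =
      if i = 0 then d else if i = 1 then c else if i = 2 then b else if i = 3 then a else 0 := by
  simp only [Polynomial.coeff_add, Polynomial.coeff_C_mul, Polynomial.coeff_X_pow,
    Polynomial.coeff_X, Polynomial.coeff_C]
  split_ifs <;> first | omega | simp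

lemma finrank_cubicPencil (s : K) : Module.finrank K (cubicPencil s) = 2 := by
  have hli : LinearIndependent K ![(X 0 ^ 3 - C (s - 2) * (X 0 ^ 2 * X 1) : Pxy K),
      X 1 ^ 3 - C (s⁻¹ - 2) * (X 0 * X 1 ^ 2)] := by
    rw [LinearIndependent.pair_iff]
    intro c d h
    have h := congrArg (dehom K) h
    rw [dehom_cubic, map_zero] at h
    have h3 := congrArg (fun p => Polynomial.coeff p 3) h
    have h0 := congrArg (fun p => Polynomial.coeff p 0) h
    rw [coeff_cubic] at h3 h0
    exact ⟨by simpa using h3, by simpa using h0⟩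
  have := finrank_span_eq_card hli
  rwa [Matrix.range_cons, Matrix.range_cons, Matrix.range_empty, Set.union_empty,
    Set.singleton_union] at this

lemma cubicPencil_injective : Function.Injective (cubicPencil (K := K)) := by
  intro s r h
  have hmem : (X 0 ^ 3 - C (s - 2) * (X 0 ^ 2 * X 1) : Pxy K) ∈ cubicPencil r := by
    rw [← h]
    exact Submodule.subset_span (Set.mem_insert _ _)
  obtain ⟨c, d, hcd⟩ := Submodule.mem_span_pair.1 hmem
  have hcd := congrArg (dehom K) hcd
  have hs := dehom_cubic (s - 2) 0 1 0
  rw [one_smul, zero_smul, add_zero] at hs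
  rw [hs, dehom_cubic] at hcd
  have h3 := congrArg (fun p => Polynomial.coeff p 3) hcd
  have h2 := congrArg (fun p => Polynomial.coeff p 2) hcd
  rw [coeff_cubic, coeff_cubic] at h3 h2
  norm_num at h3 h2
  rw [h3] at h2
  linear_combination h2

lemma isFlex_cubicPencil {s : K} (hs : s ≠ 0) (i : Fin 3) :
    IsFlex (cubicPencil s) (refLin K i) := by
  set p : Pxy K := X 0 ^ 3 - C (s - 2) * (X 0 ^ 2 * X 1) with hp
  set q : Pxy K := X 1 ^ 3 - C (s⁻¹ - 2) * (X 0 * X 1 ^ 2) with hq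
  have hpP : p ∈ cubicPencil s := Submodule.subset_span (Set.mem_insert _ _)
  have hqP : q ∈ cubicPencil s := Submodule.subset_span (Set.mem_insert_of_mem _ rfl)
  have hne : ∀ c d : K, (c ≠ 0 ∨ d ≠ 0) → c • p + d • q ≠ 0 := by
    intro c d hcd h
    have h := congrArg (dehom K) h
    rw [hp, hq, dehom_cubic, map_zero] at h
    have h3 := congrArg (fun p => Polynomial.coeff p 3) h
    have h0 := congrArg (fun p => Polynomial.coeff p 0) h
    rw [coeff_cubic] at h3 h0
    simp at h3 h0
    tauto
  suffices h : ∃ c d : K, (c ≠ 0 ∨ d ≠ 0) ∧ refLin K i ^ 2 ∣ c • p + d • q by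
    obtain ⟨c, d, hcd, hdvd⟩ := h
    refine ⟨_, Submodule.add_mem _ (Submodule.smul_mem _ c hpP) (Submodule.smul_mem _ d hqP),
      hne c d hcd, ?_⟩
    rwa [finrank_cubicPencil]
  fin_cases i
  · refine ⟨1, 0, by simp, X 0 - C (s - 2) * X 1, ?_⟩
    change _ = X 0 ^ 2 * _
    rw [one_smul, zero_smul, hp]
    ring
  · refine ⟨0, 1, by simp, X 1 - C (s⁻¹ - 2) * X 0, ?_⟩
    change _ = X 1 ^ 2 * _
    rw [one_smul, zero_smul, hq]
    ring
  · refine ⟨1, -s, by simp, X 0 - C s * X 1, ?_⟩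
    change _ = (X 0 + X 1) ^ 2 * _
    have hC : (C s : Pxy K) * C s⁻¹ = 1 := by rw [← C_mul, mul_inv_cancel₀ hs, C_1]
    have h2 : (C 2 : Pxy K) = 2 := map_ofNat C 2
    rw [one_smul, smul_eq_C_mul, hp, hq, C_neg, C_sub, C_sub, h2]
    linear_combination (X 0 * X 1 ^ 2) * hC

lemma not_homogFiniteType_of_cubics [CharZero K] {t : ℕ → ℕ} (hlow : ∀ i ≤ 2, t i = i + 1)
    (hmono : ∀ j, 2 ≤ j → t (j + 1) ≤ t j) (h3 : t 3 = 2) (h4 : t 4 ≤ 1) (h5 : t 5 = 0) :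
    ¬ HomogFiniteType K t := by
  have hQ : ∀ s : K, ∃ Q : Submodule K (Pxy K), (∀ i, ∀ g ∈ cubicPencil s, X i * g ∈ Q) ∧
      Q ≤ forms K 4 ∧ Module.finrank K Q = 5 - t 4 := by
    intro s
    set P := cubicPencil s with hP
    have hPfin := finiteDimensional_of_le_forms (cubicPencil_le s)
    have hle : ∀ i, P.map (LinearMap.mulLeft K (X i)) ≤ forms K 4 := by
      rintro i _ ⟨g, hg, rfl⟩
      exact forms_mul (a := 1) (b := 3) (X_mem_forms i) (cubicPencil_le s hg)
    have hdim : ∀ i, Module.finrank K (P.map (LinearMap.mulLeft K (X i))) = 2 := fun i => by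
      rw [finrank_map_mulLeft (X_ne_zero i), finrank_cubicPencil]
    have h0 := finiteDimensional_of_le_forms (hle 0)
    have h1 := finiteDimensional_of_le_forms (hle 1)
    have hsum := Submodule.finrank_add_le_finrank_add_finrank
      (P.map (LinearMap.mulLeft K (X 0))) (P.map (LinearMap.mulLeft K (X 1)))
    rw [hdim, hdim] at hsum
    obtain ⟨Q, hQ1, hQ2, hQ3⟩ := exists_submodule_finrank_eq (sup_le (hle 0) (hle 1))
      (m := 5 - t 4) (by omega) (by rw [finrank_forms]; omega)
    refine ⟨Q, fun i g hg => hQ1 ?_, hQ2, hQ3⟩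
    fin_cases i
    · exact Submodule.mem_sup_left ⟨g, hg, rfl⟩
    · exact Submodule.mem_sup_right ⟨g, hg, rfl⟩
  choose Q hPQ hQ4 hQdim using hQ
  let D : K → ℕ → Submodule K (Pxy K) := fun s k => match k with
    | 0 => ⊥
    | 1 => ⊥
    | 2 => ⊥
    | 3 => cubicPencil s
    | 4 => Q s
    | k + 5 => forms K (k + 5)
  refine not_homogFiniteType_of_family (P := ({0} : Set K)ᶜ) (D := D)
    (Set.toFinite _).infinite_compl (fun s _ => ⟨?_, ?_, ?_⟩) ?_ 3
    fun s hs i => isFlex_cubicPencil hs i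
  · intro k
    match k with
    | 0 | 1 | 2 => exact bot_le
    | 3 => exact cubicPencil_le s
    | 4 => exact hQ4 s
    | k + 5 => exact le_rfl
  · intro k i g hg
    match k with
    | 0 | 1 | 2 =>
      have hg : g = 0 := (Submodule.mem_bot K).1 hg
      rw [hg, mul_zero]
      exact Submodule.zero_mem _
    | 3 => exact hPQ s i g hg
    | 4 => exact forms_mul (a := 1) (b := 4) (X_mem_forms i) (hQ4 s hg)
    | k + 5 =>
      change X i * g ∈ forms K (k + 5 + 1)
      rw [add_comm]
      exact forms_mul (X_mem_forms i) hg
  · intro k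
    match k with
    | 0 | 1 | 2 =>
      change Module.finrank K (⊥ : Submodule K (Pxy K)) + _ = _
      rw [finrank_bot, hlow _ (by omega)]
    | 3 =>
      change Module.finrank K (cubicPencil s) + _ = _
      rw [finrank_cubicPencil, h3]
    | 4 =>
      change Module.finrank K (Q s) + _ = _
      rw [hQdim]
      omega
    | k + 5 =>
      change Module.finrank K (forms K (k + 5)) + _ = _
      have := anti_of_step (n := 3) hmono (i := 5) (j := k + 5) (by omega) (by omega)
      rw [finrank_forms]
      omega
  · intro s _ r _ h
    exact cubicPencil_injective (congrFun h 3)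

lemma not_homogFiniteType_of_bigType [CharZero K] {t : ℕ → ℕ} {n : ℕ} (hn : 2 ≤ n)
    (hlow : ∀ i ≤ n - 1, t i = i + 1) (hmono : ∀ j, n - 1 ≤ j → t (j + 1) ≤ t j)
    (h : BigType t n) : ¬ HomogFiniteType K t := by
  rcases h with h | ⟨h, j, hj, h1, h2⟩ | ⟨h1, h3, h4, h2⟩ | ⟨rfl, h3, h4, h5⟩
  · exact not_homogFiniteType_of_four_le hn hlow hmono h
  · exact not_homogFiniteType_of_adjacent hn hlow hmono h hj h1 h2
  · exact not_homogFiniteType_of_first h4 hlow hmono h1 h3 h2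
  · exact not_homogFiniteType_of_cubics hlow hmono h3 h4 h5

end Cubics

/-- A Hilbert–Samuel sequence with `t 1 = 2` is of homogeneous finite type
if and only if `∑_{j ≥ n} (e j + 1) * e (j+1) ≤ 3`. -/
theorem stmt0 (K : Type*) [Field K] [IsAlgClosed K] [CharZero K]
    (t : ℕ → ℕ) (ht0 : t 0 = 1) (ht1 : t 1 = 2)
    (n : ℕ) (hn : 2 ≤ n)
    (hlow : ∀ i ≤ n - 1, t i = i + 1)
    (hmono : ∀ j, n - 1 ≤ j → t (j + 1) ≤ t j)
    (hfin : ∃ N, ∀ j ≥ N, t j = 0) :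
    HomogFiniteType K t ↔
      (∑ᶠ j ∈ {j : ℕ | n ≤ j}, (jump t n j + 1) * jump t n (j + 1)) ≤ 3 := by
  constructor
  · intro h
    exact finsum_jump_le_of_smallType hn hlow hmono hfin
      (smallType_of_not_bigType hn hlow hmono fun hb =>
        not_homogFiniteType_of_bigType hn hlow hmono hb h)
  · intro h
    exact homogFiniteType_of_smallType hn hlow hmono hfin
      (smallType_of_not_bigType hn hlow hmono fun hb =>
        absurd (finsum_jump_gt_of_bigType hn hlow hmono hfin hb) (not_lt.2 h))
end
end

section
/- Let K be a field and let I be a homogeneous ideal of K[x,y] such that K[x,y]/I is finite-dimensional over K and t_I(1) = 2. Then there exists n ≥ 2 such that t_I(i) = i+1 for all 0 ≤ i ≤ n−1 and t_I(j) ≥ t_I(j+1) for all j ≥ n−1. -/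
open MvPolynomial

noncomputable section

/-- The degree `k` part `I ∩ K[x,y]_k` of an ideal `I` of `K[x,y]`. -/
def Ideal.homogPart {K : Type*} [Field K] (I : Ideal (Pxy K)) (k : ℕ) : Submodule K (Pxy K) :=
  homogeneousSubmodule (Fin 2) K k ⊓ I.restrictScalars K

lemma Ideal.mem_homogPart {K : Type*} [Field K] {I : Ideal (Pxy K)} {k : ℕ} {f : Pxy K} :
    f ∈ I.homogPart k ↔ f.IsHomogeneous k ∧ f ∈ I := by
  simp [Ideal.homogPart]

instance finite_homogeneousSubmodule (K : Type*) [Field K] (k : ℕ) :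
    Module.Finite K (homogeneousSubmodule (Fin 2) K k) :=
  Module.Finite.iff_fg.mpr (homogeneousSubmodule_fg _ _ k)

instance Ideal.finite_homogPart {K : Type*} [Field K] (I : Ideal (Pxy K)) (k : ℕ) :
    Module.Finite K (I.homogPart k) :=
  Submodule.finiteDimensional_of_le (S₂ := homogeneousSubmodule (Fin 2) K k) inf_le_left

lemma finrank_homogeneousSubmodule (K : Type*) [Field K] (k : ℕ) :
    Module.finrank K (homogeneousSubmodule (Fin 2) K k) = k + 1 := by
  have e : {d : Fin 2 →₀ ℕ | d.degree = k} ≃ Finset.HasAntidiagonal.antidiagonal k :=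
    (Finsupp.equivFunOnFinite.trans (finTwoArrowEquiv ℕ)).subtypeEquiv fun d => by
      simp [Finsupp.degree_eq_sum, Fin.sum_univ_two]
  have h : homogeneousSubmodule (Fin 2) K k = restrictSupport K {d | d.degree = k} :=
    homogeneousSubmodule_eq_finsupp_supported _ _ k
  rw [h, Module.finrank_eq_nat_card_basis (basisRestrictSupport K _), Nat.card_congr e,
    Nat.card_eq_fintype_card, Fintype.card_coe, Finset.Nat.card_antidiagonal]

lemma hilb_add_finrank_homogPart (K : Type*) [Field K] (I : Ideal (Pxy K)) (k : ℕ) :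
    hilb K I k + Module.finrank K (I.homogPart k) = k + 1 := by
  rw [← finrank_homogeneousSubmodule K k,
    ← Submodule.finrank_quotient_add_finrank (Submodule.comap
      (homogeneousSubmodule (Fin 2) K k).subtype (I.restrictScalars K)), hilb,
    ← Submodule.finrank_map_subtype_eq, Submodule.map_comap_subtype, Ideal.homogPart]

/-- If multiplication by `x` maps a space `V` of polynomials onto a space containing `y V`, then
`V = 0`, as its elements are divisible by all powers of `x`. -/
lemma eq_bot_of_X_mul_mem_map {K : Type*} [Field K] {V : Submodule K (Pxy K)}
    (h : ∀ v ∈ V, X 1 * v ∈ V.map (LinearMap.mulLeft K (X 0))) : V = ⊥ := by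
  have hdvd (k : ℕ) : ∀ v ∈ V, (X 0 : Pxy K) ^ k ∣ v := by
    induction k with
    | zero => simp
    | succ k ih =>
      intro v hv
      obtain ⟨w, hw, hwv⟩ := h v hv
      refine X_prime.pow_dvd_of_dvd_mul_left _ (a := (X 1 : Pxy K)) (by simp [X_dvd_X]) ?_
      rw [← hwv, LinearMap.mulLeft_apply, pow_succ']
      exact mul_dvd_mul_left _ (ih w hw)
  refine (Submodule.eq_bot_iff _).mpr fun v hv => by_contra fun hv0 => ?_
  have := totalDegree_le_of_dvd_of_isDomain (hdvd (v.totalDegree + 1) v hv) hv0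
  simp at this

lemma Ideal.X_mul_mem_homogPart {K : Type*} [Field K] {I : Ideal (Pxy K)} {k : ℕ} (i : Fin 2)
    {f : Pxy K} (hf : f ∈ I.homogPart k) : X i * f ∈ I.homogPart (k + 1) := by
  rw [Ideal.mem_homogPart] at hf ⊢
  exact ⟨add_comm 1 k ▸ (isHomogeneous_X K i).mul hf.1, I.mul_mem_left _ hf.2⟩

lemma Ideal.finrank_homogPart_lt_succ {K : Type*} [Field K] {I : Ideal (Pxy K)} {k : ℕ}
    (h : I.homogPart k ≠ ⊥) :
    Module.finrank K (I.homogPart k) < Module.finrank K (I.homogPart (k + 1)) := by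
  have hinj : Function.Injective (LinearMap.mulLeft K (X 0 : Pxy K)) :=
    mul_right_injective₀ (X_ne_zero 0)
  rw [(Submodule.equivMapOfInjective _ hinj (I.homogPart k)).finrank_eq]
  refine Submodule.finrank_lt_finrank_of_lt (lt_of_le_of_ne ?_ fun heq => h ?_)
  · rintro _ ⟨f, hf, rfl⟩
    exact I.X_mul_mem_homogPart 0 hf
  · exact eq_bot_of_X_mul_mem_map fun v hv => heq ▸ I.X_mul_mem_homogPart 1 hv

lemma exists_homogPart_ne_bot {K : Type*} [Field K] {I : Ideal (Pxy K)} (hI : IsHomog I)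
    (hfd : FiniteDimensional K (Pxy K ⧸ I)) : ∃ k, I.homogPart k ≠ ⊥ := by
  by_contra! h
  have hbot (f : Pxy K) (hf : f ∈ I) : f = 0 := by
    rw [← sum_homogeneousComponent f]
    refine Finset.sum_eq_zero fun k _ => ?_
    rw [← Submodule.mem_bot K, ← h k, Ideal.mem_homogPart]
    exact ⟨homogeneousComponent_isHomogeneous k f, hI f hf k⟩
  obtain ⟨p, hp, hp0⟩ := Algebra.IsAlgebraic.isAlgebraic (R := K) (Ideal.Quotient.mk I (X 0))
  refine transcendental_X (R := K) (0 : Fin 2) ⟨p, hp, hbot _ ?_⟩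
  rw [← Ideal.Quotient.eq_zero_iff_mem, ← hp0]
  exact (Polynomial.aeval_algHom_apply (Ideal.Quotient.mkₐ K I) (X 0) p).symm

/-- If `I` is a homogeneous ideal of `K[x,y]` of finite colength with `t_I(1) = 2`,
then the Hilbert function of `I` has the form
`(1, 2, 3, …, n, t_n, …)` with `n = t_{n-1} ≥ t_n ≥ t_{n+1} ≥ …`. -/
theorem stmt1 (K : Type*) [Field K] (I : Ideal (Pxy K)) (hI : IsHomog I)
    (hfd : FiniteDimensional K (Pxy K ⧸ I)) (h1 : hilb K I 1 = 2) :
    ∃ n, 2 ≤ n ∧ (∀ i ≤ n - 1, hilb K I i = i + 1) ∧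
      ∀ j, n - 1 ≤ j → hilb K I (j + 1) ≤ hilb K I j := by
  classical
  have hadd := hilb_add_finrank_homogPart K I
  have hpos (k : ℕ) : I.homogPart k ≠ ⊥ ↔ 0 < Module.finrank K (I.homogPart k) := by
    rw [Nat.pos_iff_ne_zero, Ne, Ne, Submodule.finrank_eq_zero]
  have hstep (k : ℕ) (hk : I.homogPart k ≠ ⊥) := Ideal.finrank_homogPart_lt_succ hk
  have hex := exists_homogPart_ne_bot hI hfd
  have hmono (j : ℕ) (hj : Nat.find hex ≤ j) : I.homogPart j ≠ ⊥ := by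
    induction j, hj using Nat.le_induction with
    | base => exact Nat.find_spec hex
    | succ j _ ih => exact (hpos _).mpr (Nat.zero_lt_of_lt (hstep j ih))
  have hlow (i : ℕ) (hi : i < Nat.find hex) : Module.finrank K (I.homogPart i) = 0 := by
    have := Nat.find_min hex hi
    rw [hpos] at this
    omega
  have htwo : 2 ≤ Nat.find hex := by
    by_contra! hlt
    have := (hpos 1).mp (hmono 1 (by omega))
    have := hadd 1
    omega
  refine ⟨Nat.find hex, htwo, fun i hi => ?_, fun j hj => ?_⟩
  · have := hlow i (by omega)
    have := hadd i
    omega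
  · have := hadd j
    have := hadd (j + 1)
    rcases hj.eq_or_lt with rfl | hj
    · have := hlow (Nat.find hex - 1) (by omega)
      have := (hpos _).mp (hmono (Nat.find hex - 1 + 1) (by omega))
      omega
    · have := hstep j (hmono j (by omega))
      omega
end
end

section
/- Let K be a field, let n ≥ 2, and let t : ℕ → ℕ satisfy t(i) = i+1 for all 0 ≤ i ≤ n−1, t(j) ≥ t(j+1) for all j ≥ n−1, and t(j) = 0 for all sufficiently large j. Then there exists a homogeneous ideal I of K[x,y] with K[x,y]/I finite-dimensional over K and t_I(k) = t(k) for every k ≥ 0. -/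
open MvPolynomial

noncomputable section

/-- The exponent vector of the monomial `x ^ a * y ^ b`. -/
def expo (a b : ℕ) : Fin 2 →₀ ℕ := Finsupp.single 0 a + Finsupp.single 1 b

@[simp] lemma expo_zero (a b : ℕ) : expo a b 0 = a := by simp [expo]

@[simp] lemma expo_one (a b : ℕ) : expo a b 1 = b := by simp [expo]

lemma expo_eta (m : Fin 2 →₀ ℕ) : expo (m 0) (m 1) = m := by
  ext i; fin_cases i <;> simp

lemma degree_fin_two (m : Fin 2 →₀ ℕ) : m.degree = m 0 + m 1 := by
  simp [Finsupp.degree_eq_sum, Fin.sum_univ_two]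

/-- The ideal spanned by the monomials `x ^ a * y ^ b` with `t (a + b) ≤ a`. -/
def lexIdeal (K : Type*) [Field K] (t : ℕ → ℕ) : Ideal (Pxy K) :=
  Ideal.span ((fun m => monomial m (1 : K)) '' {m : Fin 2 →₀ ℕ | t (m 0 + m 1) ≤ m 0})

lemma mem_lexIdeal {K : Type*} [Field K] {t : ℕ → ℕ}
    (ht : ∀ a b c d, t (a + b) ≤ a → a ≤ c → b ≤ d → t (c + d) ≤ c) (f : Pxy K) :
    f ∈ lexIdeal K t ↔ ∀ m, coeff m f ≠ 0 → t (m 0 + m 1) ≤ m 0 := by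
  simp only [lexIdeal, mem_ideal_span_monomial_image, mem_support_iff, Set.mem_ofPred_eq]
  refine forall₂_congr fun m _ => ⟨?_, fun h => ⟨m, h, le_rfl⟩⟩
  rintro ⟨s, hs, hsm⟩
  exact ht _ _ _ _ hs (hsm 0) (hsm 1)

/-- The coefficients of `x ^ a * y ^ (k - a)` for `a < r`, as a linear map on forms of
degree `k`. -/
def coeffMap (K : Type*) [Field K] (k r : ℕ) :
    homogeneousSubmodule (Fin 2) K k →ₗ[K] (Fin r → K) :=
  LinearMap.pi fun a => lcoeff K (expo a (k - a)) ∘ₗ (homogeneousSubmodule (Fin 2) K k).subtype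

lemma coeffMap_apply {K : Type*} [Field K] (k r : ℕ) (f : homogeneousSubmodule (Fin 2) K k)
    (a : Fin r) : coeffMap K k r f a = coeff (expo a (k - a)) (f : Pxy K) := rfl

lemma coeffMap_surjective (K : Type*) [Field K] {k r : ℕ} (hr : r ≤ k + 1) :
    Function.Surjective (coeffMap K k r) := by
  classical
  intro v
  refine ⟨⟨∑ a : Fin r, monomial (expo a (k - a)) (v a), ?_⟩, ?_⟩
  · refine Submodule.sum_mem _ fun a _ => ?_
    rw [mem_homogeneousSubmodule]
    apply isHomogeneous_monomial
    rw [degree_fin_two, expo_zero, expo_one]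
    omega
  · ext b
    rw [coeffMap_apply, coeff_sum, Finset.sum_eq_single b]
    · simp
    · intro a _ hab
      rw [coeff_monomial, if_neg]
      intro h
      have := DFunLike.congr_fun h 0
      simp only [expo_zero] at this
      exact hab (Fin.ext this)
    · simp

lemma hilb_lexIdeal {K : Type*} [Field K] {t : ℕ → ℕ}
    (ht : ∀ a b c d, t (a + b) ≤ a → a ≤ c → b ≤ d → t (c + d) ≤ c) {k : ℕ}
    (hk : t k ≤ k + 1) : hilb K (lexIdeal K t) k = t k := by
  have hker : Submodule.comap (homogeneousSubmodule (Fin 2) K k).subtype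
      ((lexIdeal K t).restrictScalars K) = LinearMap.ker (coeffMap K k (t k)) := by
    ext f
    rw [Submodule.mem_comap, Submodule.restrictScalars_mem, mem_lexIdeal ht, LinearMap.mem_ker]
    constructor
    · intro h
      ext a
      rw [coeffMap_apply]
      by_contra hne
      have := h _ hne
      have ha := a.2
      rw [expo_zero, expo_one, show (a : ℕ) + (k - a) = k by omega] at this
      omega
    · intro h m hm
      have hd : m 0 + m 1 = k := by
        have h2 := (mem_homogeneousSubmodule k (f : Pxy K)).1 f.2
        rw [← degree_fin_two, Finsupp.degree_eq_weight_one]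
        exact h2 hm
      by_contra! hlt
      rw [hd] at hlt
      apply hm
      have h3 := congrFun h ⟨m 0, hlt⟩
      rw [coeffMap_apply] at h3
      have h4 : k - m 0 = m 1 := by omega
      simpa [h4, expo_eta] using h3
  rw [hilb, hker, (LinearMap.quotKerEquivOfSurjective _ (coeffMap_surjective K hk)).finrank_eq,
    Module.finrank_fin_fun]

lemma isHomog_lexIdeal {K : Type*} [Field K] {t : ℕ → ℕ}
    (ht : ∀ a b c d, t (a + b) ≤ a → a ≤ c → b ≤ d → t (c + d) ≤ c) :
    IsHomog (lexIdeal K t) := by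
  intro f hf k
  rw [mem_lexIdeal ht] at hf ⊢
  intro m hm
  rw [coeff_homogeneousComponent] at hm
  exact hf m fun h => hm (by simp [h])

lemma finiteDimensional_quotient_lexIdeal {K : Type*} [Field K] {t : ℕ → ℕ}
    (ht : ∀ a b c d, t (a + b) ≤ a → a ≤ c → b ≤ d → t (c + d) ≤ c)
    (hfin : ∃ N, ∀ j ≥ N, t j = 0) : FiniteDimensional K (Pxy K ⧸ lexIdeal K t) := by
  obtain ⟨N, hN⟩ := hfin
  let L : Pxy K →ₗ[K] (Fin N × Fin N → K) := LinearMap.pi fun p => lcoeff K (expo p.1 p.2)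
  have hL : LinearMap.ker L ≤ LinearMap.ker (Ideal.Quotient.mkₐ K (lexIdeal K t)).toLinearMap := by
    intro f hf
    rw [LinearMap.mem_ker] at hf ⊢
    refine Ideal.Quotient.eq_zero_iff_mem.2 ((mem_lexIdeal ht f).2 fun m hm => ?_)
    by_contra! hlt
    have hlt' : m 0 + m 1 < N := by
      by_contra! hge
      rw [hN _ hge] at hlt
      omega
    have h : coeff (expo (m 0) (m 1)) f = 0 :=
      congrFun hf (⟨m 0, by omega⟩, ⟨m 1, by omega⟩)
    rw [expo_eta] at h
    exact hm h
  have : Module.Finite K (Pxy K ⧸ LinearMap.ker L) :=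
    Module.Finite.equiv L.quotKerEquivRange.symm
  refine Module.Finite.of_surjective ((LinearMap.ker L).liftQ _ hL) ?_
  rw [← LinearMap.range_eq_top, Submodule.range_liftQ, LinearMap.range_eq_top]
  exact Ideal.Quotient.mkₐ_surjective K _

/-- For any sequence of the form `(1, 2, …, n, t_n, …, t_{n+k})` with
`n = t_{n-1} ≥ t_n ≥ … ≥ t_{n+k}` there is a homogeneous ideal of `K[x,y]`
of finite colength realizing it as its Hilbert function. -/
theorem stmt2 (K : Type*) [Field K] (n : ℕ) (hn : 2 ≤ n) (t : ℕ → ℕ)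
    (hlow : ∀ i ≤ n - 1, t i = i + 1)
    (hmono : ∀ j, n - 1 ≤ j → t (j + 1) ≤ t j)
    (hfin : ∃ N, ∀ j ≥ N, t j = 0) :
    ∃ I : Ideal (Pxy K), IsHomog I ∧ FiniteDimensional K (Pxy K ⧸ I) ∧
      ∀ k, hilb K I k = t k := by
  have hle : ∀ k, t k ≤ k + 1 := by
    intro k
    induction k with
    | zero => rw [hlow 0 (by omega)]
    | succ k ih =>
      rcases le_or_gt (k + 1) (n - 1) with h | h
      · rw [hlow _ h]
      · have := hmono k (by omega)
        omega
  have hdecr : ∀ d a k, n - 1 ≤ k → t k ≤ a → t (k + d) ≤ a := by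
    intro d a k hk ha
    induction d with
    | zero => exact ha
    | succ d ih => exact (hmono (k + d) (by omega)).trans ih
  have ht : ∀ a b c d, t (a + b) ≤ a → a ≤ c → b ≤ d → t (c + d) ≤ c := by
    intro a b c d h hac hbd
    have hab : n - 1 ≤ a + b := by
      by_contra! hlt
      rw [hlow _ hlt.le] at h
      omega
    have := hdecr (c + d - (a + b)) a (a + b) hab h
    rw [show a + b + (c + d - (a + b)) = c + d by omega] at this
    omega
  exact ⟨lexIdeal K t, isHomog_lexIdeal ht, finiteDimensional_quotient_lexIdeal ht hfin,
    fun k => hilb_lexIdeal ht (hle k)⟩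
end
end

section
/- Let K be an algebraically closed field of characteristic 0 and let n ≥ 2. Let R be a local Artinian K-algebra whose Hilbert–Samuel sequence satisfies t_i(R) = i+1 for 0 ≤ i ≤ n−1 and t_i(R) = 0 for i ≥ n (equivalently, m^n = 0). Then R is isomorphic as a K-algebra to K[x,y]/(x,y)^n, where (x,y) is the ideal generated by the two variables. -/
open MvPolynomial

noncomputable section

/-- The Hilbert–Samuel sequence of a local algebra:
`t_k(R) = dim_K (m^k / m^(k+1))`. -/
def hsSeq (K : Type*) [Field K] (R : Type*) [CommRing R] [Algebra K R]
    [IsLocalRing R] (k : ℕ) : ℕ :=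
  Module.finrank K
    (((IsLocalRing.maximalIdeal R ^ k).restrictScalars K) ⧸
      Submodule.comap ((IsLocalRing.maximalIdeal R ^ k).restrictScalars K).subtype
        ((IsLocalRing.maximalIdeal R ^ (k + 1)).restrictScalars K))

/-- The dimension of a finite-dimensional local algebra is the sum of the first `k` values of its
Hilbert–Samuel sequence plus the dimension of the `k`-th power of the maximal ideal. -/
theorem finrank_eq_sum_hsSeq_add (K : Type*) [Field K] (R : Type*) [CommRing R] [Algebra K R]
    [IsLocalRing R] [FiniteDimensional K R] (k : ℕ) :
    Module.finrank K R = ∑ i ∈ Finset.range k, hsSeq K R i +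
      Module.finrank K ((IsLocalRing.maximalIdeal R ^ k).restrictScalars K) := by
  induction k with
  | zero =>
    rw [Finset.sum_range_zero, zero_add, pow_zero, Ideal.one_eq_top,
      Submodule.restrictScalars_top, finrank_top]
  | succ k ih =>
    have hle : (IsLocalRing.maximalIdeal R ^ (k + 1)).restrictScalars K ≤
        (IsLocalRing.maximalIdeal R ^ k).restrictScalars K :=
      fun x hx => Ideal.pow_le_pow_right k.le_succ hx
    have h := Submodule.finrank_quotient_add_finrank
      (Submodule.comap ((IsLocalRing.maximalIdeal R ^ k).restrictScalars K).subtype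
        ((IsLocalRing.maximalIdeal R ^ (k + 1)).restrictScalars K))
    rw [(Submodule.comapSubtypeEquivOfLe hle).finrank_eq] at h
    rw [Finset.sum_range_succ, ih, ← h, hsSeq, add_assoc]

/-- If the Hilbert–Samuel sequence vanishes at `n`, so does the `n`-th power of the maximal
ideal. -/
theorem maximalIdeal_pow_eq_bot_of_hsSeq_eq_zero {K : Type*} [Field K] {R : Type*} [CommRing R]
    [Algebra K R] [IsLocalRing R] [FiniteDimensional K R] {n : ℕ} (h : hsSeq K R n = 0) :
    IsLocalRing.maximalIdeal R ^ n = ⊥ := by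
  have : IsNoetherianRing R := IsNoetherianRing.of_finite K R
  have hle : IsLocalRing.maximalIdeal R ^ n ≤ IsLocalRing.maximalIdeal R ^ (n + 1) := by
    rw [hsSeq, Module.finrank_zero_iff, Submodule.Quotient.subsingleton_iff] at h
    intro x hx
    exact (h.symm ▸ Submodule.mem_top :
      (⟨x, hx⟩ : (IsLocalRing.maximalIdeal R ^ n).restrictScalars K) ∈ Submodule.comap _ _)
  refine Submodule.eq_bot_of_le_smul_of_le_jacobson_bot (IsLocalRing.maximalIdeal R) _
    (IsNoetherian.noetherian _) ?_ (IsLocalRing.maximalIdeal_le_jacobson _)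
  rwa [smul_eq_mul, ← pow_succ']

/-- A local algebra of embedding dimension two has a maximal ideal generated by two elements. -/
theorem exists_maximalIdeal_eq_span_pair {K : Type*} [Field K] {R : Type*} [CommRing R]
    [Algebra K R] [IsLocalRing R] [FiniteDimensional K R] (h : hsSeq K R 1 = 2) :
    ∃ a b : R, IsLocalRing.maximalIdeal R = Ideal.span {a, b} := by
  have : IsNoetherianRing R := IsNoetherianRing.of_finite K R
  let e := Module.finBasisOfFinrankEq K _ h
  obtain ⟨a, ha⟩ := Submodule.Quotient.mk_surjective _ (e 0)
  obtain ⟨b, hb⟩ := Submodule.Quotient.mk_surjective _ (e 1)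
  have ham : (a : R) ∈ IsLocalRing.maximalIdeal R := by simpa using a.2
  have hbm : (b : R) ∈ IsLocalRing.maximalIdeal R := by simpa using b.2
  refine ⟨a, b, le_antisymm ?_ ?_⟩
  · refine Submodule.le_of_le_smul_of_le_jacobson_bot (I := IsLocalRing.maximalIdeal R)
      (IsNoetherian.noetherian _) (IsLocalRing.maximalIdeal_le_jacobson _) ?_
    intro z hz
    have hz1 : z ∈ (IsLocalRing.maximalIdeal R ^ 1).restrictScalars K := by simpa using hz
    have hs := e.sum_repr (Submodule.Quotient.mk ⟨z, hz1⟩)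
    rw [Fin.sum_univ_two, ← ha, ← hb, ← Submodule.Quotient.mk_smul, ← Submodule.Quotient.mk_smul,
      ← Submodule.Quotient.mk_add, eq_comm, Submodule.Quotient.eq] at hs
    set c := e.repr (Submodule.Quotient.mk ⟨z, hz1⟩) 0
    set d := e.repr (Submodule.Quotient.mk ⟨z, hz1⟩) 1
    have hs' : z - (c • (a : R) + d • (b : R)) ∈ IsLocalRing.maximalIdeal R ^ 2 := hs
    rw [smul_eq_mul, ← pow_two, ← add_sub_cancel (c • (a : R) + d • (b : R)) z]
    refine Submodule.add_mem_sup (Ideal.mem_span_pair.2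
      ⟨algebraMap K R c, algebraMap K R d, ?_⟩) hs'
    simp only [Algebra.smul_def]
  · rw [Ideal.span_le]
    rintro x (rfl | rfl)
    exacts [ham, hbm]

/-- Generators of the maximal ideal of a local algebra with residue field `K` and nilpotent maximal
ideal generate the algebra. -/
theorem aeval_surjective_of_maximalIdeal_eq_span_pair {K : Type*} [Field K] {R : Type*}
    [CommRing R] [Algebra K R] [IsLocalRing R] {n : ℕ} {a b : R}
    (hres : ∀ r : R, ∃ c : K, r - algebraMap K R c ∈ IsLocalRing.maximalIdeal R)
    (hab : IsLocalRing.maximalIdeal R = Ideal.span {a, b})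
    (hn : IsLocalRing.maximalIdeal R ^ n = ⊥) :
    Function.Surjective (aeval ![a, b] : Pxy K →ₐ[K] R) := by
  have key : ∀ k : ℕ, ∀ r : R, ∃ p : Pxy K,
      r - aeval ![a, b] p ∈ IsLocalRing.maximalIdeal R ^ k := by
    intro k
    induction k with
    | zero => exact fun r => ⟨0, by simp⟩
    | succ k ih =>
      intro r
      obtain ⟨c, hc⟩ := hres r
      have ha : a ∈ IsLocalRing.maximalIdeal R := hab ▸ Ideal.subset_span (by simp)
      have hb : b ∈ IsLocalRing.maximalIdeal R := hab ▸ Ideal.subset_span (by simp)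
      obtain ⟨u, v, huv⟩ := Ideal.mem_span_pair.1 (hab ▸ hc)
      obtain ⟨p, hp⟩ := ih u
      obtain ⟨q, hq⟩ := ih v
      refine ⟨C c + p * X 0 + q * X 1, ?_⟩
      have : r - aeval ![a, b] (C c + p * X 0 + q * X 1) =
          (u - aeval ![a, b] p) * a + (v - aeval ![a, b] q) * b := by
        simp only [map_add, map_mul, aeval_X, algHom_C, Matrix.cons_val_zero, Matrix.cons_val_one]
        linear_combination -huv
      rw [this, pow_succ]
      exact add_mem (Ideal.mul_mem_mul hp ha) (Ideal.mul_mem_mul hq hb)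
  intro r
  obtain ⟨p, hp⟩ := key n r
  rw [hn, Ideal.mem_bot, sub_eq_zero] at hp
  exact ⟨p, hp.symm⟩

/-- The monomials of degree less than `n` span `K[x,y]/(x,y)^n`. -/
theorem span_monomials_quotient_eq_top (K : Type*) [Field K] (n : ℕ) :
    Submodule.span K (Set.range
      fun s : (Finset.range n).sigma fun k => Finset.HasAntidiagonal.antidiagonal k =>
        Ideal.Quotient.mk ((Ideal.span {X 0, X 1} : Ideal (Pxy K)) ^ n)
          (X 0 ^ s.1.2.1 * X 1 ^ s.1.2.2)) = ⊤ := by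
  rw [eq_top_iff]
  rintro z -
  obtain ⟨p, rfl⟩ := Ideal.Quotient.mk_surjective z
  induction p using MvPolynomial.induction_on' with
  | add p q hp hq => rw [map_add]; exact add_mem hp hq
  | monomial s c =>
    have hmon : (monomial s c : Pxy K) = c • (X 0 ^ s 0 * X 1 ^ s 1) := by
      rw [monomial_eq, Finsupp.prod_fintype _ _ (by simp), Fin.prod_univ_two, smul_eq_C_mul]
    have hmk : Ideal.Quotient.mk ((Ideal.span {X 0, X 1} : Ideal (Pxy K)) ^ n)
        (c • (X 0 ^ s 0 * X 1 ^ s 1)) = c • Ideal.Quotient.mk _ (X 0 ^ s 0 * X 1 ^ s 1) := rfl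
    rw [hmon, hmk]
    refine Submodule.smul_mem _ _ ?_
    rcases lt_or_ge (s 0 + s 1) n with h | h
    · refine Submodule.subset_span ⟨⟨⟨s 0 + s 1, (s 0, s 1)⟩, ?_⟩, rfl⟩
      simpa using h
    · have hmem : (X 0 ^ s 0 * X 1 ^ s 1 : Pxy K) ∈ Ideal.span {X 0, X 1} ^ n := by
        refine Ideal.pow_le_pow_right h ?_
        rw [pow_add]
        exact Ideal.mul_mem_mul (Ideal.pow_mem_pow (Ideal.subset_span (by simp)) _)
          (Ideal.pow_mem_pow (Ideal.subset_span (by simp)) _)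
      rw [Ideal.Quotient.eq_zero_iff_mem.2 hmem]
      exact zero_mem _

instance finite_quotient_span_pow (K : Type*) [Field K] (n : ℕ) :
    Module.Finite K (Pxy K ⧸ (Ideal.span {X 0, X 1} : Ideal (Pxy K)) ^ n) :=
  .of_fg_top (span_monomials_quotient_eq_top K n ▸ Submodule.fg_span (Set.finite_range _))

theorem finrank_quotient_span_pow_le (K : Type*) [Field K] (n : ℕ) :
    Module.finrank K (Pxy K ⧸ (Ideal.span {X 0, X 1} : Ideal (Pxy K)) ^ n) ≤
      ∑ k ∈ Finset.range n, (k + 1) := by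
  have h := finrank_range_le_card (R := K) (fun s : (Finset.range n).sigma
    fun k => Finset.HasAntidiagonal.antidiagonal k =>
      Ideal.Quotient.mk ((Ideal.span {X 0, X 1} : Ideal (Pxy K)) ^ n)
        (X 0 ^ s.1.2.1 * X 1 ^ s.1.2.2))
  rw [Set.finrank, span_monomials_quotient_eq_top, finrank_top, Fintype.card_coe,
    Finset.card_sigma] at h
  simpa only [Finset.Nat.card_antidiagonal] using h

/-- A local Artinian algebra of type `(1, 2, …, n)` is isomorphic to
`K[x,y]/(x,y)^n`. -/
theorem stmt4 (K : Type*) [Field K] [IsAlgClosed K] [CharZero K]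
    (R : Type*) [CommRing R] [Algebra K R] [IsLocalRing R] [FiniteDimensional K R]
    (n : ℕ) (hn : 2 ≤ n)
    (hlow : ∀ i ≤ n - 1, hsSeq K R i = i + 1)
    (hhigh : ∀ i, n ≤ i → hsSeq K R i = 0) :
    Nonempty (R ≃ₐ[K] (Pxy K ⧸ (Ideal.span {X 0, X 1} : Ideal (Pxy K)) ^ n)) := by
  have hbot := maximalIdeal_pow_eq_bot_of_hsSeq_eq_zero (hhigh n le_rfl)
  obtain ⟨a, b, hab⟩ := exists_maximalIdeal_eq_span_pair (hlow 1 (by omega))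
  have hres : ∀ r : R, ∃ c : K, r - algebraMap K R c ∈ IsLocalRing.maximalIdeal R := by
    intro r
    obtain ⟨c, hc⟩ := (IsAlgClosed.algebraMap_bijective_of_isIntegral
      (k := K) (K := IsLocalRing.ResidueField R)).2 (IsLocalRing.residue R r)
    refine ⟨c, ?_⟩
    rw [← IsLocalRing.residue_eq_zero_iff, map_sub, sub_eq_zero, ← hc]
    rfl
  have hsurj := aeval_surjective_of_maximalIdeal_eq_span_pair hres hab hbot
  have hker : ∀ p ∈ (Ideal.span {X 0, X 1} : Ideal (Pxy K)) ^ n,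
      (aeval ![a, b] : Pxy K →ₐ[K] R) p = 0 := by
    intro p hp
    have h := Ideal.mem_map_of_mem (aeval ![a, b] : Pxy K →ₐ[K] R) hp
    rw [Ideal.map_pow, Ideal.map_span, Set.image_pair, aeval_X, aeval_X, Matrix.cons_val_zero,
      Matrix.cons_val_one, Matrix.cons_val_zero, ← hab, hbot] at h
    exact h
  let f := Ideal.Quotient.liftₐ _ (aeval ![a, b] : Pxy K →ₐ[K] R) hker
  have hf : Function.Surjective f := Ideal.Quotient.lift_surjective_of_surjective _ _ hsurj
  have hdim : Module.finrank K R = ∑ k ∈ Finset.range n, (k + 1) := by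
    rw [finrank_eq_sum_hsSeq_add K R n, hbot, Submodule.restrictScalars_bot, finrank_bot, add_zero]
    exact Finset.sum_congr rfl fun i hi => hlow i (by have := Finset.mem_range.1 hi; omega)
  have hrank : Module.finrank K (Pxy K ⧸ (Ideal.span {X 0, X 1} : Ideal (Pxy K)) ^ n) =
      Module.finrank K R :=
    le_antisymm (hdim ▸ finrank_quotient_span_pow_le K n)
      (LinearMap.finrank_le_finrank_of_surjective (f := f.toLinearMap) hf)
  have hinj : Function.Injective f :=
    (LinearMap.injective_iff_surjective_of_finrank_eq_finrank (f := f.toLinearMap) hrank).2 hf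
  exact ⟨(AlgEquiv.ofBijective f ⟨hinj, hf⟩).symm⟩
end
end
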